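/- Let n ≥ 3, m ≥ 2 and ζ > 2. Let f : ℝⁿ → ℝ be continuous, C^m outside some compact set, with finite limit f(∞) = lim_{|x|→∞} f(x) and limsup_{|x|→∞} |x|^{ζ+k} |D^k(f(x) − f(∞))| < ∞ for every k = 0,1,…,m. Let u ∈ C²(ℝⁿ) satisfy −√2 Σᵢ 1/(1+λᵢ(D²u(x))) = f(x) for all x ∈ ℝⁿ, and suppose u(x) ≤ C(1+|x|²) for all x ∈ ℝⁿ for some constant C, and D²u(x) + I is positive definite for every x. Then there exist c ∈ ℝ, b ∈ ℝⁿ and a symmetric n×n matrix A with A + I positive definite and −√2 Σᵢ 1/(1+λᵢ(A)) = f(∞), such that u(x) − (½ xᵀA x + b·x + c) = O_{m+1}(|x|^{2−min{n,ζ}}) as |x| → ∞ if ζ ≠ n, and = O_{m+1}(|x|^{2−n} ln|x|) if ζ = n. -/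

import Mathlib

open Filter

/-- The Hessian matrix `(∂ᵢ∂ⱼ u(x))` of a function on Euclidean space. -/
noncomputable def hess {n : ℕ} (u : EuclideanSpace ℝ (Fin n) → ℝ)
    (x : EuclideanSpace ℝ (Fin n)) : Matrix (Fin n) (Fin n) ℝ :=
  Matrix.of fun i j =>
    iteratedFDeriv ℝ 2 u x ![EuclideanSpace.single i 1, EuclideanSpace.single j 1]

set_option linter.unusedSectionVars false


section PartOne
open Filter Bornology Topology

/-- Admissible weights: eventually positive and doubling at infinity. -/
def Wt (σ : ℝ → ℝ) : Prop :=
  (∀ᶠ r in atTop, 0 < σ r) ∧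
  ∀ Λ : ℝ, 1 ≤ Λ → ∃ C : ℝ, 0 < C ∧ ∀ᶠ r in atTop, ∀ s, r ≤ Λ * s → s ≤ Λ * r → σ s ≤ C * σ r

/-- Symbol type classes with Hölder exponent one half. -/
def SH {V : Type} [NormedAddCommGroup V] [NormedSpace ℝ V] :
    (k : ℕ) → (E : Type) → [NormedAddCommGroup E] → [NormedSpace ℝ E] → (V → E) → (ℝ → ℝ) → Prop
  | 0, _, _, _, q, σ => ∃ C δ : ℝ, 0 < C ∧ 0 < δ ∧ ∀ᶠ y in cobounded V,
      ‖q y‖ ≤ C * σ ‖y‖ ∧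
        ∀ y', ‖y' - y‖ ≤ δ * ‖y‖ → ‖q y' - q y‖ ≤ C * σ ‖y‖ * √(‖y' - y‖ / ‖y‖)
  | k + 1, E, _, _, q, σ => (∃ C : ℝ, 0 < C ∧ ∀ᶠ y in cobounded V,
      DifferentiableAt ℝ q y ∧ ‖q y‖ ≤ C * σ ‖y‖) ∧
      SH k (V →L[ℝ] E) (fderiv ℝ q) (fun r => σ r / r)

variable {V : Type} [NormedAddCommGroup V] [NormedSpace ℝ V]
variable {E F G : Type} [NormedAddCommGroup E] [NormedSpace ℝ E]
  [NormedAddCommGroup F] [NormedSpace ℝ F] [NormedAddCommGroup G] [NormedSpace ℝ G]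

lemma SH_zero_iff {q : V → E} {σ : ℝ → ℝ} : SH 0 E q σ ↔ ∃ C δ : ℝ, 0 < C ∧ 0 < δ ∧
    ∀ᶠ y in cobounded V, ‖q y‖ ≤ C * σ ‖y‖ ∧
      ∀ y', ‖y' - y‖ ≤ δ * ‖y‖ → ‖q y' - q y‖ ≤ C * σ ‖y‖ * √(‖y' - y‖ / ‖y‖) := by
  rw [SH]

lemma SH_succ_iff {k : ℕ} {q : V → E} {σ : ℝ → ℝ} : SH (k + 1) E q σ ↔
    (∃ C : ℝ, 0 < C ∧ ∀ᶠ y in cobounded V, DifferentiableAt ℝ q y ∧ ‖q y‖ ≤ C * σ ‖y‖) ∧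
      SH k (V →L[ℝ] E) (fderiv ℝ q) (fun r => σ r / r) := by
  rw [SH]

lemma ev_cob {P : V → Prop} : (∀ᶠ y in cobounded V, P y) ↔ ∃ R : ℝ, ∀ y, R ≤ ‖y‖ → P y := by
  rw [hasBasis_cobounded_norm.eventually_iff]
  simp

lemma ev_norm {P : ℝ → Prop} (h : ∀ᶠ r in atTop, P r) : ∀ᶠ y in cobounded V, P ‖y‖ :=
  tendsto_norm_cobounded_atTop.eventually h

lemma ev_pos : ∀ᶠ y in cobounded V, 0 < ‖y‖ := ev_norm (eventually_gt_atTop 0)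

lemma ev_ball {P : V → Prop} (h : ∀ᶠ y in cobounded V, P y) :
    ∀ᶠ y in cobounded V, ∀ y', ‖y' - y‖ ≤ (1/2) * ‖y‖ → P y' := by
  rw [ev_cob] at h ⊢
  obtain ⟨R, hR⟩ := h
  refine ⟨2 * R, fun y hy y' hy' => hR y' ?_⟩
  have := norm_sub_norm_le y (y - y')
  rw [sub_sub_cancel, norm_sub_rev y y'] at this
  linarith

lemma ev_nhds {P : V → Prop} (h : ∀ᶠ y in cobounded V, P y) :
    ∀ᶠ y in cobounded V, ∀ᶠ z in 𝓝 y, P z := by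
  filter_upwards [ev_ball h, ev_pos] with y hy hp
  have : Metric.ball y ((1/2) * ‖y‖) ∈ 𝓝 y := Metric.ball_mem_nhds _ (by positivity)
  filter_upwards [this] with z hz
  exact hy z (by rw [Metric.mem_ball, dist_eq_norm] at hz; exact hz.le)

lemma norm_comp_of_ball {y y' : V} (h : ‖y' - y‖ ≤ (1/2) * ‖y‖) :
    ‖y‖ ≤ 2 * ‖y'‖ ∧ ‖y'‖ ≤ 2 * ‖y‖ := by
  have h1 := norm_sub_norm_le y (y - y')
  rw [sub_sub_cancel, norm_sub_rev y y'] at h1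
  have h2 := norm_sub_norm_le y' y
  have := norm_nonneg y
  constructor <;> linarith

lemma Wt.ball {σ : ℝ → ℝ} (h : Wt σ) : ∃ C : ℝ, 0 < C ∧ ∀ᶠ y in cobounded V,
    ∀ y', ‖y' - y‖ ≤ (1/2) * ‖y‖ → σ ‖y'‖ ≤ C * σ ‖y‖ := by
  obtain ⟨C, hC, h2⟩ := h.2 2 (by norm_num)
  refine ⟨C, hC, ?_⟩
  filter_upwards [ev_norm h2] with y hy y' hy'
  exact hy _ (norm_comp_of_ball hy').1 (norm_comp_of_ball hy').2

lemma Wt.mul {σ τ : ℝ → ℝ} (h : Wt σ) (h' : Wt τ) : Wt (fun r => σ r * τ r) := by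
  refine ⟨?_, fun Λ hΛ => ?_⟩
  · filter_upwards [h.1, h'.1] with r h1 h2 using mul_pos h1 h2
  · obtain ⟨C, hC, h2⟩ := h.2 Λ hΛ
    obtain ⟨C', hC', h2'⟩ := h'.2 Λ hΛ
    have hp : ∀ᶠ r in atTop, ∀ s, r ≤ Λ * s → 0 < τ s := by
      obtain ⟨R, hR⟩ := eventually_atTop.1 h'.1
      filter_upwards [eventually_ge_atTop (Λ * R)] with r hr s hs
      exact hR s (le_of_mul_le_mul_left (hr.trans hs) (by linarith))
    refine ⟨C * C', by positivity, ?_⟩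
    filter_upwards [h2, h2', h.1, h'.1, hp] with r h3 h4 h5 h6 h7 s hs1 hs2
    calc σ s * τ s ≤ (C * σ r) * (C' * τ r) :=
          mul_le_mul (h3 s hs1 hs2) (h4 s hs1 hs2) (h7 s hs1).le (by positivity)
      _ = _ := by ring

lemma Wt.rpow (a : ℝ) : Wt (fun r => r ^ a) := by
  refine ⟨?_, fun Λ hΛ => ?_⟩
  · filter_upwards [eventually_gt_atTop 0] with r h1 using Real.rpow_pos_of_pos h1 _
  · have hL : 0 < Λ := by linarith
    refine ⟨Λ ^ |a|, by positivity, ?_⟩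
    filter_upwards [eventually_gt_atTop 0] with r hr s h1 h2
    have hs : 0 < s := by
      by_contra hs
      push Not at hs
      nlinarith
    rcases le_or_gt 0 a with ha | ha
    · rw [abs_of_nonneg ha, ← Real.mul_rpow hL.le hr.le]
      exact Real.rpow_le_rpow hs.le h2 ha
    · rw [abs_of_neg ha]
      have : s ^ a ≤ (r / Λ) ^ a := by
        apply Real.rpow_le_rpow_of_nonpos (by positivity) _ ha.le
        rw [div_le_iff₀ hL]; linarith
      refine this.trans (le_of_eq ?_)
      rw [Real.div_rpow hr.le hL.le, Real.rpow_neg hL.le]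
      field_simp

lemma Wt.congr {σ τ : ℝ → ℝ} (h : Wt σ) (he : σ =ᶠ[atTop] τ) : Wt τ := by
  refine ⟨?_, fun Λ hΛ => ?_⟩
  · filter_upwards [h.1, he] with r h1 h2 using h2 ▸ h1
  · obtain ⟨C, hC, h2⟩ := h.2 Λ hΛ
    obtain ⟨R, hR⟩ := eventually_atTop.1 he
    refine ⟨C, hC, ?_⟩
    filter_upwards [h2, he, eventually_ge_atTop (Λ * R)] with r h3 h4 h5 s hs1 hs2
    rw [← h4, ← hR s (le_of_mul_le_mul_left (h5.trans hs1) (by linarith))]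
    exact h3 s hs1 hs2

lemma Wt.div {σ : ℝ → ℝ} (h : Wt σ) : Wt (fun r => σ r / r) := by
  refine (h.mul (Wt.rpow (-1))).congr ?_
  filter_upwards with r
  rw [Real.rpow_neg_one, div_eq_mul_inv]

lemma Wt.one : Wt (fun _ => 1) := by
  simpa using Wt.rpow 0

lemma Wt.id : Wt (fun r => r) := by
  simpa using Wt.rpow 1

lemma SH.mono {k : ℕ} {q : V → E} {σ τ : ℝ → ℝ} (h : SH k E q σ)
    (hC : ∃ C : ℝ, ∀ᶠ r in atTop, σ r ≤ C * τ r) (hτ : ∀ᶠ r in atTop, 0 < τ r) : SH k E q τ := by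
  induction k generalizing E σ τ with
  | zero =>
    obtain ⟨C, hC⟩ := hC
    rw [SH_zero_iff] at h ⊢
    obtain ⟨C1, δ, h1, h2, h3⟩ := h
    refine ⟨C1 * (|C| + 1), δ, by positivity, h2, ?_⟩
    filter_upwards [h3, ev_norm hC, ev_norm hτ] with y h4 h5 h6
    have h7 : C1 * σ ‖y‖ ≤ C1 * (|C| + 1) * τ ‖y‖ := by
      have : C * τ ‖y‖ ≤ (|C| + 1) * τ ‖y‖ := by
        apply mul_le_mul_of_nonneg_right _ h6.le
        linarith [le_abs_self C]
      rw [mul_assoc]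
      exact mul_le_mul_of_nonneg_left (h5.trans this) h1.le
    refine ⟨h4.1.trans h7, fun y' hy' => (h4.2 y' hy').trans ?_⟩
    exact mul_le_mul_of_nonneg_right h7 (Real.sqrt_nonneg _)
  | succ k ih =>
    rw [SH_succ_iff] at h ⊢
    obtain ⟨⟨C1, h1, h3⟩, h2⟩ := h
    refine ⟨?_, ih h2 ?_ ?_⟩
    · obtain ⟨C, hC⟩ := hC
      refine ⟨C1 * (|C| + 1), by positivity, ?_⟩
      filter_upwards [h3, ev_norm hC, ev_norm hτ] with y h4 h5 h6
      refine ⟨h4.1, h4.2.trans ?_⟩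
      have : C * τ ‖y‖ ≤ (|C| + 1) * τ ‖y‖ := by
        apply mul_le_mul_of_nonneg_right _ h6.le
        linarith [le_abs_self C]
      rw [mul_assoc]
      exact mul_le_mul_of_nonneg_left (h5.trans this) h1.le
    · obtain ⟨C, hC⟩ := hC
      refine ⟨C, ?_⟩
      filter_upwards [hC, eventually_gt_atTop 0] with r h5 h6
      rw [← mul_div_assoc]
      gcongr
    · filter_upwards [hτ, eventually_gt_atTop 0] with r h5 h6
      positivity

lemma SH.congr_wt {k : ℕ} {q : V → E} {σ τ : ℝ → ℝ} (h : SH k E q σ)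
    (he : σ =ᶠ[atTop] τ) (hτ : ∀ᶠ r in atTop, 0 < τ r) : SH k E q τ :=
  h.mono ⟨1, by filter_upwards [he] with r hr using by rw [hr, one_mul]⟩ hτ

lemma SH.congr {k : ℕ} {q p : V → E} {σ : ℝ → ℝ} (h : SH k E q σ)
    (he : ∀ᶠ y in cobounded V, q y = p y) : SH k E p σ := by
  induction k generalizing E σ with
  | zero =>
    rw [SH_zero_iff] at h ⊢
    obtain ⟨C1, δ, h1, h2, h3⟩ := h
    refine ⟨C1, min δ (1/2), h1, by positivity, ?_⟩
    filter_upwards [h3, he, ev_ball he] with y h4 h5 h6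
    rw [← h5]
    refine ⟨h4.1, fun y' hy' => ?_⟩
    rw [← h6 y' (hy'.trans (by gcongr; exact min_le_right _ _))]
    exact h4.2 y' (hy'.trans (by gcongr; exact min_le_left _ _))
  | succ k ih =>
    rw [SH_succ_iff] at h ⊢
    obtain ⟨⟨C1, h1, h3⟩, h2⟩ := h
    refine ⟨⟨C1, h1, ?_⟩, ih h2 ?_⟩
    · filter_upwards [h3, he, ev_nhds he] with y h4 h5 h6
      exact ⟨h4.1.congr_of_eventuallyEq (by filter_upwards [h6] with z hz using hz.symm),
        h5 ▸ h4.2⟩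
    · filter_upwards [ev_nhds he] with y h6
      exact Filter.EventuallyEq.fderiv_eq h6

/-- Lipschitz type bounds give the Hölder class. -/
lemma SH_zero_of_lip {q : V → E} {σ : ℝ → ℝ} {C δ : ℝ} (hδ : 0 < δ)
    (hσ : ∀ᶠ r in atTop, 0 < σ r)
    (hb : ∀ᶠ y in cobounded V, ‖q y‖ ≤ C * σ ‖y‖)
    (hl : ∀ᶠ y in cobounded V, ∀ y', ‖y' - y‖ ≤ δ * ‖y‖ →
      ‖q y' - q y‖ ≤ C * (σ ‖y‖ / ‖y‖) * ‖y' - y‖) : SH 0 E q σ := by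
  rw [SH_zero_iff]
  refine ⟨|C| + 1, min δ 1, by positivity, by positivity, ?_⟩
  filter_upwards [hb, hl, ev_norm hσ, ev_pos] with y h1 h2 h3 h4
  have h5 : C * σ ‖y‖ ≤ (|C| + 1) * σ ‖y‖ := by
    apply mul_le_mul_of_nonneg_right _ h3.le
    linarith [le_abs_self C]
  refine ⟨h1.trans h5, fun y' hy' => ?_⟩
  have h6 := h2 y' (hy'.trans (by gcongr; exact min_le_left _ _))
  set s := ‖y' - y‖ / ‖y‖ with hs
  have hs0 : 0 ≤ s := by positivity
  have hs1 : s ≤ 1 := by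
    rw [hs, div_le_one h4]
    exact hy'.trans (mul_le_of_le_one_left h4.le (min_le_right _ _))
  have hss : s ≤ √s := by
    apply Real.le_sqrt_of_sq_le
    nlinarith
  calc ‖q y' - q y‖ ≤ C * σ ‖y‖ * s := by rw [hs]; refine h6.trans (le_of_eq ?_); ring
    _ ≤ (|C| + 1) * σ ‖y‖ * s := by gcongr
    _ ≤ _ := by gcongr

lemma SH_zero_of_deriv {q : V → E} {σ : ℝ → ℝ} {C : ℝ} (hσ : Wt σ)
    (hb : ∀ᶠ y in cobounded V, DifferentiableAt ℝ q y ∧ ‖q y‖ ≤ C * σ ‖y‖)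
    (hd : ∀ᶠ y in cobounded V, ‖fderiv ℝ q y‖ ≤ C * (σ ‖y‖ / ‖y‖)) : SH 0 E q σ := by
  obtain ⟨C', hC', hw⟩ := (hσ.div).ball (V := V)
  have hb' : ∀ᶠ y in cobounded V, ‖q y‖ ≤ |C| * (1 + C') * σ ‖y‖ := by
    filter_upwards [hb, ev_norm hσ.1] with y h1 h2
    refine h1.2.trans (mul_le_mul_of_nonneg_right ?_ h2.le)
    have := le_abs_self C
    nlinarith [abs_nonneg C]
  refine SH_zero_of_lip (δ := 1/2) (by norm_num) hσ.1 hb' ?_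
  filter_upwards [ev_ball hb, ev_ball hd, hw, ev_norm hσ.1, ev_pos, ev_ball (ev_norm hσ.div.1)]
    with y h1 h2 h3 h4 h5 h6 y' hy'
  have hconv : Convex ℝ (Metric.closedBall y ((1/2) * ‖y‖)) := convex_closedBall _ _
  refine hconv.norm_image_sub_le_of_norm_fderiv_le (𝕜 := ℝ) (f := q) (x := y) (y := y') ?_ ?_ ?_ ?_
  · intro z hz
    rw [Metric.mem_closedBall, dist_eq_norm] at hz
    exact (h1 z hz).1
  · intro z hz
    rw [Metric.mem_closedBall, dist_eq_norm] at hz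
    calc ‖fderiv ℝ q z‖ ≤ C * (σ ‖z‖ / ‖z‖) := h2 z hz
      _ ≤ |C| * (σ ‖z‖ / ‖z‖) := mul_le_mul_of_nonneg_right (le_abs_self C) (h6 z hz).le
      _ ≤ |C| * (C' * (σ ‖y‖ / ‖y‖)) := by gcongr; exact h3 z hz
      _ ≤ |C| * (1 + C') * (σ ‖y‖ / ‖y‖) := by
        rw [mul_assoc]
        have : 0 < σ ‖y‖ / ‖y‖ := by positivity
        gcongr
        linarith
  · exact Metric.mem_closedBall_self (by positivity)
  · rw [Metric.mem_closedBall, dist_eq_norm]; exact hy'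

lemma SH.bound {k : ℕ} {q : V → E} {σ : ℝ → ℝ} (h : SH k E q σ) :
    ∃ C : ℝ, 0 < C ∧ ∀ᶠ y in cobounded V, ‖q y‖ ≤ C * σ ‖y‖ := by
  cases k with
  | zero =>
    obtain ⟨C, δ, h1, h2, h3⟩ := SH_zero_iff.1 h
    exact ⟨C, h1, h3.mono fun y hy => hy.1⟩
  | succ k =>
    obtain ⟨⟨C, h1, h3⟩, _⟩ := SH_succ_iff.1 h
    exact ⟨C, h1, h3.mono fun y hy => hy.2⟩

lemma SH.diff {k : ℕ} {q : V → E} {σ : ℝ → ℝ} (h : SH (k+1) E q σ) :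
    ∀ᶠ y in cobounded V, DifferentiableAt ℝ q y := by
  obtain ⟨⟨C, h1, h3⟩, _⟩ := SH_succ_iff.1 h
  exact h3.mono fun y hy => hy.1

lemma SH.fderiv {k : ℕ} {q : V → E} {σ : ℝ → ℝ} (h : SH (k+1) E q σ) :
    SH k (V →L[ℝ] E) (fderiv ℝ q) (fun r => σ r / r) := (SH_succ_iff.1 h).2

lemma SH.pred {k : ℕ} {q : V → E} {σ : ℝ → ℝ} (h : SH (k+1) E q σ) (hσ : Wt σ) : SH k E q σ := by
  induction k generalizing E σ with
  | zero =>
    obtain ⟨⟨C, h1, h3⟩, h4⟩ := SH_succ_iff.1 h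
    obtain ⟨C', h5, h6⟩ := h4.bound
    refine SH_zero_of_deriv (C := max C C') hσ ?_ ?_
    · filter_upwards [h3, ev_norm hσ.1] with y hy hp
      exact ⟨hy.1, hy.2.trans (by gcongr; exact le_max_left _ _)⟩
    · filter_upwards [h6, ev_norm hσ.1] with y hy hp
      exact hy.trans (by gcongr; exact le_max_right _ _)
  | succ k ih =>
    obtain ⟨h3, h4⟩ := SH_succ_iff.1 h
    exact SH_succ_iff.2 ⟨h3, ih h4 hσ.div⟩

lemma SH.of_le {j k : ℕ} (hjk : j ≤ k) {q : V → E} {σ : ℝ → ℝ} (h : SH k E q σ) (hσ : Wt σ) :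
    SH j E q σ := by
  induction hjk with
  | refl => exact h
  | step _ ih => exact ih (h.pred hσ)

lemma SH.add {k : ℕ} {p q : V → E} {σ : ℝ → ℝ} (hp : SH k E p σ) (hq : SH k E q σ) :
    SH k E (fun y => p y + q y) σ := by
  induction k generalizing E σ with
  | zero =>
    obtain ⟨C, δ, h1, h2, h3⟩ := SH_zero_iff.1 hp
    obtain ⟨C', δ', h1', h2', h3'⟩ := SH_zero_iff.1 hq
    refine SH_zero_iff.2 ⟨C + C', min δ δ', by positivity, by positivity, ?_⟩
    filter_upwards [h3, h3'] with y h4 h5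
    refine ⟨(norm_add_le _ _).trans (by linarith [h4.1, h5.1]), fun y' hy' => ?_⟩
    have h6 := h4.2 y' (hy'.trans (by gcongr; exact min_le_left _ _))
    have h7 := h5.2 y' (hy'.trans (by gcongr; exact min_le_right _ _))
    rw [add_sub_add_comm]
    refine (norm_add_le _ _).trans (by linarith)
  | succ k ih =>
    obtain ⟨⟨C, h1, h3⟩, h4⟩ := SH_succ_iff.1 hp
    obtain ⟨⟨C', h1', h3'⟩, h4'⟩ := SH_succ_iff.1 hq
    refine SH_succ_iff.2 ⟨⟨C + C', by positivity, ?_⟩, (ih h4 h4').congr ?_⟩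
    · filter_upwards [h3, h3'] with y h4 h5
      exact ⟨h4.1.add h5.1, (norm_add_le _ _).trans (by linarith [h4.2, h5.2])⟩
    · filter_upwards [h3, h3'] with y h4 h5
      exact (fderiv_add h4.1 h5.1).symm

lemma SH.clm {k : ℕ} {q : V → E} {σ : ℝ → ℝ} (hq : SH k E q σ) (hσ : ∀ᶠ r in atTop, 0 < σ r)
    (T : E →L[ℝ] F) : SH k F (fun y => T (q y)) σ := by
  induction k generalizing E F σ with
  | zero =>
    obtain ⟨C, δ, h1, h2, h3⟩ := SH_zero_iff.1 hq
    refine SH_zero_iff.2 ⟨(‖T‖ + 1) * C, δ, by positivity, h2, ?_⟩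
    filter_upwards [h3, ev_norm hσ] with y h4 h5
    have key : ∀ (v : E) (b : ℝ), ‖v‖ ≤ C * b → ‖T v‖ ≤ (‖T‖ + 1) * C * b := by
      intro v b h
      calc ‖T v‖ ≤ ‖T‖ * ‖v‖ := T.le_opNorm v
        _ ≤ (‖T‖ + 1) * ‖v‖ := by gcongr; linarith
        _ ≤ (‖T‖ + 1) * (C * b) := by gcongr
        _ = _ := by ring
    refine ⟨key _ _ h4.1, fun y' hy' => ?_⟩
    rw [← map_sub, mul_assoc]
    exact key _ _ (by rw [← mul_assoc]; exact h4.2 y' hy')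
  | succ k ih =>
    obtain ⟨⟨C, h1, h3⟩, h4⟩ := SH_succ_iff.1 hq
    refine SH_succ_iff.2 ⟨⟨(‖T‖ + 1) * C, by positivity, ?_⟩,
      (ih h4 ?_ (ContinuousLinearMap.compL ℝ V E F T)).congr ?_⟩
    · filter_upwards [h3] with y h4
      refine ⟨T.differentiableAt.comp y h4.1, ?_⟩
      calc ‖T (q y)‖ ≤ ‖T‖ * ‖q y‖ := T.le_opNorm _
        _ ≤ (‖T‖ + 1) * ‖q y‖ := by gcongr; linarith
        _ ≤ (‖T‖ + 1) * (C * σ ‖y‖) := by gcongr; exact h4.2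
        _ = _ := by ring
    · filter_upwards [hσ, eventually_gt_atTop 0] with r h5 h6
      positivity
    · filter_upwards [h3] with y h4
      exact (T.hasFDerivAt.comp y h4.1.hasFDerivAt).fderiv.symm

lemma SH.bilin {k : ℕ} {p : V → E} {q : V → F} {σ τ : ℝ → ℝ} (hp : SH k E p σ)
    (hq : SH k F q τ) (hσ : Wt σ) (hτ : Wt τ) (B : E →L[ℝ] F →L[ℝ] G) :
    SH k G (fun y => B (p y) (q y)) (fun r => σ r * τ r) := by
  induction k generalizing E F G σ τ with
  | zero =>
    obtain ⟨C, δ, h1, h2, h3⟩ := SH_zero_iff.1 hp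
    obtain ⟨C', δ', h1', h2', h3'⟩ := SH_zero_iff.1 hq
    obtain ⟨D, hD, hw⟩ := hσ.ball (V := V)
    refine SH_zero_iff.2 ⟨(‖B‖ + 1) * C * C' * (1 + D), min (min δ δ') (1/2), by positivity,
      by positivity, ?_⟩
    filter_upwards [h3, h3', ev_norm hσ.1, ev_norm hτ.1, hw, ev_ball (h3.mono fun y h => h.1)]
      with y h4 h5 h6 h7 h8 h9
    have hB : ∀ (a : E) (b : F), ‖B a b‖ ≤ (‖B‖ + 1) * ‖a‖ * ‖b‖ := by
      intro a b
      refine (B.le_opNorm₂ a b).trans ?_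
      gcongr
      linarith
    constructor
    · calc ‖B (p y) (q y)‖ ≤ (‖B‖ + 1) * ‖p y‖ * ‖q y‖ := hB _ _
        _ ≤ (‖B‖ + 1) * (C * σ ‖y‖) * (C' * τ ‖y‖) := by
          gcongr
          · exact h4.1
          · exact h5.1
        _ = (‖B‖ + 1) * C * C' * 1 * (σ ‖y‖ * τ ‖y‖) := by ring
        _ ≤ _ := by gcongr; linarith
    · intro y' hy'
      have e1 : ‖y' - y‖ ≤ δ * ‖y‖ := hy'.trans (by gcongr; exact (min_le_left _ _).trans (min_le_left _ _))
      have e2 : ‖y' - y‖ ≤ δ' * ‖y‖ := hy'.trans (by gcongr; exact (min_le_left _ _).trans (min_le_right _ _))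
      have e3 : ‖y' - y‖ ≤ (1/2) * ‖y‖ := hy'.trans (by gcongr; exact min_le_right _ _)
      have e4 : B (p y') (q y') - B (p y) (q y) = B (p y') (q y' - q y) + B (p y' - p y) (q y) := by
        simp
      rw [e4]
      set s := √(‖y' - y‖ / ‖y‖)
      have hs : 0 ≤ s := Real.sqrt_nonneg _
      calc _ ≤ ‖B (p y') (q y' - q y)‖ + ‖B (p y' - p y) (q y)‖ := norm_add_le _ _
        _ ≤ (‖B‖ + 1) * ‖p y'‖ * ‖q y' - q y‖ + (‖B‖ + 1) * ‖p y' - p y‖ * ‖q y‖ :=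
          add_le_add (hB _ _) (hB _ _)
        _ ≤ (‖B‖ + 1) * (C * (D * σ ‖y‖)) * (C' * τ ‖y‖ * s)
            + (‖B‖ + 1) * (C * σ ‖y‖ * s) * (C' * τ ‖y‖) := by
          gcongr
          · exact (h9 y' e3).trans (by gcongr; exact h8 y' e3)
          · exact h5.2 y' e2
          · exact h4.2 y' e1
          · exact h5.1
        _ = _ := by ring
  | succ k ih =>
    have hp' := hp.pred hσ
    have hq' := hq.pred hτ
    obtain ⟨⟨C, h1, h3⟩, h4⟩ := SH_succ_iff.1 hp
    obtain ⟨⟨C', h1', h3'⟩, h4'⟩ := SH_succ_iff.1 hq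
    have hpos : ∀ᶠ r in atTop, 0 < σ r * τ r / r := ((hσ.mul hτ).div).1
    have k1 := (ih hp' h4' hσ hτ.div (B.precompR V)).congr_wt (τ := fun r => σ r * τ r / r)
      (by filter_upwards with r; ring) hpos
    have k2 := (ih h4 hq' hσ.div hτ (B.precompL V)).congr_wt (τ := fun r => σ r * τ r / r)
      (by filter_upwards with r; ring) hpos
    refine SH_succ_iff.2 ⟨⟨(‖B‖ + 1) * C * C', by positivity, ?_⟩, (k1.add k2).congr ?_⟩
    · filter_upwards [h3, h3', ev_norm hσ.1, ev_norm hτ.1] with y h4 h5 h6 h7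
      refine ⟨(B.hasFDerivAt_of_bilinear h4.1.hasFDerivAt h5.1.hasFDerivAt).differentiableAt, ?_⟩
      calc ‖B (p y) (q y)‖ ≤ ‖B‖ * ‖p y‖ * ‖q y‖ := B.le_opNorm₂ _ _
        _ ≤ (‖B‖ + 1) * (C * σ ‖y‖) * (C' * τ ‖y‖) := by
          gcongr
          · linarith
          · exact h4.2
          · exact h5.2
        _ = _ := by ring
    · filter_upwards [h3, h3'] with y h4 h5
      exact (B.hasFDerivAt_of_bilinear h4.1.hasFDerivAt h5.1.hasFDerivAt).fderiv.symm

/-- maps comparable to the identity at infinity, locally Lipschitz -/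
def Cmp (p : V → V) : Prop := ∃ Λ δ : ℝ, 1 ≤ Λ ∧ 0 < δ ∧ ∀ᶠ y in cobounded V,
  ‖y‖ ≤ Λ * ‖p y‖ ∧ ‖p y‖ ≤ Λ * ‖y‖ ∧ ∀ y', ‖y' - y‖ ≤ δ * ‖y‖ → ‖p y' - p y‖ ≤ Λ * ‖y' - y‖

lemma Cmp.tendsto {p : V → V} (hp : Cmp p) : Tendsto p (cobounded V) (cobounded V) := by
  obtain ⟨Λ, δ, h1, h2, h3⟩ := hp
  rw [← tendsto_norm_atTop_iff_cobounded]
  have : Tendsto (fun y : V => Λ⁻¹ * ‖y‖) (cobounded V) atTop :=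
    tendsto_norm_cobounded_atTop.const_mul_atTop (by positivity)
  refine tendsto_atTop_mono' _ ?_ this
  filter_upwards [h3] with y hy
  rw [inv_mul_le_iff₀ (by linarith)]
  exact hy.1

lemma Wt.cmp {σ : ℝ → ℝ} (hσ : Wt σ) {p : V → V} (hp : Cmp p) :
    ∃ C : ℝ, 0 < C ∧ ∀ᶠ y in cobounded V, σ ‖p y‖ ≤ C * σ ‖y‖ := by
  obtain ⟨Λ, δ, h1, h2, h3⟩ := hp
  obtain ⟨C, hC, h4⟩ := hσ.2 Λ h1
  refine ⟨C, hC, ?_⟩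
  filter_upwards [h3, ev_norm h4] with y hy hy'
  exact hy' _ hy.1 hy.2.1

lemma SH.comp_zero {q : V → E} {σ : ℝ → ℝ} (hq : SH 0 E q σ) (hσ : Wt σ) {p : V → V}
    (hp : Cmp p) : SH 0 E (fun y => q (p y)) σ := by
  obtain ⟨C', hC', hw⟩ := hσ.cmp hp
  have ht := hp.tendsto
  obtain ⟨C, δ, h1, h2, h3⟩ := SH_zero_iff.1 hq
  obtain ⟨Λ, δ', h4, h5, h6⟩ := hp
  have hΛ : 0 < Λ := by linarith
  refine SH_zero_iff.2 ⟨C * C' * Λ, min δ' (δ / Λ ^ 2), by positivity, by positivity, ?_⟩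
  filter_upwards [ht.eventually h3, h6, hw, ev_norm hσ.1, ev_pos, ht.eventually ev_pos,
    ht.eventually (ev_norm hσ.1)] with y h7 h8 h9 h10 h11 h12 h13
  constructor
  · calc ‖q (p y)‖ ≤ C * (C' * σ ‖y‖) := h7.1.trans (by gcongr)
      _ = C * C' * 1 * σ ‖y‖ := by ring
      _ ≤ _ := by gcongr
  · intro y' hy'
    have e1 := h8.2.2 y' (hy'.trans (by gcongr; exact min_le_left _ _))
    have e2 : ‖y' - y‖ ≤ δ / Λ ^ 2 * ‖y‖ := hy'.trans (by gcongr; exact min_le_right _ _)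
    have e3 : ‖p y' - p y‖ ≤ δ * ‖p y‖ := by
      calc ‖p y' - p y‖ ≤ Λ * (δ / Λ ^ 2 * (Λ * ‖p y‖)) := e1.trans (by gcongr; exact e2.trans (by gcongr; exact h8.1))
        _ = δ * ‖p y‖ := by field_simp
    refine (h7.2 _ e3).trans ?_
    have e4 : √(‖p y' - p y‖ / ‖p y‖) ≤ Λ * √(‖y' - y‖ / ‖y‖) := by
      rw [Real.sqrt_le_left (by positivity), mul_pow, Real.sq_sqrt (by positivity)]
      rw [div_le_iff₀ h12]
      calc ‖p y' - p y‖ ≤ Λ * ‖y' - y‖ := e1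
        _ = Λ * (‖y' - y‖ / ‖y‖) * ‖y‖ := by field_simp
        _ ≤ Λ * (‖y' - y‖ / ‖y‖) * (Λ * ‖p y‖) := by gcongr; exact h8.1
        _ = _ := by ring
    calc C * σ ‖p y‖ * √(‖p y' - p y‖ / ‖p y‖) ≤ C * (C' * σ ‖y‖) * (Λ * √(‖y' - y‖ / ‖y‖)) := by
          gcongr
      _ = _ := by ring

lemma SH.comp {k : ℕ} {q : V → E} {σ : ℝ → ℝ} (hq : SH k E q σ) (hσ : Wt σ) {p : V → V}
    (hp : Cmp p) (hpk : 1 ≤ k → SH k V p (fun r => r)) : SH k E (fun y => q (p y)) σ := by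
  induction k generalizing E σ with
  | zero => exact hq.comp_zero hσ hp
  | succ k ih =>
    have hpk := hpk (by omega)
    have h1 := hq.fderiv
    have h2 := ih h1 hσ.div (fun _ => hpk.pred Wt.id)
    have h3 := hpk.fderiv.congr_wt (τ := fun _ => 1)
      (by filter_upwards [eventually_gt_atTop 0] with r hr using div_self hr.ne') Wt.one.1
    have h4 := (h2.bilin h3 hσ.div Wt.one (ContinuousLinearMap.compL ℝ V V E)).congr_wt
      (τ := fun r => σ r / r) (by filter_upwards with r; ring) hσ.div.1
    obtain ⟨C, hC, hb⟩ := hq.bound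
    obtain ⟨C', hC', hw⟩ := hσ.cmp hp
    refine SH_succ_iff.2 ⟨⟨C * C', by positivity, ?_⟩, h4.congr ?_⟩
    · filter_upwards [hp.tendsto.eventually hq.diff, hpk.diff, hw, hp.tendsto.eventually hb]
        with y h5 h6 h7 h8
      exact ⟨h5.comp y h6, h8.trans (by rw [mul_assoc]; gcongr)⟩
    · filter_upwards [hp.tendsto.eventually hq.diff, hpk.diff] with y h5 h6
      exact (h5.hasFDerivAt.comp y h6.hasFDerivAt).fderiv.symm

lemma SH_inv [CompleteSpace V] {k : ℕ} {M N : V → V →L[ℝ] V} (hM : SH k (V →L[ℝ] V) M (fun _ => 1))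
    {C : ℝ} (hN : ∀ᶠ y in cobounded V, N y * M y = 1 ∧ M y * N y = 1 ∧ ‖N y‖ ≤ C) :
    SH k (V →L[ℝ] V) N (fun _ => 1) := by
  induction k with
  | zero =>
    obtain ⟨D, δ, h1, h2, h3⟩ := SH_zero_iff.1 hM
    refine SH_zero_iff.2 ⟨(|C| + 1) * (|C| + 1) * (D + 1), min δ (1/2), by positivity, by positivity, ?_⟩
    filter_upwards [h3, hN, ev_ball hN] with y h4 h5 h6
    have hc : ‖N y‖ ≤ |C| + 1 := h5.2.2.trans (by linarith [le_abs_self C])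
    constructor
    · calc ‖N y‖ ≤ (|C| + 1) * 1 * 1 := by linarith
        _ ≤ (|C| + 1) * (|C| + 1) * (D + 1) := by
          gcongr <;> linarith [abs_nonneg C]
        _ = _ := by ring
    · intro y' hy'
      have e1 := h4.2 y' (hy'.trans (by gcongr; exact min_le_left _ _))
      have e2 := h6 y' (hy'.trans (by gcongr; exact min_le_right _ _))
      have hc' : ‖N y'‖ ≤ |C| + 1 := e2.2.2.trans (by linarith [le_abs_self C])
      have : N y' - N y = - (N y' * ((M y' - M y) * N y)) := by
        rw [sub_mul, mul_sub, ← mul_assoc, e2.1, h5.2.1]; simp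
      rw [this, norm_neg]
      calc _ ≤ ‖N y'‖ * (‖M y' - M y‖ * ‖N y‖) :=
            (norm_mul_le _ _).trans (by gcongr; exact norm_mul_le _ _)
        _ ≤ (|C| + 1) * ((D * 1 * √(‖y' - y‖ / ‖y‖)) * (|C| + 1)) := by gcongr
        _ ≤ (|C| + 1) * (((D + 1) * 1 * √(‖y' - y‖ / ‖y‖)) * (|C| + 1)) := by gcongr; linarith
        _ = _ := by ring
  | succ k ih =>
    have hN' := ih (hM.pred Wt.one)
    have hMd := hM.fderiv
    let B : (V →L[ℝ] V) →L[ℝ] (V →L[ℝ] V) →L[ℝ] (V →L[ℝ] V) := ContinuousLinearMap.compL ℝ V V V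
    have w1 : Wt (fun r : ℝ => 1 / r) := Wt.one.div
    have k1 := SH.bilin (G := V →L[ℝ] (V →L[ℝ] V)) hMd hN' w1 Wt.one (B.precompL V)
    have k2 := (SH.bilin (G := V →L[ℝ] (V →L[ℝ] V)) hN' k1 Wt.one (w1.mul Wt.one) (B.precompR V)).congr_wt (τ := fun r => 1 / r)
      (by filter_upwards with r; ring) w1.1
    have k3 := k2.clm w1.1 (-ContinuousLinearMap.id ℝ _)
    have key : ∀ᶠ y in cobounded V, HasFDerivAt N
        (-(B.precompR V (N y) (B.precompL V (fderiv ℝ M y) (N y)))) y := by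
      filter_upwards [ev_nhds hN, hN, hM.diff] with y h1 h2 h3
      let x : (V →L[ℝ] V)ˣ := ⟨M y, N y, h2.2.1, h2.1⟩
      have e1 := (hasFDerivAt_ringInverse (𝕜 := ℝ) x).comp y
        (f := M) (f' := fderiv ℝ M y) h3.hasFDerivAt
      have e2 : N =ᶠ[𝓝 y] (Ring.inverse ∘ M) := by
        filter_upwards [h1] with z hz
        let xz : (V →L[ℝ] V)ˣ := ⟨M z, N z, hz.2.1, hz.1⟩
        exact (Ring.inverse_unit xz).symm
      refine (e1.congr_of_eventuallyEq e2).congr_fderiv ?_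
      ext v w
      simp [B, x, ContinuousLinearMap.precompR, ContinuousLinearMap.precompL]
    refine SH_succ_iff.2 ⟨⟨|C| + 1, by positivity, ?_⟩, k3.congr ?_⟩
    · filter_upwards [key, hN] with y h1 h2
      exact ⟨h1.differentiableAt, h2.2.2.trans (by linarith [le_abs_self C])⟩
    · filter_upwards [key] with y h1
      rw [h1.fderiv]; rfl

/-- extraction of bounds on iterated derivatives -/
lemma SH.iterated {k j : ℕ} (hj : j ≤ k) {q : V → E} {σ : ℝ → ℝ} (h : SH k E q σ) :
    ∃ C : ℝ, 0 < C ∧ ∀ᶠ y in cobounded V, ‖iteratedFDeriv ℝ j q y‖ ≤ C * (σ ‖y‖ / ‖y‖ ^ j) := by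
  induction j generalizing E k σ with
  | zero =>
    obtain ⟨C, hC, hb⟩ := h.bound
    refine ⟨C, hC, hb.mono fun y hy => ?_⟩
    simpa using hy
  | succ j ih =>
    obtain ⟨k, rfl⟩ : ∃ k', k = k' + 1 := ⟨k - 1, by omega⟩
    obtain ⟨C, hC, hb⟩ := ih (by omega) h.fderiv
    refine ⟨C, hC, hb.mono fun y hy => ?_⟩
    rw [norm_iteratedFDeriv_fderiv] at hy
    refine hy.trans (le_of_eq ?_)
    rw [pow_succ', div_div]

/-- from bounds on iterated derivatives -/
lemma SH_of_iterated {k : ℕ} {q : V → E} {σ : ℝ → ℝ} (hσ : Wt σ)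
    (hc : ∀ᶠ y in cobounded V, ContDiffAt ℝ (k + 1 : ℕ) q y)
    (hb : ∀ j ≤ k + 1, ∃ C : ℝ, ∀ᶠ y in cobounded V,
      ‖iteratedFDeriv ℝ j q y‖ ≤ C * (σ ‖y‖ / ‖y‖ ^ j)) : SH k E q σ := by
  induction k generalizing E σ with
  | zero =>
    obtain ⟨C, h0⟩ := hb 0 (by omega)
    obtain ⟨C', h1⟩ := hb 1 (by omega)
    refine SH_zero_of_deriv (C := max C C') hσ ?_ ?_
    · filter_upwards [h0, ev_norm hσ.1, hc] with y hy hp hc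
      refine ⟨hc.differentiableAt (by simp), ?_⟩
      simp only [norm_iteratedFDeriv_zero, pow_zero, div_one] at hy
      exact hy.trans (by gcongr; exact le_max_left _ _)
    · filter_upwards [h1, ev_norm hσ.1] with y hy hp
      rw [← norm_iteratedFDeriv_fderiv] at hy
      simp only [norm_iteratedFDeriv_zero, pow_one] at hy
      exact hy.trans (by gcongr; exact le_max_right _ _)
  | succ k ih =>
    refine SH_succ_iff.2 ⟨?_, ih hσ.div ?_ ?_⟩
    · obtain ⟨C, h0⟩ := hb 0 (by omega)
      refine ⟨|C| + 1, by positivity, ?_⟩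
      filter_upwards [h0, hc, ev_norm hσ.1] with y h1 h2 h3
      simp only [norm_iteratedFDeriv_zero, pow_zero, div_one] at h1
      refine ⟨h2.differentiableAt (by simp), h1.trans ?_⟩
      gcongr
      linarith [le_abs_self C]
    · filter_upwards [hc] with y h2
      exact h2.fderiv_right (by norm_cast)
    · intro j hj
      obtain ⟨C, h0⟩ := hb (j + 1) (by omega)
      refine ⟨C, h0.mono fun y hy => ?_⟩
      rw [norm_iteratedFDeriv_fderiv]
      refine hy.trans (le_of_eq ?_)
      rw [pow_succ', div_div]

end PartOne


section PartTwo
open Filter Bornology Topology MeasureTheory Metric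
open scoped ContDiff

variable {V : Type} [NormedAddCommGroup V] [NormedSpace ℝ V] [FiniteDimensional ℝ V]
  [MeasurableSpace V] [BorelSpace V] (μ : Measure V) [μ.IsAddHaarMeasure]
variable {E F : Type} [NormedAddCommGroup E] [NormedSpace ℝ E]
  [NormedAddCommGroup F] [NormedSpace ℝ F]

/-- averaging operator with operator valued kernel at scale `t` -/
noncomputable def Kop (κ : V → E →L[ℝ] F) (t : ℝ) (H : V → E) (y : V) : F :=
  ∫ z in closedBall (0 : V) 1, κ z (H (y - t • z)) ∂μ

/-- smooth kernels supported in the unit ball -/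
structure Ker (κ : V → E →L[ℝ] F) : Prop where
  smooth : ContDiff ℝ ∞ κ
  supp : tsupport κ ⊆ closedBall 0 1

/-- derivative of a kernel -/
noncomputable def kD (κ : V → E →L[ℝ] F) (z : V) : E →L[ℝ] (V →L[ℝ] F) := (fderiv ℝ κ z).flip

lemma Ker.zero {κ : V → E →L[ℝ] F} (h : Ker κ) {z : V} (hz : z ∉ closedBall (0 : V) 1) : κ z = 0 :=
  image_eq_zero_of_notMem_tsupport fun h' => hz (h.supp h')

lemma Ker.kD {κ : V → E →L[ℝ] F} (h : Ker κ) : Ker (kD κ) := by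
  refine ⟨?_, ?_⟩
  · have h1 : ContDiff ℝ ∞ (fderiv ℝ κ) := h.smooth.fderiv_right (by simp)
    exact (LinearIsometryEquiv.contDiff (F := E →L[ℝ] V →L[ℝ] F)
      (ContinuousLinearMap.flipₗᵢ ℝ V E F)).comp h1
  · refine subset_trans ?_ ((tsupport_fderiv_subset ℝ).trans h.supp)
    refine closure_mono fun z hz => ?_
    simp only [Function.mem_support] at hz ⊢
    intro h0
    apply hz
    simp only [_root_.kD, h0]
    ext
    simp

lemma Ker.compact {κ : V → E →L[ℝ] F} (h : Ker κ) : HasCompactSupport κ :=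
  (isCompact_closedBall 0 1).of_isClosed_subset (isClosed_tsupport _) h.supp

lemma Ker.bound {κ : V → E →L[ℝ] F} (h : Ker κ) : ∃ C : ℝ, 0 < C ∧ ∀ (t : ℝ) (H : V → E) (y : V)
    (b : ℝ), (∀ z, ‖z‖ ≤ 1 → ‖H (y - t • z)‖ ≤ b) → ‖Kop μ κ t H y‖ ≤ C * b := by
  obtain ⟨M, hM⟩ := h.compact.exists_bound_of_continuous h.smooth.continuous
  refine ⟨(|M| + 1) * (μ.real (closedBall 0 1) + 1), by positivity, fun t H y b hb => ?_⟩
  have hb0 : 0 ≤ b := (norm_nonneg _).trans (hb 0 (by simp))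
  have := norm_setIntegral_le_of_norm_le_const (μ := μ) (s := closedBall (0:V) 1)
    (f := fun z => κ z (H (y - t • z))) (C := (|M| + 1) * b) measure_closedBall_lt_top ?_
  · refine this.trans ?_
    rw [mul_assoc, mul_assoc]
    have : 0 ≤ μ.real (closedBall (0:V) 1) := by positivity
    gcongr (|M| + 1) * ?_
    nlinarith
  · intro z hz
    refine ((κ z).le_opNorm _).trans ?_
    gcongr
    · exact (hM z).trans (by linarith [le_abs_self M])
    · exact hb z (by simpa using hz)

lemma Kop_integrable {κ : V → E →L[ℝ] F} (h : Ker κ) {t : ℝ} {H : V → E} {y : V}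
    (hH : ContinuousOn H (closedBall y |t|)) :
    IntegrableOn (fun z => κ z (H (y - t • z))) (closedBall (0 : V) 1) μ := by
  apply ContinuousOn.integrableOn_compact (isCompact_closedBall _ _)
  refine h.smooth.continuous.continuousOn.clm_apply (hH.comp (by fun_prop) ?_)
  intro z hz
  simp only [mem_closedBall, dist_eq_norm, sub_zero] at hz ⊢
  rw [sub_sub_cancel_left, norm_neg, norm_smul, Real.norm_eq_abs]
  nlinarith [abs_nonneg t]

lemma Kop_continuous {κ : V → E →L[ℝ] F} (h : Ker κ) {H : V → E} (hH : Continuous H) :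
    Continuous (fun p : ℝ × V => Kop μ κ p.1 H p.2) := by
  unfold Kop
  apply continuous_parametric_integral_of_continuous _ (isCompact_closedBall _ _)
  have := h.smooth.continuous
  simp only [Function.uncurry_def]
  fun_prop

lemma Kop_hasFDerivAt {κ : V → E →L[ℝ] F} (h : Ker κ) {H : V → E} (hH : Continuous H)
    {t : ℝ} (ht : 0 < t) (y : V) :
    HasFDerivAt (Kop μ κ t H) (t⁻¹ • Kop μ (kD κ) t H y) y := by
  set d := Module.finrank ℝ V
  set κt : V → E →L[ℝ] F := fun x => κ (t⁻¹ • x) with hκt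
  set c : ℝ := |(t ^ d)⁻¹| with hc
  have ht0 : t ≠ 0 := ht.ne'
  have gen : ∀ {G : Type} [NormedAddCommGroup G] [NormedSpace ℝ G] (k : V → E →L[ℝ] G), Ker k →
      ∀ y, Kop μ k t H y = c • ∫ x, k (t⁻¹ • x) (H (y - x)) ∂μ := by
    intro G _ _ k hk y
    have := Measure.integral_comp_smul μ (fun x => k (t⁻¹ • x) (H (y - x))) t
    simp only [inv_smul_smul₀ ht0] at this
    rw [← this, Kop]
    refine setIntegral_eq_integral_of_forall_compl_eq_zero fun z hz => ?_
    rw [hk.zero hz]; simp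
  have hcs : HasCompactSupport κt := h.compact.comp_smul (inv_ne_zero ht0)
  have hsm : ContDiff ℝ 1 κt := (h.smooth.comp (contDiff_const_smul _)).of_le (by simp)
  have hd := hcs.hasFDerivAt_convolution_left (μ := μ) (ContinuousLinearMap.id ℝ (E →L[ℝ] F)) hsm
    (hH.locallyIntegrable) y
  have hd2 := hd.const_smul c
  have e1 : Kop μ κ t H = fun y => c • convolution κt H (ContinuousLinearMap.id ℝ (E →L[ℝ] F)) μ y := by
    funext y
    rw [gen κ h y]; rfl
  rw [e1]
  refine hd2.congr_fderiv ?_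
  rw [gen (kD κ) h.kD y, convolution, smul_comm t⁻¹ c, ← integral_smul t⁻¹]
  congr 2
  funext x
  have e2 : fderiv ℝ κt x = t⁻¹ • fderiv ℝ κ (t⁻¹ • x) := by
    rw [hκt, fderiv_comp_smul]
  rw [e2]
  ext v
  simp [kD, ContinuousLinearMap.precompL]

lemma Kop_sub_const {κ : V → E →L[ℝ] F} (h : Ker κ) {H : V → E} (hH : Continuous H)
    {t : ℝ} (ht : 0 < t) (y : V) (e : E) :
    Kop μ (kD κ) t H y = Kop μ (kD κ) t (fun x => H x - e) y := by
  have h1 := Kop_hasFDerivAt μ h (H := fun _ => e) continuous_const ht y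
  have h2 : Kop μ κ t (fun _ => e) = fun _ => Kop μ κ t (fun _ => e) 0 := by
    funext y; rfl
  rw [h2] at h1
  have h3 := h1.unique (hasFDerivAt_const _ _)
  have h4 : Kop μ (kD κ) t (fun _ => e) y = 0 := by
    rcases smul_eq_zero.1 h3 with h5 | h5
    · exact absurd h5 (inv_ne_zero ht.ne')
    · exact h5
  have h5 : Kop μ (kD κ) t (fun x => H x - e) y = Kop μ (kD κ) t H y - Kop μ (kD κ) t (fun _ => e) y := by
    simp only [Kop, map_sub]
    exact integral_sub (Kop_integrable μ h.kD hH.continuousOn)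
      (Kop_integrable μ h.kD (t := t) (y := y) (H := fun _ => e) continuous_const.continuousOn)
  rw [h5, h4, sub_zero]

/-- bound with cancellation -/
lemma Kop_bound_hol {κ : V → E →L[ℝ] F} (h : Ker κ) : ∃ C : ℝ, 0 < C ∧ ∀ (H : V → E) (y0 : V)
    (r b : ℝ), 0 < r → Continuous H → 0 ≤ b →
    (∀ y ∈ closedBall y0 (2 * r), ∀ y' ∈ closedBall y0 (2 * r),
      ‖H y - H y'‖ ≤ b * √(‖y - y'‖ / r)) → ∀ t ∈ Set.Ioc 0 r, ∀ y ∈ ball y0 r,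
      ‖Kop μ (kD κ) t H y‖ ≤ C * (b * √(t / r)) := by
  obtain ⟨C, hC, hb⟩ := h.kD.bound μ
  refine ⟨C, hC, fun H y0 r b hr hH hb0 hh t ht y hy => ?_⟩
  rw [Kop_sub_const μ h hH ht.1 y (H y)]
  refine hb t _ y _ fun z hz => ?_
  rw [mem_ball, dist_eq_norm] at hy
  have e1 : ‖t • z‖ ≤ t := by
    rw [norm_smul, Real.norm_eq_abs, abs_of_pos ht.1]
    exact mul_le_of_le_one_right ht.1.le hz
  refine (hh _ ?_ y ?_).trans ?_
  · rw [mem_closedBall, dist_eq_norm]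
    have : y - t • z - y0 = (y - y0) - t • z := by abel
    rw [this]
    refine (norm_sub_le _ _).trans ?_
    linarith [ht.2]
  · rw [mem_closedBall, dist_eq_norm]
    linarith
  · rw [sub_sub_cancel_left, norm_neg]
    gcongr

end PartTwo


section PartThree
open Filter Bornology Topology MeasureTheory Metric
open scoped ContDiff

lemma inv_mul_sqrt_div {t r : ℝ} (ht : 0 < t) : t⁻¹ * √(t / r) = (√r)⁻¹ * t ^ (-1/2 : ℝ) := by
  rw [Real.sqrt_div ht.le, show (-1/2 : ℝ) = 1/2 - 1 by norm_num, Real.rpow_sub ht, Real.rpow_one,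
    ← Real.sqrt_eq_rpow]
  ring

lemma int_half (c : ℝ) (r : ℝ) : ∫ t in (0:ℝ)..r, c * t ^ (-1/2 : ℝ) = 2 * c * r ^ (1/2 : ℝ) := by
  rw [intervalIntegral.integral_const_mul, integral_rpow (Or.inl (by norm_num))]
  norm_num
  ring

lemma int_half' (c : ℝ) {e r : ℝ} (he : 0 < e) (hr : e ≤ r) (hc : 0 ≤ c) :
    ∫ t in e..r, c * t ^ (-3/2 : ℝ) ≤ 2 * c * e ^ (-1/2 : ℝ) := by
  rw [intervalIntegral.integral_const_mul, integral_rpow (Or.inr ⟨by norm_num, ?_⟩)]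
  · have : 0 ≤ r ^ (-1/2 : ℝ) := by have := he.trans_le hr; positivity
    norm_num
    ring_nf at *
    nlinarith
  · rw [Set.uIcc_of_le hr]
    intro h; exact absurd h.1 (by linarith)

variable {V : Type} [NormedAddCommGroup V] [NormedSpace ℝ V] [FiniteDimensional ℝ V]
  [MeasurableSpace V] [BorelSpace V] (μ : Measure V) [μ.IsAddHaarMeasure]
variable {E F : Type} [NormedAddCommGroup E] [NormedSpace ℝ E]
  [NormedAddCommGroup F] [NormedSpace ℝ F]

lemma int_hasFDeriv {G : ℝ → V → F} {G' : ℝ → V → V →L[ℝ] F} {y0 : V} {r : ℝ} (hr : 0 < r)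
    {bd bd' : ℝ → ℝ}
    (h1 : ∀ y, ContinuousOn (fun t => G t y) (Set.Ioc 0 r))
    (h2 : ∀ y, ContinuousOn (fun t => G' t y) (Set.Ioc 0 r))
    (hb : IntervalIntegrable bd volume 0 r) (hb' : IntervalIntegrable bd' volume 0 r)
    (h3 : ∀ t ∈ Set.Ioc 0 r, ∀ y ∈ ball y0 r, ‖G t y‖ ≤ bd t)
    (h4 : ∀ t ∈ Set.Ioc 0 r, ∀ y ∈ ball y0 r, ‖G' t y‖ ≤ bd' t)
    (h5 : ∀ t ∈ Set.Ioc 0 r, ∀ y ∈ ball y0 r, HasFDerivAt (G t) (G' t y) y)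
    {y : V} (hy : y ∈ ball y0 r) :
    HasFDerivAt (fun y => ∫ t in (0:ℝ)..r, G t y) (∫ t in (0:ℝ)..r, G' t y) y := by
  have e : Set.uIoc 0 r = Set.Ioc 0 r := Set.uIoc_of_le hr.le
  have m1 : ∀ y, AEStronglyMeasurable (fun t => G t y) (volume.restrict (Set.uIoc 0 r)) := fun y => by
    rw [e]; exact (h1 y).aestronglyMeasurable measurableSet_Ioc
  refine intervalIntegral.hasFDerivAt_integral_of_dominated_of_fderiv_le (𝕜 := ℝ) (F' := fun y t => G' t y)
    (F := fun y t => G t y) (bound := bd')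
    (isOpen_ball.mem_nhds hy) (Eventually.of_forall m1) ?_ ?_ ?_ hb' ?_
  · refine hb.mono_fun' (m1 y) ?_
    rw [e]
    filter_upwards [ae_restrict_mem measurableSet_Ioc] with t ht using h3 t ht y hy
  · rw [e]; exact (h2 y).aestronglyMeasurable measurableSet_Ioc
  · rw [e]; exact Eventually.of_forall fun t ht x hx => h4 t ht x hx
  · rw [e]; exact Eventually.of_forall fun t ht x hx => h5 t ht x hx

lemma Kop_contOn {κ : V → E →L[ℝ] F} (h : Ker κ) {H : V → E} (hH : Continuous H) (y : V) :
    Continuous (fun t => Kop μ κ t H y) :=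
  (Kop_continuous μ h hH).comp (by fun_prop : Continuous fun t : ℝ => (t, y))

set_option maxHeartbeats 1000000 in
lemma J_deriv {ψ : V → E →L[ℝ] F} (h : Ker ψ) : ∃ C : ℝ, 0 < C ∧ ∀ (H : V → E) (y0 : V)
    (r b : ℝ), 0 < r → Continuous H → 0 ≤ b → (∀ y, ‖H y‖ ≤ b) →
    (∀ y ∈ closedBall y0 (2 * r), ∀ y' ∈ closedBall y0 (2 * r),
      ‖H y - H y'‖ ≤ b * √(‖y - y'‖ / r)) → ∀ y ∈ ball y0 r,
      HasFDerivAt (fun y => ∫ t in (0:ℝ)..r, t • Kop μ ψ t H y)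
        (∫ t in (0:ℝ)..r, Kop μ (kD ψ) t H y) y ∧
      HasFDerivAt (fun y => ∫ t in (0:ℝ)..r, Kop μ (kD ψ) t H y)
        (∫ t in (0:ℝ)..r, t⁻¹ • Kop μ (kD (kD ψ)) t H y) y ∧
      ‖∫ t in (0:ℝ)..r, Kop μ (kD ψ) t H y‖ ≤ C * (b * r) ∧
      ‖∫ t in (0:ℝ)..r, t⁻¹ • Kop μ (kD (kD ψ)) t H y‖ ≤ C * b ∧
      ∀ y' ∈ ball y0 r, ‖(∫ t in (0:ℝ)..r, t⁻¹ • Kop μ (kD (kD ψ)) t H y') -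
        ∫ t in (0:ℝ)..r, t⁻¹ • Kop μ (kD (kD ψ)) t H y‖ ≤ C * b * √(‖y' - y‖ / r) := by
  obtain ⟨C0, hC0, b0⟩ := h.bound μ
  obtain ⟨C1, hC1, b1⟩ := h.kD.bound μ
  obtain ⟨C2, hC2, b2⟩ := Kop_bound_hol μ h.kD
  obtain ⟨C3, hC3, b3⟩ := Kop_bound_hol μ h.kD.kD
  refine ⟨C1 + 8 * C2 + 2 * C3, by positivity, fun H y0 r b hr hH hb hHb hHh y hy => ?_⟩
  replace b0 := fun t y => b0 t H y b (fun z _ => hHb _)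
  replace b1 := fun t y => b1 t H y b (fun z _ => hHb _)
  replace b2 := b2 H y0 r b hr hH hb hHh
  replace b3 := b3 H y0 r b hr hH hb hHh
  have c0 := Kop_contOn μ h hH
  have c1 := Kop_contOn μ h.kD hH
  have c2 := Kop_contOn μ h.kD.kD hH
  have hci : ContinuousOn (fun t : ℝ => t⁻¹) (Set.Ioc 0 r) := 
    continuousOn_inv₀.mono fun t ht => ht.1.ne'
  have c2' : ∀ y, ContinuousOn (fun t => t⁻¹ • Kop μ (kD (kD ψ)) t H y) (Set.Ioc 0 r) :=
    fun y => hci.smul (c2 y).continuousOn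
  set g : ℝ → ℝ := fun t => C2 * b * (√r)⁻¹ * t ^ (-1/2 : ℝ) with hg
  have hgi : ∀ s, IntervalIntegrable g volume 0 s := fun s =>
    (intervalIntegral.intervalIntegrable_rpow' (by norm_num)).const_mul _
  have b2' : ∀ t ∈ Set.Ioc 0 r, ∀ y ∈ ball y0 r, ‖t⁻¹ • Kop μ (kD (kD ψ)) t H y‖ ≤ g t := by
    intro t ht y hy
    rw [norm_smul, norm_inv, Real.norm_eq_abs, abs_of_pos ht.1, hg]
    calc _ ≤ t⁻¹ * (C2 * (b * √(t / r))) := by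
            have := ht.1
            gcongr; exact b2 t ht y hy
      _ = C2 * b * (t⁻¹ * √(t / r)) := by ring
      _ = _ := by rw [inv_mul_sqrt_div ht.1]; ring
  have ii2 : ∀ y ∈ ball y0 r, ∀ s ∈ Set.Icc 0 r, IntervalIntegrable (fun t => t⁻¹ • Kop μ (kD (kD ψ)) t H y) volume 0 s := by
    intro y hy s hs
    have hss : Set.Ioc 0 s ⊆ Set.Ioc 0 r := Set.Ioc_subset_Ioc_right hs.2
    refine (hgi s).mono_fun' ?_ ?_
    · rw [Set.uIoc_of_le hs.1]; exact ((c2' y).mono hss).aestronglyMeasurable measurableSet_Ioc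
    · rw [Set.uIoc_of_le hs.1]
      filter_upwards [ae_restrict_mem measurableSet_Ioc] with t ht using b2' t (hss ht) y hy
  have hsrp : 0 < √r := Real.sqrt_pos.2 hr
  have int2 : ∀ s ∈ Set.Icc 0 r, ∀ y ∈ ball y0 r,
      ‖∫ t in (0:ℝ)..s, t⁻¹ • Kop μ (kD (kD ψ)) t H y‖ ≤ 2 * C2 * b * √(s / r) := by
    intro s hs y hy
    have hss : Set.Ioc 0 s ⊆ Set.Ioc 0 r := Set.Ioc_subset_Ioc_right hs.2
    refine (intervalIntegral.norm_integral_le_of_norm_le hs.1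
      (Eventually.of_forall fun t ht => b2' t (hss ht) y hy) (hgi s)).trans ?_
    rw [hg, int_half, ← Real.sqrt_eq_rpow, Real.sqrt_div hs.1]
    apply le_of_eq; ring
  refine ⟨?_, ?_, ?_, ?_, ?_⟩
  · refine int_hasFDeriv (G := fun t y => t • Kop μ ψ t H y) (y0 := y0) hr (bd := fun t => t * (C0 * b))
      (bd' := fun t => C1 * b)
      (fun y => (continuous_id.smul (c0 y)).continuousOn) (fun y => (c1 y).continuousOn)
      (Continuous.intervalIntegrable (by fun_prop) _ _) (Continuous.intervalIntegrable (by fun_prop) _ _)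
      ?_ ?_ ?_ hy
    · intro t ht y hy
      rw [norm_smul, Real.norm_eq_abs, abs_of_pos ht.1]
      have := ht.1
      gcongr; exact b0 t y
    · intro t ht y hy; exact b1 t y
    · intro t ht y hy
      have := (Kop_hasFDerivAt μ h hH ht.1 y).const_smul t
      rwa [smul_inv_smul₀ ht.1.ne'] at this
  · exact int_hasFDeriv (y0 := y0) hr (bd := fun t => C1 * b)
      (bd' := g) (fun y => (c1 y).continuousOn) c2' (Continuous.intervalIntegrable (by fun_prop) _ _) (hgi r)
      (fun t ht y hy => b1 t y) b2' (fun t ht y hy => Kop_hasFDerivAt μ h.kD hH ht.1 y) hy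
  · have := intervalIntegral.norm_integral_le_of_norm_le_const (a := 0) (b := r) (C := C1 * b)
      (f := fun t => Kop μ (kD ψ) t H y) (fun t _ => b1 t y)
    rw [sub_zero, abs_of_pos hr] at this
    refine this.trans ?_
    rw [mul_assoc]
    gcongr
    nlinarith
  · have := int2 r ⟨hr.le, le_rfl⟩ y hy
    rw [div_self hr.ne', Real.sqrt_one, mul_one] at this
    refine this.trans ?_
    gcongr
    nlinarith
  · intro y' hy'
    set e := ‖y' - y‖ with he
    rcases le_or_gt r e with hre | hre
    · have k1 := int2 r ⟨hr.le, le_rfl⟩ y hy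
      have k2 := int2 r ⟨hr.le, le_rfl⟩ y' hy'
      rw [div_self hr.ne', Real.sqrt_one, mul_one] at k1 k2
      have k3 : 1 ≤ √(e / r) := by
        rw [Real.one_le_sqrt, le_div_iff₀ hr]; linarith
      calc _ ≤ 2 * C2 * b + 2 * C2 * b := (norm_sub_le _ _).trans (add_le_add k2 k1)
        _ ≤ (C1 + 8 * C2 + 2 * C3) * b * 1 := by nlinarith [mul_nonneg hC1.le hb, mul_nonneg hC2.le hb, mul_nonneg hC3.le hb]
        _ ≤ _ := by gcongr
    · rcases eq_or_lt_of_le (norm_nonneg (y' - y)) with h0 | h0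
      · have : y' = y := sub_eq_zero.1 (norm_eq_zero.1 h0.symm)
        rw [this, sub_self, norm_zero]; positivity
      rw [← he] at h0
      have heI : e ∈ Set.Icc 0 r := ⟨h0.le, hre.le⟩
      have sp : ∀ y ∈ ball y0 r, (∫ t in (0:ℝ)..r, t⁻¹ • Kop μ (kD (kD ψ)) t H y) =
          (∫ t in (0:ℝ)..e, t⁻¹ • Kop μ (kD (kD ψ)) t H y) +
          ∫ t in e..r, t⁻¹ • Kop μ (kD (kD ψ)) t H y := fun y hy =>
        (intervalIntegral.integral_add_adjacent_intervals (ii2 y hy e heI)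
          ((ii2 y hy e heI).symm.trans (ii2 y hy r ⟨hr.le, le_rfl⟩))).symm
      have ii3 : ∀ y ∈ ball y0 r, IntervalIntegrable (fun t => t⁻¹ • Kop μ (kD (kD ψ)) t H y) volume e r :=
        fun y hy => ((ii2 y hy e heI).symm.trans (ii2 y hy r ⟨hr.le, le_rfl⟩))
      have k1 := int2 e heI y hy
      have k2 := int2 e heI y' hy'
      have k3 : ‖(∫ t in e..r, t⁻¹ • Kop μ (kD (kD ψ)) t H y') - 
          ∫ t in e..r, t⁻¹ • Kop μ (kD (kD ψ)) t H y‖ ≤ 2 * C3 * b * √(e / r) := by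
        rw [← intervalIntegral.integral_sub (ii3 y' hy') (ii3 y hy)]
        refine (intervalIntegral.norm_integral_le_of_norm_le hre.le
          (g := fun t => C3 * b * (√r)⁻¹ * e * t ^ (-3/2 : ℝ)) (Eventually.of_forall fun t ht => ?_) ?_).trans ?_
        · have ht0 : 0 < t := h0.trans ht.1
          have htr : t ∈ Set.Ioc 0 r := ⟨ht0, ht.2⟩
          have mv := (convex_ball y0 r).norm_image_sub_le_of_norm_hasFDerivWithin_le
            (f := Kop μ (kD (kD ψ)) t H) (C := t⁻¹ * (C3 * (b * √(t / r))))
            (fun x hx => (Kop_hasFDerivAt μ h.kD.kD hH ht0 x).hasFDerivWithinAt)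
            (fun x hx => by
              rw [norm_smul, norm_inv, Real.norm_eq_abs, abs_of_pos ht0]
              gcongr
              exact b3 t htr x hx) hy hy'
          rw [← smul_sub, norm_smul, norm_inv, Real.norm_eq_abs, abs_of_pos ht0]
          calc _ ≤ t⁻¹ * (t⁻¹ * (C3 * (b * √(t / r))) * e) := by gcongr
            _ = C3 * b * e * t⁻¹ * (t⁻¹ * √(t / r)) := by ring
            _ = C3 * b * e * (√r)⁻¹ * (t⁻¹ * t ^ (-1/2 : ℝ)) := by rw [inv_mul_sqrt_div ht0]; ring
            _ = _ := by
              rw [← Real.rpow_neg_one t, ← Real.rpow_add ht0,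
                show (-1 + -1/2 : ℝ) = -3/2 by norm_num]
              ring
        · refine (intervalIntegral.intervalIntegrable_rpow ?_).const_mul _
          right
          rw [Set.uIcc_of_le hre.le]
          intro h; exact absurd h.1 (by linarith)
        · refine (int_half' _ h0 hre.le (by positivity)).trans ?_
          rw [Real.sqrt_div h0.le]
          have : e * e ^ (-1/2 : ℝ) = √e := by
            nth_rewrite 1 [← Real.rpow_one e]
            rw [← Real.rpow_add h0, Real.sqrt_eq_rpow]
            norm_num
          rw [← this]
          apply le_of_eq; ring
      rw [sp y hy, sp y' hy', add_sub_add_comm]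
      calc _ ≤ (2 * C2 * b * √(e / r) + 2 * C2 * b * √(e / r)) + 2 * C3 * b * √(e / r) :=
            (norm_add_le _ _).trans (add_le_add ((norm_sub_le _ _).trans (add_le_add k2 k1)) k3)
        _ = (4 * C2 + 2 * C3) * b * √(e / r) := by ring
        _ ≤ _ := by gcongr; linarith

end PartThree


section PartFour
open Filter Bornology Topology MeasureTheory Metric
open scoped ContDiff

variable {V : Type} [NormedAddCommGroup V] [NormedSpace ℝ V] [FiniteDimensional ℝ V]
  [MeasurableSpace V] [BorelSpace V] (μ : Measure V) [μ.IsAddHaarMeasure]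
variable {E F : Type} [NormedAddCommGroup E] [NormedSpace ℝ E]
  [NormedAddCommGroup F] [NormedSpace ℝ F]

lemma Kop_congr {κ : V → E →L[ℝ] F} {t : ℝ} {H H' : V → E} {y : V}
    (h : ∀ x ∈ closedBall y |t|, H x = H' x) : Kop μ κ t H y = Kop μ κ t H' y := by
  refine setIntegral_congr_fun measurableSet_closedBall fun z hz => ?_
  rw [h]
  simp only [mem_closedBall, dist_eq_norm, sub_zero] at hz ⊢
  rw [sub_sub_cancel_left, norm_neg, norm_smul, Real.norm_eq_abs]
  nlinarith [abs_nonneg t]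

set_option maxHeartbeats 1000000 in
lemma local_schauder_global {η ψ : V → E →L[ℝ] F} (hη : Ker η) (h : Ker ψ) : ∃ C : ℝ, 0 < C ∧
    ∀ (q' : V → F) (q H : V → E) (y0 : V)
    (r a b : ℝ), 0 < r → Continuous q → Continuous H → 0 ≤ a → 0 ≤ b → (∀ y, ‖q y‖ ≤ a) → (∀ y, ‖H y‖ ≤ b) →
    (∀ y ∈ closedBall y0 (2 * r), ∀ y' ∈ closedBall y0 (2 * r),
      ‖H y - H y'‖ ≤ b * √(‖y - y'‖ / r)) →
    (∀ y ∈ ball y0 r, q' y = Kop μ η r q y - ∫ t in (0:ℝ)..r, t • Kop μ ψ t H y) →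
    ∀ y ∈ ball y0 r, DifferentiableAt ℝ q' y ∧ DifferentiableAt ℝ (fderiv ℝ q') y ∧
      ‖fderiv ℝ q' y‖ ≤ C * (a / r + b * r) ∧
      ‖fderiv ℝ (fderiv ℝ q') y‖ ≤ C * (a / r ^ 2 + b) ∧
      ∀ y' ∈ ball y0 r, ‖fderiv ℝ (fderiv ℝ q') y' - fderiv ℝ (fderiv ℝ q') y‖ ≤
        C * (a / r ^ 2 + b) * √(‖y' - y‖ / r) := by
  obtain ⟨C0, hC0, J⟩ := J_deriv μ h
  obtain ⟨C1, hC1, b1⟩ := hη.kD.bound μ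
  obtain ⟨C2, hC2, b2⟩ := hη.kD.kD.bound μ
  obtain ⟨C3, hC3, b3⟩ := hη.kD.kD.kD.bound μ
  refine ⟨C0 + C1 + C2 + 2 * C3, by positivity, fun q' q H y0 r a b hr hq hH ha hb hqa hHb hHh hP => ?_⟩
  replace J := J H y0 r b hr hH hb hHb hHh
  replace b1 := fun y => b1 r q y a (fun z _ => hqa _)
  replace b2 := fun y => b2 r q y a (fun z _ => hqa _)
  replace b3 := fun y => b3 r q y a (fun z _ => hqa _)
  set J1 := fun y => ∫ t in (0:ℝ)..r, Kop μ (kD ψ) t H y with hJ1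
  set J2 := fun y => ∫ t in (0:ℝ)..r, t⁻¹ • Kop μ (kD (kD ψ)) t H y with hJ2
  set D1 : V → V →L[ℝ] F := fun y => r⁻¹ • Kop μ (kD η) r q y - J1 y with hD1
  set D2 : V → V →L[ℝ] V →L[ℝ] F := fun y => r⁻¹ • r⁻¹ • Kop μ (kD (kD η)) r q y - J2 y with hD2
  have d1 : ∀ y ∈ ball y0 r, HasFDerivAt q' (D1 y) y := by
    intro y hy
    refine ((Kop_hasFDerivAt μ hη hq hr y).sub (J y hy).1).congr_of_eventuallyEq ?_
    filter_upwards [isOpen_ball.mem_nhds hy] with x hx using hP x hx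
  have d2 : ∀ y ∈ ball y0 r, HasFDerivAt (fderiv ℝ q') (D2 y) y := by
    intro y hy
    refine (((Kop_hasFDerivAt μ hη.kD hq hr y).const_smul r⁻¹).sub (J y hy).2.1).congr_of_eventuallyEq ?_
    filter_upwards [isOpen_ball.mem_nhds hy] with x hx using (d1 x hx).fderiv
  have n1 : ∀ {G : Type} [NormedAddCommGroup G] [NormedSpace ℝ G] (x : G) (c : ℝ), ‖x‖ ≤ c →
      ‖r⁻¹ • x‖ ≤ c / r := by
    intro G _ _ x c hx
    rw [norm_smul, norm_inv, Real.norm_eq_abs, abs_of_pos hr, div_eq_inv_mul]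
    gcongr
  have har : 0 ≤ a / r := by positivity
  have har2 : 0 ≤ a / r ^ 2 := by positivity
  intro y hy
  refine ⟨(d1 y hy).differentiableAt, (d2 y hy).differentiableAt, ?_, ?_, ?_⟩
  · rw [(d1 y hy).fderiv]
    refine (norm_sub_le _ _).trans ((add_le_add (n1 _ _ (b1 y)) (J y hy).2.2.1).trans ?_)
    have hbr : 0 ≤ b * r := by positivity
    rw [mul_div_assoc]
    nlinarith [mul_nonneg hC0.le har, mul_nonneg hC2.le har, mul_nonneg hC3.le har,
      mul_nonneg hC1.le hbr, mul_nonneg hC2.le hbr, mul_nonneg hC3.le hbr]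
  · rw [(d2 y hy).fderiv]
    refine (norm_sub_le _ _).trans ((add_le_add (n1 _ _ (n1 _ _ (b2 y))) (J y hy).2.2.2.1).trans ?_)
    rw [div_div, ← pow_two, mul_div_assoc]
    nlinarith [mul_nonneg hC0.le har2, mul_nonneg hC1.le har2, mul_nonneg hC3.le har2,
      mul_nonneg hC1.le hb, mul_nonneg hC2.le hb, mul_nonneg hC3.le hb]
  · intro y' hy'
    rw [(d2 y hy).fderiv, (d2 y' hy').fderiv, hD2]
    simp only
    rw [sub_sub_sub_comm]
    set e := ‖y' - y‖ with he
    have he2 : e ≤ 2 * r := by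
      rw [mem_ball, dist_eq_norm] at hy hy'
      have : y' - y = (y' - y0) - (y - y0) := by abel
      rw [he, this]
      refine (norm_sub_le _ _).trans ?_
      linarith
    have he0 : 0 ≤ e := norm_nonneg _
    have k1 : ‖r⁻¹ • r⁻¹ • Kop μ (kD (kD η)) r q y' - r⁻¹ • r⁻¹ • Kop μ (kD (kD η)) r q y‖ ≤
        C3 * a / r / r * (2 * √(e / r)) := by
      rw [← smul_sub, ← smul_sub]
      have mv := (convex_ball y0 r).norm_image_sub_le_of_norm_hasFDerivWithin_le
            (f := Kop μ (kD (kD η)) r q) (C := C3 * a / r)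
            (fun x hx => (Kop_hasFDerivAt μ hη.kD.kD hq hr x).hasFDerivWithinAt)
            (fun x hx => n1 _ _ (b3 x)) hy hy'
      refine (n1 _ _ (n1 _ _ mv)).trans ?_
      rw [← he]
      have : C3 * a / r * e / r / r = C3 * a / r / r * (e / r) := by ring
      rw [this]
      gcongr
      have h1 : e / r ≤ 2 := by rw [div_le_iff₀ hr]; linarith
      have h2 : 0 ≤ e / r := by positivity
      have h3 : √(e / r) ≤ 2 := by
        rw [Real.sqrt_le_left (by norm_num)]; linarith
      nlinarith [Real.sq_sqrt h2, Real.sqrt_nonneg (e / r)]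
    refine (norm_sub_le _ _).trans ((add_le_add k1 ((J y hy).2.2.2.2 y' hy')).trans ?_)
    rw [div_div, ← pow_two, mul_div_assoc]
    have : C3 * (a / r ^ 2) * (2 * √(e / r)) + C0 * b * √(e / r) =
      (2 * C3 * (a / r ^ 2) + C0 * b) * √(e / r) := by ring
    rw [this]
    gcongr ?_ * _
    nlinarith [mul_nonneg hC0.le har2, mul_nonneg hC1.le har2, mul_nonneg hC2.le har2,
      mul_nonneg hC1.le hb, mul_nonneg hC2.le hb, mul_nonneg hC3.le hb]

lemma exists_retract (y0 : V) {s : ℝ} (hs : 0 < s) : ∃ ρ : V → V, Continuous ρ ∧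
    (∀ y, ρ y ∈ closedBall y0 s) ∧ ∀ y ∈ closedBall y0 s, ρ y = y := by
  refine ⟨fun y => y0 + (s / max s ‖y - y0‖) • (y - y0), ?_, ?_, ?_⟩
  · refine continuous_const.add (Continuous.smul (Continuous.div continuous_const (by fun_prop) ?_) (by fun_prop))
    intro y
    exact (lt_of_lt_of_le hs (le_max_left _ _)).ne'
  · intro y
    have h0 : 0 < max s ‖y - y0‖ := lt_of_lt_of_le hs (le_max_left _ _)
    rw [mem_closedBall, dist_eq_norm, add_sub_cancel_left, norm_smul, Real.norm_eq_abs,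
      abs_of_pos (by positivity), div_mul_eq_mul_div, div_le_iff₀ h0]
    gcongr
    exact le_max_right _ _
  · intro y hy
    rw [mem_closedBall, dist_eq_norm] at hy
    simp only
    rw [max_eq_left hy, div_self hs.ne', one_smul, add_sub_cancel]

lemma local_schauder {η ψ : V → E →L[ℝ] E} (hη : Ker η) (h : Ker ψ) : ∃ C : ℝ, 0 < C ∧
    ∀ (q H : V → E) (y0 : V)
    (r a b : ℝ), 0 < r → ContinuousOn q (closedBall y0 (2 * r)) → ContinuousOn H (closedBall y0 (2 * r)) →
    0 ≤ a → 0 ≤ b → (∀ y ∈ closedBall y0 (2 * r), ‖q y‖ ≤ a) → (∀ y ∈ closedBall y0 (2 * r), ‖H y‖ ≤ b) →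
    (∀ y ∈ closedBall y0 (2 * r), ∀ y' ∈ closedBall y0 (2 * r),
      ‖H y - H y'‖ ≤ b * √(‖y - y'‖ / r)) →
    (∀ y ∈ ball y0 r, q y = Kop μ η r q y - ∫ t in (0:ℝ)..r, t • Kop μ ψ t H y) →
    ∀ y ∈ ball y0 r, DifferentiableAt ℝ q y ∧ DifferentiableAt ℝ (fderiv ℝ q) y ∧
      ‖fderiv ℝ q y‖ ≤ C * (a / r + b * r) ∧
      ‖fderiv ℝ (fderiv ℝ q) y‖ ≤ C * (a / r ^ 2 + b) ∧
      ∀ y' ∈ ball y0 r, ‖fderiv ℝ (fderiv ℝ q) y' - fderiv ℝ (fderiv ℝ q) y‖ ≤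
        C * (a / r ^ 2 + b) * √(‖y' - y‖ / r) := by
  obtain ⟨C, hC, hl⟩ := local_schauder_global μ hη h
  refine ⟨C, hC, fun q H y0 r a b hr hq hH ha hb hqa hHb hHh hP => ?_⟩
  obtain ⟨ρ, hρ, hρ1, hρ2⟩ := exists_retract y0 (s := 2 * r) (by positivity)
  have hss : ∀ y ∈ ball y0 r, ∀ t : ℝ, |t| ≤ r → ∀ x ∈ closedBall y |t|, ρ x = x := by
    intro y hy t ht x hx
    apply hρ2
    rw [mem_closedBall] at hx ⊢
    rw [mem_ball] at hy
    linarith [dist_triangle x y y0]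
  refine hl q (fun y => q (ρ y)) (fun y => H (ρ y)) y0 r a b hr 
    (hq.comp_continuous hρ hρ1) (hH.comp_continuous hρ hρ1) ha hb (fun y => hqa _ (hρ1 y))
    (fun y => hHb _ (hρ1 y)) ?_ ?_
  · intro y hy y' hy'
    rw [hρ2 y hy, hρ2 y' hy']
    exact hHh y hy y' hy'
  · intro y hy
    rw [hP y hy]
    congr 1
    · exact Kop_congr μ fun x hx => by rw [hss y hy r (abs_of_pos hr).le x hx]
    · refine intervalIntegral.integral_congr fun t ht => ?_
      rw [Set.uIcc_of_le hr.le] at ht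
      rw [Kop_congr μ (H := H) (H' := fun y => H (ρ y)) fun x hx => by
        rw [hss y hy t (by rw [abs_of_nonneg ht.1]; exact ht.2) x hx]]

/-- scalar kernels -/
noncomputable def sk (E : Type) [NormedAddCommGroup E] [NormedSpace ℝ E] (η : V → ℝ) (z : V) : E →L[ℝ] E :=
  η z • ContinuousLinearMap.id ℝ E

lemma Ker_sk {η : V → ℝ} (h1 : ContDiff ℝ ∞ η) (h2 : tsupport η ⊆ closedBall 0 1) : Ker (sk E η) := by
  refine ⟨h1.smul contDiff_const, ?_⟩
  refine subset_trans (closure_mono fun z hz => ?_) h2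
  simp only [Function.mem_support, sk] at hz ⊢
  intro h; exact hz (by rw [h, zero_smul])

/-- exterior Poisson property -/
def Pois (η ψ : V → ℝ) (q H : V → E) : Prop := ∃ R0 : ℝ, ∀ y : V, ∀ r : ℝ, 0 < r → R0 < ‖y‖ - r →
  q y = Kop μ (sk E η) r q y - ∫ t in (0:ℝ)..r, t • Kop μ (sk E ψ) t H y

lemma SH.contAt {q : V → E} {σ : ℝ → ℝ} (h : SH 0 E q σ) : ∀ᶠ y in cobounded V, ContinuousAt q y := by
  obtain ⟨C, δ, h1, h2, h3⟩ := SH_zero_iff.1 h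
  filter_upwards [h3, ev_pos] with y hy hp
  rw [ContinuousAt, tendsto_iff_norm_sub_tendsto_zero]
  have hb : ∀ᶠ x in 𝓝 y, ‖x - y‖ ≤ δ * ‖y‖ := by
    filter_upwards [closedBall_mem_nhds y (by positivity : 0 < δ * ‖y‖)] with x hx
    rwa [mem_closedBall, dist_eq_norm] at hx
  have hc : ContinuousAt (fun x => C * σ ‖y‖ * √(‖x - y‖ / ‖y‖)) y := by
    fun_prop
  rw [ContinuousAt] at hc
  simp only [sub_self, norm_zero, zero_div, Real.sqrt_zero, mul_zero] at hc
  exact squeeze_zero' (Eventually.of_forall fun x => norm_nonneg _) (hb.mono fun x hx => hy.2 x hx) hc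

set_option maxHeartbeats 1000000 in
lemma schauder_zero {η ψ : V → ℝ} (hη : Ker (sk E η)) (hψ : Ker (sk E ψ)) {q H : V → E}
    (hP : Pois μ η ψ q H) {θ : ℝ → ℝ} (hθ : Wt θ)
    (hc : ∀ᶠ y in cobounded V, ContinuousAt q y) {C1 : ℝ} (hb : ∀ᶠ y in cobounded V, ‖q y‖ ≤ C1 * θ ‖y‖)
    (hH : SH 0 E H (fun r => θ r / r / r)) : SH 2 E q θ := by
  obtain ⟨C, hC, hl⟩ := local_schauder μ hη hψ
  obtain ⟨C2, δ, hC2, hδ, hH'⟩ := SH_zero_iff.1 hH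
  obtain ⟨D, hD, hw⟩ := hθ.ball (V := V)
  obtain ⟨D', hD', hw'⟩ := hθ.div.div.ball (V := V)
  obtain ⟨R0, hR0⟩ := hP
  set ε := min (δ / 8) (1/8) with hε
  have hε0 : 0 < ε := by positivity
  have hε1 : ε ≤ 1/8 := min_le_right _ _
  have hε2 : ε ≤ δ / 8 := min_le_left _ _
  set K := |C1| * D / ε ^ 2 + C2 * D' with hK
  set K1 := |C1| * D / ε + C2 * D' * ε with hK1
  have main : ∀ᶠ y0 in cobounded V, 0 < ‖y0‖ ∧ ‖q y0‖ ≤ |C1| * θ ‖y0‖ ∧ 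
      ∀ y ∈ ball y0 (ε * ‖y0‖), DifferentiableAt ℝ q y ∧ DifferentiableAt ℝ (fderiv ℝ q) y ∧
      ‖fderiv ℝ q y‖ ≤ C * K1 * (θ ‖y0‖ / ‖y0‖) ∧
      ‖fderiv ℝ (fderiv ℝ q) y‖ ≤ C * K * (θ ‖y0‖ / ‖y0‖ / ‖y0‖) ∧
      ∀ y' ∈ ball y0 (ε * ‖y0‖), ‖fderiv ℝ (fderiv ℝ q) y' - fderiv ℝ (fderiv ℝ q) y‖ ≤
        C * K * (θ ‖y0‖ / ‖y0‖ / ‖y0‖) * √(‖y' - y‖ / (ε * ‖y0‖)) := by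
    filter_upwards [ev_ball hc, ev_ball hb, ev_ball hH', ev_ball hH.contAt, ev_ball (ev_norm hθ.1), hw, hw',
      ev_pos, ev_norm (eventually_gt_atTop (2 * R0))] with y0 g1 g2 g3 g4 g5 g6 g7 g8 g9
    have hself : ‖y0 - y0‖ ≤ 1/2 * ‖y0‖ := by rw [sub_self, norm_zero]; positivity
    have hθ0 := g5 y0 hself
    have hθy : 0 < θ ‖y0‖ / ‖y0‖ / ‖y0‖ := by positivity
    refine ⟨g8, (g2 y0 hself).trans (by gcongr; exact le_abs_self _), ?_⟩
    have hin : ∀ y ∈ closedBall y0 (2 * (ε * ‖y0‖)), ‖y - y0‖ ≤ 1/2 * ‖y0‖ := by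
      intro y hy
      rw [mem_closedBall, dist_eq_norm] at hy
      refine hy.trans ?_
      nlinarith
    have := hl q H y0 (ε * ‖y0‖) (|C1| * D * θ ‖y0‖) (C2 * D' * (θ ‖y0‖ / ‖y0‖ / ‖y0‖)) (by positivity)
      (fun y hy => (g1 y (hin y hy)).continuousWithinAt) (fun y hy => (g4 y (hin y hy)).continuousWithinAt)
      (by positivity) (by positivity) ?_ ?_ ?_ ?_
    · have e1 : |C1| * D * θ ‖y0‖ / (ε * ‖y0‖) + C2 * D' * (θ ‖y0‖ / ‖y0‖ / ‖y0‖) * (ε * ‖y0‖) =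
          K1 * (θ ‖y0‖ / ‖y0‖) := by rw [hK1]; field_simp
      have e2 : |C1| * D * θ ‖y0‖ / (ε * ‖y0‖) ^ 2 + C2 * D' * (θ ‖y0‖ / ‖y0‖ / ‖y0‖) =
          K * (θ ‖y0‖ / ‖y0‖ / ‖y0‖) := by rw [hK]; field_simp
      rw [e1, e2, ← mul_assoc, ← mul_assoc] at this
      exact this
    · intro y hy
      refine (g2 y (hin y hy)).trans ?_
      rw [mul_assoc]
      refine (mul_le_mul_of_nonneg_right (le_abs_self _) (g5 y (hin y hy)).le).trans ?_
      gcongr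
      exact g6 y (hin y hy)
    · intro y hy
      refine (g3 y (hin y hy)).1.trans ?_
      rw [mul_assoc]
      gcongr
      exact g7 y (hin y hy)
    · intro y hy y' hy'
      have hn := (norm_comp_of_ball (hin y hy)).1
      rw [norm_sub_rev, norm_sub_rev y y']
      have hyy : ‖y' - y‖ ≤ δ * ‖y‖ := by
        rw [mem_closedBall, dist_eq_norm] at hy hy'
        have : y' - y = (y' - y0) - (y - y0) := by abel
        rw [this]
        refine (norm_sub_le _ _).trans ?_
        nlinarith [norm_nonneg y]
      refine ((g3 y (hin y hy)).2 y' hyy).trans ?_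
      have hw7 := g7 y (hin y hy)
      rw [mul_assoc C2 D']
      gcongr
      nlinarith
    · intro y hy
      refine hR0 y _ (by positivity) ?_
      rw [mem_ball, dist_eq_norm] at hy
      have := norm_sub_norm_le y0 y
      rw [norm_sub_rev] at this
      nlinarith
  have hK0 : 0 < K := by positivity
  have hK10 : 0 < K1 := by positivity
  refine SH_succ_iff.2 ⟨⟨|C1| + 1, by positivity, ?_⟩, SH_succ_iff.2 ⟨⟨C * K1, by positivity, ?_⟩, 
    SH_zero_iff.2 ⟨C * K * √(1 / ε) + C * K, ε / 2, by positivity, by positivity, ?_⟩⟩⟩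
  · filter_upwards [main, ev_norm hθ.1] with y hy hp
    exact ⟨(hy.2.2 y (mem_ball_self (by have := hy.1; positivity))).1, hy.2.1.trans (by gcongr; linarith)⟩
  · filter_upwards [main, ev_norm hθ.1] with y hy hp
    have := (hy.2.2 y (mem_ball_self (by have := hy.1; positivity)))
    exact ⟨this.2.1, this.2.2.1⟩
  · filter_upwards [main, ev_norm hθ.1] with y hy hp
    have hy1 := hy.1
    have := (hy.2.2 y (mem_ball_self (by positivity)))
    have hs := Real.sqrt_nonneg (1 / ε)
    have hW : 0 < θ ‖y‖ / ‖y‖ / ‖y‖ := by positivity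
    refine ⟨this.2.2.2.1.trans ?_, fun y' hy' => (this.2.2.2.2 y' ?_).trans ?_⟩
    · gcongr; nlinarith [mul_pos hC hK0]
    · rw [mem_ball, dist_eq_norm]
      refine hy'.trans_lt ?_
      have : 0 < ε * ‖y‖ := by positivity
      linarith
    · have : ‖y' - y‖ / (ε * ‖y‖) = 1 / ε * (‖y' - y‖ / ‖y‖) := by field_simp
      rw [this, Real.sqrt_mul (by positivity)]
      have h2 : 0 ≤ C * K * (θ ‖y‖ / ‖y‖ / ‖y‖) * √(‖y' - y‖ / ‖y‖) := by positivity
      nlinarith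

end PartFour


section PartFive
open Filter Bornology Topology MeasureTheory Metric
open scoped ContDiff

variable {V : Type} [NormedAddCommGroup V] [NormedSpace ℝ V] [FiniteDimensional ℝ V]
  [MeasurableSpace V] [BorelSpace V] (μ : Measure V) [μ.IsAddHaarMeasure]
variable {E F : Type} [NormedAddCommGroup E] [NormedSpace ℝ E]
  [NormedAddCommGroup F] [NormedSpace ℝ F]

lemma Kop_deriv_right {η : V → ℝ} (hη : Ker (sk E η)) (hη' : Ker (sk (V →L[ℝ] E) η)) {H : V → E}
    (hH : ContDiff ℝ 1 H) {M : ℝ} (hM : ∀ y, ‖fderiv ℝ H y‖ ≤ M) (t : ℝ) (y : V) :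
    HasFDerivAt (Kop μ (sk E η) t H) (Kop μ (sk (V →L[ℝ] E) η) t (fderiv ℝ H) y) y := by
  have hM0 : 0 ≤ M := (norm_nonneg _).trans (hM 0)
  have cH := hH.continuous
  have cH' := hH.continuous_fderiv (by simp)
  obtain ⟨N, hN⟩ := hη'.compact.exists_bound_of_continuous hη'.smooth.continuous
  unfold Kop
  refine hasFDerivAt_integral_of_dominated_of_fderiv_le (𝕜 := ℝ) (F := fun y z => (sk E η z) (H (y - t • z)))
    (F' := fun y z => sk (V →L[ℝ] E) η z (fderiv ℝ H (y - t • z))) (bound := fun _ => N * M)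
    (s := Set.univ) univ_mem ?_ ?_ ?_ ?_ ?_ ?_
  · exact Eventually.of_forall fun y => (Kop_integrable μ hη (t := t) (y := y) cH.continuousOn).aestronglyMeasurable
  · exact Kop_integrable μ hη cH.continuousOn
  · exact (Kop_integrable μ hη' (t := t) (y := y) cH'.continuousOn).aestronglyMeasurable
  · refine Eventually.of_forall fun z x _ => ?_
    refine ((sk (V →L[ℝ] E) η z).le_opNorm _).trans ?_
    have := (norm_nonneg _).trans (hN z)
    exact mul_le_mul (hN z) (hM _) (norm_nonneg _) this
  · exact integrableOn_const (by exact measure_closedBall_lt_top.ne)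
  · refine Eventually.of_forall fun z x _ => ?_
    have h1 : HasFDerivAt (fun x => H (x - t • z)) (fderiv ℝ H (x - t • z)) x := by
      have := ((hH.differentiable (by simp)) (x - t • z)).hasFDerivAt.comp x ((hasFDerivAt_id x).sub_const (t • z))
      simpa [Function.comp_def] using this
    have := h1.const_smul (η z)
    simp only [sk, _root_.smul_apply, ContinuousLinearMap.id_apply]
    exact this

lemma int_Kop_deriv_right {η : V → ℝ} (hη : Ker (sk E η)) (hη' : Ker (sk (V →L[ℝ] E) η)) {H : V → E}
    (hH : ContDiff ℝ 1 H) {M : ℝ} (hM : ∀ y, ‖fderiv ℝ H y‖ ≤ M) (hM' : ∀ y, ‖H y‖ ≤ M) {r : ℝ}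
    (hr : 0 < r) (y : V) :
    HasFDerivAt (fun y => ∫ t in (0:ℝ)..r, t • Kop μ (sk E η) t H y)
      (∫ t in (0:ℝ)..r, t • Kop μ (sk (V →L[ℝ] E) η) t (fderiv ℝ H) y) y := by
  have cH := hH.continuous
  have cH' := hH.continuous_fderiv (by simp)
  obtain ⟨C0, hC0, b0⟩ := hη.bound μ
  obtain ⟨C1, hC1, b1⟩ := hη'.bound μ
  refine int_hasFDeriv (G := fun t y => t • Kop μ (sk E η) t H y)
    (G' := fun t y => t • Kop μ (sk (V →L[ℝ] E) η) t (fderiv ℝ H) y) (y0 := y) hr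
    (bd := fun t => t * (C0 * M)) (bd' := fun t => t * (C1 * M))
      (fun y => (continuous_id.smul (Kop_contOn μ hη cH y)).continuousOn) 
      (fun y => (continuous_id.smul (Kop_contOn μ hη' cH' y)).continuousOn)
      (Continuous.intervalIntegrable (by fun_prop) _ _) (Continuous.intervalIntegrable (by fun_prop) _ _)
      ?_ ?_ ?_ (mem_ball_self hr)
  · intro t ht y hy
    rw [norm_smul, Real.norm_eq_abs, abs_of_pos ht.1]
    have := ht.1
    gcongr; exact b0 t H y M fun z _ => hM' _
  · intro t ht y hy
    rw [norm_smul, Real.norm_eq_abs, abs_of_pos ht.1]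
    have := ht.1
    gcongr; exact b1 t _ y M fun z _ => hM _
  · intro t ht y hy
    exact (Kop_deriv_right μ hη hη' hH hM t y).const_smul t

/-- cutoff -/
lemma exists_cut {q : V → E} {y : V} {r s : ℝ} (hr : 0 < r) (hrs : r < s)
    (hq : ContDiffOn ℝ 1 q (ball y s)) : ∃ q' : V → E, ContDiff ℝ 1 q' ∧
    (∀ x ∈ ball y ((2 * r + s) / 3), q' x = q x) ∧ ∃ M, (∀ x, ‖q' x‖ ≤ M) ∧ ∀ x, ‖fderiv ℝ q' x‖ ≤ M := by
  let f : ContDiffBump y := ⟨(2 * r + s) / 3, (r + 2 * s) / 3, by linarith, by linarith⟩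
  have hts : tsupport (fun x => f x • q x) ⊆ closedBall y ((r + 2 * s)/3) := by
    rw [← f.tsupport_eq]
    exact closure_mono (Function.support_smul_subset_left _ _)
  have hcd : ContDiff ℝ 1 (fun x => f x • q x) := by
    refine contDiff_iff_contDiffAt.2 fun x => ?_
    by_cases hx : x ∉ tsupport (fun x => f x • q x)
    · have h0 : ∀ᶠ z in 𝓝 x, (fun x => f x • q x) z = 0 := notMem_tsupport_iff_eventuallyEq.1 hx
      exact (contDiffAt_const (c := (0 : E))).congr_of_eventuallyEq h0
    push Not at hx
    have : x ∈ ball y s := closedBall_subset_ball (by linarith) (hts hx)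
    exact f.contDiff.contDiffAt.smul (hq.contDiffAt (isOpen_ball.mem_nhds this))
  have hcs : HasCompactSupport (fun x => f x • q x) :=
    (isCompact_closedBall _ _).of_isClosed_subset (isClosed_tsupport _) hts
  obtain ⟨M1, hM1⟩ := hcs.exists_bound_of_continuous hcd.continuous
  obtain ⟨M2, hM2⟩ := (hcs.fderiv ℝ).exists_bound_of_continuous (hcd.continuous_fderiv (by simp))
  refine ⟨_, hcd, fun x hx => ?_, max M1 M2, fun x => (hM1 x).trans (le_max_left _ _),
    fun x => (hM2 x).trans (le_max_right _ _)⟩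
  rw [f.one_of_mem_closedBall (ball_subset_closedBall hx), one_smul]

lemma Pois.deriv {η ψ : V → ℝ} (hη : Ker (sk E η)) (hη' : Ker (sk (V →L[ℝ] E) η))
    (hψ : Ker (sk E ψ)) (hψ' : Ker (sk (V →L[ℝ] E) ψ)) {q H : V → E} (hP : Pois μ η ψ q H) {R : ℝ}
    (hq : ContDiffOn ℝ 1 q {y | R < ‖y‖}) (hH : ContDiffOn ℝ 1 H {y | R < ‖y‖}) :
    Pois μ η ψ (fderiv ℝ q) (fderiv ℝ H) := by
  obtain ⟨R0, h0⟩ := hP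
  refine ⟨max R0 R, fun y r hr hyr => ?_⟩
  obtain ⟨s, hrs, hs⟩ : ∃ s, r < s ∧ max R0 R < ‖y‖ - s := by
    refine ⟨(r + (‖y‖ - max R0 R)) / 2, ?_, ?_⟩ <;> linarith
  have hsub : ∀ y' t, ball y' t ⊆ {x : V | ‖y'‖ - t < ‖x‖} := by
    intro y' t x hx
    rw [mem_ball, dist_eq_norm, norm_sub_rev] at hx
    have := norm_sub_norm_le y' x
    simp only [Set.mem_ofPred_eq]; linarith
  have hsub' : ball y s ⊆ {x : V | R < ‖x‖} := fun x hx => by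
    have := hsub y s hx
    simp only [Set.mem_ofPred_eq] at this ⊢
    linarith [le_max_right R0 R]
  obtain ⟨q', c1, e1, M, hM, hM'⟩ := exists_cut hr hrs (hq.mono hsub')
  obtain ⟨H', c2, e2, N, hN, hN'⟩ := exists_cut hr hrs (hH.mono hsub')
  set r' := (2 * r + s) / 3 with hr'
  have e1' : ∀ x ∈ ball y r', fderiv ℝ q x = fderiv ℝ q' x := fun x hx => by
    refine (Filter.EventuallyEq.fderiv_eq ?_).symm
    filter_upwards [isOpen_ball.mem_nhds hx] with z hz using e1 z hz
  have e2' : ∀ x ∈ ball y r', fderiv ℝ H x = fderiv ℝ H' x := fun x hx => by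
    refine (Filter.EventuallyEq.fderiv_eq ?_).symm
    filter_upwards [isOpen_ball.mem_nhds hx] with z hz using e2 z hz
  have hcb : ∀ x ∈ ball y ((s - r) / 3), ∀ t : ℝ, |t| ≤ r → closedBall x |t| ⊆ ball y r' := by
    intro x hx t ht z hz
    rw [mem_ball] at hx ⊢
    rw [mem_closedBall] at hz
    linarith [dist_triangle z x y]
  have hpos : 0 < (s - r) / 3 := by linarith
  have hyy : y ∈ ball y ((s - r) / 3) := mem_ball_self hpos
  have hyr' : y ∈ ball y r' := mem_ball_self (by linarith)
  have key : ∀ x ∈ ball y ((s - r) / 3), q x = Kop μ (sk E η) r q' x - ∫ t in (0:ℝ)..r, t • Kop μ (sk E ψ) t H' x := by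
    intro x hx
    rw [h0 x r hr ?_]
    · congr 1
      · exact Kop_congr μ fun z hz => (e1 z (hcb x hx r (abs_of_pos hr).le hz)).symm
      · refine intervalIntegral.integral_congr fun t ht => ?_
        rw [Set.uIcc_of_le hr.le] at ht
        rw [Kop_congr μ (H := H) (H' := H') fun z hz => (e2 z (hcb x hx t (by rw [abs_of_nonneg ht.1]; exact ht.2) hz)).symm]
    · have := hsub y _ hx
      simp only [Set.mem_ofPred_eq] at this
      linarith [le_max_left R0 R]
  have hd := (Kop_deriv_right μ hη hη' c1 hM' r y).sub (int_Kop_deriv_right μ hψ hψ' c2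
    (M := N) hN' hN hr y)
  have hd' := (hd.congr_of_eventuallyEq (f₁ := q) (by
    filter_upwards [isOpen_ball.mem_nhds hyy] with x hx using key x hx)).fderiv
  rw [hd']
  congr 1
  · exact Kop_congr μ fun z hz => (e1' z (hcb y hyy r (abs_of_pos hr).le hz)).symm
  · refine intervalIntegral.integral_congr fun t ht => ?_
    rw [Set.uIcc_of_le hr.le] at ht
    rw [Kop_congr μ (H := fderiv ℝ H) (H' := fderiv ℝ H') fun z hz => (e2' z (hcb y hyy t (by rw [abs_of_nonneg ht.1]; exact ht.2) hz))]

lemma SH.contDiff_one {k : ℕ} {q : V → E} {σ : ℝ → ℝ} (h : SH (k+1) E q σ) (hσ : Wt σ) :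
    ∃ R : ℝ, ContDiffOn ℝ 1 q {y | R < ‖y‖} := by
  have h1 := h.diff
  have h2 := (h.fderiv.of_le (Nat.zero_le k) hσ.div).contAt
  obtain ⟨R, hR⟩ := ev_cob.1 (h1.and h2)
  refine ⟨R, ?_⟩
  rw [show (1 : WithTop ℕ∞) = 0 + 1 from rfl, contDiffOn_succ_iff_fderiv_of_isOpen
    (isOpen_lt continuous_const continuous_norm)]
  refine ⟨?_, by simp, contDiffOn_zero.2 ?_⟩
  · intro y hy; exact (hR y (le_of_lt hy)).1.differentiableWithinAt
  · intro y hy; exact (hR y (le_of_lt hy)).2.continuousWithinAt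

lemma schauder {η ψ : V → ℝ} (hη : ContDiff ℝ ∞ η) (hη' : tsupport η ⊆ closedBall 0 1)
    (hψ : ContDiff ℝ ∞ ψ) (hψ' : tsupport ψ ⊆ closedBall 0 1) {k : ℕ} {q H : V → E}
    (hP : Pois μ η ψ q H) {θ : ℝ → ℝ} (hθ : Wt θ)
    (hc : ∀ᶠ y in cobounded V, ContinuousAt q y) {C1 : ℝ} (hb : ∀ᶠ y in cobounded V, ‖q y‖ ≤ C1 * θ ‖y‖)
    (hH : SH k E H (fun r => θ r / r / r)) : SH (k + 2) E q θ := by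
  induction k generalizing E θ C1 with
  | zero => exact schauder_zero μ (Ker_sk hη hη') (Ker_sk hψ hψ') hP hθ hc hb hH
  | succ k ih =>
    have h2 := schauder_zero μ (Ker_sk hη hη') (Ker_sk hψ hψ') hP hθ hc hb
      (hH.of_le (Nat.zero_le _) hθ.div.div)
    obtain ⟨R1, hR1⟩ := h2.contDiff_one hθ
    obtain ⟨R2, hR2⟩ := hH.contDiff_one hθ.div.div
    have hP' := hP.deriv μ (Ker_sk hη hη') (Ker_sk hη hη') (Ker_sk hψ hψ') (Ker_sk hψ hψ')
      (R := max R1 R2) (hR1.mono fun y hy => (le_max_left R1 R2).trans_lt hy) (hR2.mono fun y hy => (le_max_right R1 R2).trans_lt hy)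
    obtain ⟨C, _, hC⟩ := h2.fderiv.bound
    refine SH_succ_iff.2 ⟨(SH_succ_iff.1 h2).1, ih hP' hθ.div ?_ hC hH.fderiv⟩
    exact (h2.fderiv.of_le (Nat.zero_le _) hθ.div).contAt

end PartFive


section PartSix
open Filter Bornology Topology MeasureTheory Metric
open scoped ContDiff

variable {V : Type} [NormedAddCommGroup V] [InnerProductSpace ℝ V] [FiniteDimensional ℝ V]
  [MeasurableSpace V] [BorelSpace V] (μ : Measure V) [μ.IsAddHaarMeasure]

/-- kernels for the Poisson representation -/
structure PK (η ψ : V → ℝ) : Prop where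
  sη : ContDiff ℝ ∞ η
  sψ : ContDiff ℝ ∞ ψ
  tη : tsupport η ⊆ closedBall 0 1
  tψ : tsupport ψ ⊆ closedBall 0 1
  nη : ∀ z, 0 ≤ η z
  nψ : ∀ z, 0 ≤ ψ z
  iη : ∫ z in closedBall (0 : V) 1, η z ∂μ = 1
  dψ : ∀ z v, fderiv ℝ ψ z v = - η z * inner ℝ z v

lemma exists_PK : ∃ η ψ : V → ℝ, PK μ η ψ := by
  set g1 : ℝ → ℝ := fun x => (Polynomial.X ^ 2 : Polynomial ℝ).eval x⁻¹ * expNegInvGlue x with hg1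
  have hd : ∀ x, HasDerivAt expNegInvGlue (g1 x) x := by
    intro x
    have := expNegInvGlue.hasDerivAt_polynomial_eval_inv_mul 1 x
    simpa [hg1] using this
  have hs1 : ContDiff ℝ ∞ g1 := expNegInvGlue.contDiff_polynomial_eval_inv_mul (n := ⊤) _
  have hn1 : ∀ x, 0 ≤ g1 x := fun x => by
    simp only [hg1, Polynomial.eval_pow, Polynomial.eval_X]
    exact mul_nonneg (sq_nonneg _) (expNegInvGlue.nonneg _)
  have hz1 : ∀ x, x ≤ 0 → g1 x = 0 := fun x hx => by
    simp only [hg1, expNegInvGlue.zero_of_nonpos hx, mul_zero]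
  set η0 : V → ℝ := fun z => 2 * g1 (1 - ‖z‖ ^ 2) with hη0
  have hsq : ContDiff ℝ ∞ (fun z : V => 1 - ‖z‖ ^ 2) := contDiff_const.sub (contDiff_norm_sq ℝ)
  have hsη0 : ContDiff ℝ ∞ η0 := contDiff_const.mul (hs1.comp hsq)
  have hsub : ∀ (f : V → ℝ), (∀ z, 1 < ‖z‖ → f z = 0) → tsupport f ⊆ closedBall 0 1 := by
    intro f hf
    refine closure_minimal (fun z hz => ?_) isClosed_closedBall
    by_contra h
    rw [mem_closedBall, dist_zero_right, not_le] at h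
    exact hz (hf z h)
  have hneg : ∀ z : V, 1 < ‖z‖ → 1 - ‖z‖ ^ 2 ≤ 0 := fun z hz => by nlinarith
  have htη0 : tsupport η0 ⊆ closedBall 0 1 := hsub _ fun z hz => by
    simp only [hη0, hz1 _ (hneg z hz), mul_zero]
  have hcs : HasCompactSupport η0 := 
    (isCompact_closedBall 0 1).of_isClosed_subset (isClosed_tsupport _) htη0
  have hI : 0 < ∫ z, η0 z ∂μ := by
    refine hsη0.continuous.integral_pos_of_hasCompactSupport_nonneg_nonzero (x := 0) hcs 
      (fun z => mul_nonneg zero_le_two (hn1 _)) ?_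
    simp only [hη0, hg1]
    have := expNegInvGlue.pos_of_pos (x := 1) one_pos
    simp
  set I := ∫ z, η0 z ∂μ with hIdef
  have hI2 : ∫ z in closedBall (0 : V) 1, η0 z ∂μ = I := 
    setIntegral_eq_integral_of_forall_compl_eq_zero fun z hz => 
      image_eq_zero_of_notMem_tsupport fun h' => hz (htη0 h')
  refine ⟨fun z => I⁻¹ * η0 z, fun z => I⁻¹ * expNegInvGlue (1 - ‖z‖ ^ 2), ?_, ?_, ?_, ?_, ?_, ?_, ?_, ?_⟩
  · exact contDiff_const.mul hsη0
  · exact contDiff_const.mul ((expNegInvGlue.contDiff (n := ⊤)).comp hsq)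
  · refine hsub _ fun z hz => ?_
    simp only [hη0, hz1 _ (hneg z hz), mul_zero]
  · refine hsub _ fun z hz => ?_
    simp only [expNegInvGlue.zero_of_nonpos (hneg z hz), mul_zero]
  · exact fun z => mul_nonneg (by positivity) (mul_nonneg zero_le_two (hn1 _))
  · exact fun z => mul_nonneg (by positivity) (expNegInvGlue.nonneg _)
  · rw [integral_const_mul, hI2, inv_mul_cancel₀ hI.ne']
  · intro z v
    have h1 : HasFDerivAt (fun z : V => 1 - ‖z‖ ^ 2) (-(2 • innerSL ℝ z)) z :=
      ((hasStrictFDerivAt_norm_sq z).hasFDerivAt).const_sub 1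
    have h2 := ((hd (1 - ‖z‖ ^ 2)).comp_hasFDerivAt z h1).const_mul I⁻¹
    have h3 := h2.fderiv
    simp only [Function.comp_def] at h3
    rw [h3]
    simp [hη0]
    ring

variable {μ} {η ψ : V → ℝ}

lemma PK.kη (h : PK μ η ψ) {E : Type} [NormedAddCommGroup E] [NormedSpace ℝ E] : Ker (sk E η) := Ker_sk h.sη h.tη
lemma PK.kψ (h : PK μ η ψ) {E : Type} [NormedAddCommGroup E] [NormedSpace ℝ E] : Ker (sk E ψ) := Ker_sk h.sψ h.tψ

lemma PK.A_deriv (h : PK μ η ψ) {U : V → ℝ} (hU : ContDiff ℝ 2 U) {ι : Type} [Fintype ι] (b : OrthonormalBasis ι ℝ V)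
    (y : V) (t : ℝ) : HasDerivAt (fun t => Kop μ (sk ℝ η) t U y)
      (t * Kop μ (sk ℝ ψ) t (fun x => ∑ i, fderiv ℝ (fderiv ℝ U) x (b i) (b i)) y) t := by
  have cη := h.sη.continuous
  have cψ := h.sψ.continuous
  have cU := hU.continuous
  have hU1 : ContDiff ℝ 1 (fderiv ℝ U) := hU.fderiv_right (by norm_num)
  have cU1 := hU1.continuous
  have cU2 : Continuous (fderiv ℝ (fderiv ℝ U)) := hU1.continuous_fderiv (by simp)
  have dU := hU.differentiable (by simp)
  have dU1 := hU1.differentiable (by simp)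
  have hψc : HasCompactSupport ψ := (isCompact_closedBall (0:V) 1).of_isClosed_subset (isClosed_tsupport _) h.tψ
  have h1 : HasDerivAt (fun t => Kop μ (sk ℝ η) t U y)
      (∫ z in closedBall (0:V) 1, η z * (fderiv ℝ U (y - t • z) (-z)) ∂μ) t := by
    have cF : Continuous (fun p : ℝ × V => η p.2 * (fderiv ℝ U (y - p.1 • p.2) (-p.2))) := by fun_prop
    obtain ⟨M, hM⟩ := ((isCompact_Icc (a := t - 1) (b := t + 1)).prod 
      (isCompact_closedBall (0 : V) 1)).exists_bound_of_continuousOn cF.continuousOn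
    refine (hasDerivAt_integral_of_dominated_loc_of_deriv_le (μ := μ.restrict (closedBall (0:V) 1))
      (F := fun t z => (sk ℝ η z) (U (y - t • z))) (F' := fun t z => η z * (fderiv ℝ U (y - t • z) (-z)))
      (bound := fun _ => M) (s := Set.Icc (t - 1) (t + 1)) (Icc_mem_nhds (by linarith) (by linarith)) ?_ ?_ ?_ ?_ ?_ ?_).2
    · exact Eventually.of_forall fun t => (Kop_integrable μ h.kη (t := t) (y := y) cU.continuousOn).aestronglyMeasurable
    · exact Kop_integrable μ h.kη cU.continuousOn
    · exact (Continuous.aestronglyMeasurable (by fun_prop))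
    · filter_upwards [ae_restrict_mem measurableSet_closedBall] with z hz s hs
      exact hM (s, z) ⟨hs, hz⟩
    · exact integrableOn_const (by exact measure_closedBall_lt_top.ne)
    · refine Eventually.of_forall fun z s _ => ?_
      have e1 : HasDerivAt (fun s : ℝ => y - s • z) (-z) s := by
        have := ((hasDerivAt_id s).smul_const z).const_sub y
        simpa using this
      have := ((dU (y - s • z)).hasFDerivAt.comp_hasDerivAt s e1).const_mul (η z)
      simpa [sk, Function.comp_def] using this
  convert h1 using 1
  -- integration by parts
  have cb : ∀ i, Continuous (fun z => fderiv ℝ (fderiv ℝ U) (y - t • z) (b i) (b i)) := by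
    intro i; fun_prop
  have e0 : Kop μ (sk ℝ ψ) t (fun x => ∑ i, fderiv ℝ (fderiv ℝ U) x (b i) (b i)) y =
      ∑ i, ∫ z, ψ z * fderiv ℝ (fderiv ℝ U) (y - t • z) (b i) (b i) ∂μ := by
    rw [Kop, setIntegral_eq_integral_of_forall_compl_eq_zero, ← integral_finsetSum]
    · congr 1; ext z; simp [sk, Finset.mul_sum]
    · intro i _
      exact (cψ.mul (cb i)).integrable_of_hasCompactSupport 
        (hψc.mul_right)
    · intro z hz
      rw [h.kψ.zero hz]; simp
  have e1 : ∫ z in closedBall (0:V) 1, η z * (fderiv ℝ U (y - t • z) (-z)) ∂μ =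
      ∑ i, ∫ z, fderiv ℝ ψ z (b i) * fderiv ℝ U (y - t • z) (b i) ∂μ := by
    rw [setIntegral_eq_integral_of_forall_compl_eq_zero, ← integral_finsetSum]
    · congr 1; ext z
      have hz : -z = ∑ i, (-(inner ℝ (b i) z : ℝ)) • b i := by
        nth_rewrite 1 [← b.sum_repr' z]
        simp [Finset.sum_neg_distrib]
      rw [hz, map_sum, Finset.mul_sum]
      refine Finset.sum_congr rfl fun i _ => ?_
      rw [map_smul, h.dψ, real_inner_comm, smul_eq_mul]; ring
    · intro i _
      refine Continuous.integrable_of_hasCompactSupport ?_ ?_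
      · have : Continuous (fderiv ℝ ψ) := h.sψ.continuous_fderiv (by simp)
        fun_prop
      · refine HasCompactSupport.mul_right ?_
        exact hψc.fderiv_apply ℝ (b i)
    · intro z hz
      rw [show η z = 0 from image_eq_zero_of_notMem_tsupport fun h' => hz (h.tη h'), zero_mul]
  rw [e0, e1, Finset.mul_sum]
  refine Finset.sum_congr rfl fun i _ => ?_
  have hfd : ∀ z, HasFDerivAt (fun z => fderiv ℝ U (y - t • z) (b i)) 
      ((ContinuousLinearMap.apply ℝ ℝ (b i)).comp ((fderiv ℝ (fderiv ℝ U) (y - t • z)).comp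
        (-(t • ContinuousLinearMap.id ℝ V)))) z := by
    intro z
    have e1 : HasFDerivAt (fun z : V => y - t • z) (-(t • ContinuousLinearMap.id ℝ V)) z := 
      ((hasFDerivAt_id z).const_smul t).const_sub y
    exact (ContinuousLinearMap.apply ℝ ℝ (b i)).hasFDerivAt.comp z ((dU1 (y - t • z)).hasFDerivAt.comp z e1)
  have hfd' : ∀ z, fderiv ℝ (fun z => fderiv ℝ U (y - t • z) (b i)) z (b i) = 
      - t * fderiv ℝ (fderiv ℝ U) (y - t • z) (b i) (b i) := by
    intro z
    rw [(hfd z).fderiv]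
    simp
  have ibp := integral_mul_fderiv_eq_neg_fderiv_mul_of_integrable (μ := μ) (f := ψ)
    (g := fun z => fderiv ℝ U (y - t • z) (b i)) (v := b i) ?_ ?_ ?_ ?_ ?_
  · simp only [hfd'] at ibp
    have : ∀ z, ψ z * (-t * fderiv ℝ (fderiv ℝ U) (y - t • z) (b i) (b i)) =
      (-t) * (ψ z * fderiv ℝ (fderiv ℝ U) (y - t • z) (b i) (b i)) := fun z => by ring
    simp only [this, integral_const_mul] at ibp
    linarith
  · refine Continuous.integrable_of_hasCompactSupport ?_ ?_
    · have : Continuous (fderiv ℝ ψ) := h.sψ.continuous_fderiv (by simp)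
      fun_prop
    · exact (hψc.fderiv_apply ℝ (b i)).mul_right
  · simp only [hfd']
    refine Continuous.integrable_of_hasCompactSupport ?_ hψc.mul_right
    fun_prop
  · refine Continuous.integrable_of_hasCompactSupport ?_ hψc.mul_right
    fun_prop
  · intro z _
    exact (h.sψ.differentiable (by simp)) z
  · intro z _
    exact (hfd z).differentiableAt

lemma PK.rep (h : PK μ η ψ) {U : V → ℝ} (hU : ContDiff ℝ 2 U) {ι : Type} [Fintype ι] (b : OrthonormalBasis ι ℝ V)
    (y : V) (r : ℝ) : U y = Kop μ (sk ℝ η) r U y - 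
      ∫ t in (0:ℝ)..r, t • Kop μ (sk ℝ ψ) t (fun x => ∑ i, fderiv ℝ (fderiv ℝ U) x (b i) (b i)) y := by
  have hU1 : ContDiff ℝ 1 (fderiv ℝ U) := hU.fderiv_right (by norm_num)
  have cU2 : Continuous (fderiv ℝ (fderiv ℝ U)) := hU1.continuous_fderiv (by simp)
  have := intervalIntegral.integral_eq_sub_of_hasDerivAt (a := 0) (b := r) (fun t _ => h.A_deriv hU b y t) ?_
  · simp only [smul_eq_mul]
    rw [this]
    have e0 : Kop μ (sk ℝ η) 0 U y = U y := by
      simp only [Kop, sk, zero_smul, sub_zero, _root_.smul_apply, ContinuousLinearMap.id_apply, smul_eq_mul]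
      rw [integral_mul_const, h.iη, one_mul]
    rw [e0]; ring
  · apply Continuous.intervalIntegrable
    exact continuous_id.mul (Kop_contOn μ h.kψ (by fun_prop) y)

end PartSix


section PartSeven
open Filter Bornology Topology MeasureTheory Metric

/-- decay profile -/
structure Tail (n : ℕ) (ζ : ℝ) (Θ : ℝ → ℝ) : Prop where
  wt : Wt Θ
  pos : ∀ R, 2 ≤ R → 0 < Θ R
  dom : ∃ C : ℝ, 0 < C ∧ ∀ R, 2 ≤ R → R ^ (-ζ) ≤ C * Θ R
  int : ∀ R, 2 ≤ R → IntegrableOn (fun t => t * Θ t) (Set.Ioi R)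
  tail : ∃ C : ℝ, 0 < C ∧ ∀ R, 2 ≤ R → ∫ t in Set.Ioi R, t * Θ t ≤ C * (R ^ 2 * Θ R)
  rad : ∃ C : ℝ, 0 < C ∧ ∀ t, 2 ≤ t → ∫ ρ in (0:ℝ)..3, ρ ^ (n - 1) * (1 + t * ρ) ^ (-ζ) ≤ C * Θ t
  lim : Tendsto Θ atTop (𝓝 0)

lemma rad_aux {n : ℕ} (hn : 1 ≤ n) {ζ t : ℝ} (ht : 0 < t) :
    ∫ ρ in (0:ℝ)..3, ρ ^ (n - 1) * (1 + t * ρ) ^ (-ζ) ≤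
      ∫ ρ in (0:ℝ)..3, t ^ (1 - n : ℝ) * (1 + t * ρ) ^ (n - 1 - ζ) := by
  have hp : ∀ ρ ∈ Set.uIcc (0:ℝ) 3, 1 + t * ρ ≠ 0 := fun ρ hρ => by
    rw [Set.uIcc_of_le (by norm_num)] at hρ
    have := mul_nonneg ht.le hρ.1
    linarith
  have hc : ∀ a : ℝ, ContinuousOn (fun ρ : ℝ => (1 + t * ρ) ^ a) (Set.uIcc 0 3) := fun a =>
    ContinuousOn.rpow_const (by fun_prop) fun ρ hρ => Or.inl (hp ρ hρ)
  refine intervalIntegral.integral_mono_on (by norm_num) 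
    (ContinuousOn.intervalIntegrable (ContinuousOn.mul (by fun_prop) (hc _)))
    (ContinuousOn.intervalIntegrable (ContinuousOn.mul (by fun_prop) (hc _))) fun ρ hρ => ?_
  have h0 := mul_nonneg ht.le hρ.1
  have h1 : 0 < 1 + t * ρ := by linarith
  have h2 : ρ ^ (n - 1) ≤ ((1 + t * ρ) / t) ^ (n - 1) := by
    refine pow_le_pow_left₀ hρ.1 ?_ _
    rw [le_div_iff₀ ht]; linarith
  have h3 : ((1 + t * ρ) / t) ^ (n - 1) = t ^ (1 - n : ℝ) * (1 + t * ρ) ^ ((n : ℝ) - 1) := by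
    rw [← Real.rpow_natCast, Nat.cast_sub hn, Nat.cast_one, Real.div_rpow h1.le ht.le,
      show (1 - n : ℝ) = -((n:ℝ) - 1) by ring, Real.rpow_neg ht.le]
    field_simp
  rw [show (n - 1 - ζ : ℝ) = (n - 1) + (-ζ) by ring, Real.rpow_add h1, ← mul_assoc, ← h3]
  gcongr

lemma rad_pow {n : ℕ} (hn : 1 ≤ n) {ζ t : ℝ} (ht : 0 < t) (hne : (n:ℝ) ≠ ζ) :
    ∫ ρ in (0:ℝ)..3, ρ ^ (n - 1) * (1 + t * ρ) ^ (-ζ) ≤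
      t ^ (-n : ℝ) * (((1 + 3 * t) ^ (n - ζ) - 1) / (n - ζ)) := by
  refine (rad_aux hn ht).trans (le_of_eq ?_)
  have hne' : (n - ζ : ℝ) ≠ 0 := sub_ne_zero.2 hne
  rw [intervalIntegral.integral_const_mul]
  have hp : ∀ ρ ∈ Set.uIcc (0:ℝ) 3, 1 + t * ρ ≠ 0 := fun ρ hρ => by
    rw [Set.uIcc_of_le (by norm_num)] at hρ
    have := mul_nonneg ht.le hρ.1
    linarith
  rw [intervalIntegral.integral_eq_sub_of_hasDerivAt (f := fun ρ => (1 + t * ρ) ^ (n - ζ) / (t * (n - ζ)))]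
  · rw [show (-n : ℝ) = (1 - n) + (-1) by ring, Real.rpow_add ht, Real.rpow_neg_one]
    simp only [mul_zero, add_zero, Real.one_rpow]
    rw [mul_comm t 3]
    field_simp
  · intro ρ hρ
    have e1 : HasDerivAt (fun ρ : ℝ => 1 + t * ρ) t ρ := by
      simpa using ((hasDerivAt_id ρ).const_mul t).const_add 1
    have := (e1.rpow_const (p := n - ζ) (Or.inl (hp ρ hρ))).div_const (t * (n - ζ))
    refine this.congr_deriv ?_
    rw [show (n - 1 - ζ : ℝ) = n - ζ - 1 by ring]
    field_simp
  · apply ContinuousOn.intervalIntegrable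
    exact ContinuousOn.rpow_const (by fun_prop) fun ρ hρ => Or.inl (hp ρ hρ)

lemma rad_log {n : ℕ} (hn : 1 ≤ n) {t : ℝ} (ht : 0 < t)  :
    ∫ ρ in (0:ℝ)..3, ρ ^ (n - 1) * (1 + t * ρ) ^ (-(n:ℝ)) ≤
      t ^ (-n : ℝ) * Real.log (1 + 3 * t) := by
  refine (rad_aux hn ht).trans (le_of_eq ?_)
  rw [intervalIntegral.integral_const_mul]
  have hp : ∀ ρ ∈ Set.uIcc (0:ℝ) 3, 1 + t * ρ ≠ 0 := fun ρ hρ => by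
    rw [Set.uIcc_of_le (by norm_num)] at hρ
    have := mul_nonneg ht.le hρ.1
    linarith
  rw [intervalIntegral.integral_eq_sub_of_hasDerivAt (f := fun ρ => Real.log (1 + t * ρ) / t)]
  · rw [show (-n : ℝ) = (1 - n) + (-1) by ring, Real.rpow_add ht, Real.rpow_neg_one]
    simp only [mul_zero, add_zero, Real.log_one, zero_div, sub_zero]
    rw [mul_comm t 3]
    field_simp
  · intro ρ hρ
    have e1 : HasDerivAt (fun ρ : ℝ => 1 + t * ρ) t ρ := by
      simpa using ((hasDerivAt_id ρ).const_mul t).const_add 1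
    have := (e1.log (hp ρ hρ)).div_const t
    refine this.congr_deriv ?_
    rw [show (n - 1 - n : ℝ) = -1 by ring, Real.rpow_neg_one]
    field_simp
  · apply ContinuousOn.intervalIntegrable
    exact ContinuousOn.rpow_const (by fun_prop) fun ρ hρ => Or.inl (hp ρ hρ)

lemma tail_pow {n : ℕ} (hn : 3 ≤ n) {ζ : ℝ} (hζ : 2 < ζ) (hne : ζ ≠ n) :
    Tail n ζ (fun t => t ^ (-(min (n:ℝ) ζ))) := by
  have hn' : (3:ℝ) ≤ n := by exact_mod_cast hn
  set s := min (n:ℝ) ζ with hs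
  have hs2 : 2 < s := lt_min (by linarith) hζ
  have e1 : ∀ t : ℝ, 0 < t → t * t ^ (-s) = t ^ (1 - s) := fun t ht => by
    nth_rewrite 1 [← Real.rpow_one t]
    rw [← Real.rpow_add ht]; ring_nf
  refine ⟨Wt.rpow _, fun R hR => by positivity, ⟨1, one_pos, fun R hR => ?_⟩, fun R hR => ?_,
    ⟨1 / (s - 2), by apply div_pos <;> linarith, fun R hR => ?_⟩, ?_, ?_⟩
  · rw [one_mul]
    exact Real.rpow_le_rpow_of_exponent_le (by linarith) (by linarith [min_le_right (n:ℝ) ζ])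
  · refine (integrableOn_Ioi_rpow_of_lt (a := 1 - s) (by linarith) (by linarith : 0 < R)).congr_fun
      (fun t ht => ?_) measurableSet_Ioi
    have : R < t := ht
    rw [e1 t (by linarith)]
  · rw [setIntegral_congr_fun measurableSet_Ioi (g := fun t => t ^ (1 - s)) 
      (fun t ht => by have : R < t := ht; simp only; rw [e1 t (by linarith)]),
      integral_Ioi_rpow_of_lt (by linarith) (by linarith)]
    have : R ^ 2 * R ^ (-s) = R ^ (1 - s + 1) := by
      rw [← Real.rpow_natCast, ← Real.rpow_add (by linarith)]
      congr 1; push_cast; ring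
    rw [this]
    have h2 : s - 2 ≠ 0 := by linarith
    have h3 : 1 - s + 1 ≠ 0 := by linarith
    apply le_of_eq
    rw [show 1 - s + 1 = -(s - 2) by ring] at *
    field_simp
  · rcases lt_or_gt_of_ne hne with h | h
    · have hsz : s = ζ := min_eq_right h.le
      have hd : 0 < n - ζ := by linarith
      refine ⟨4 ^ (n - ζ) / (n - ζ), by positivity, fun t ht => ?_⟩
      have ht0 : 0 < t := by linarith
      refine (rad_pow (by omega) ht0 h.ne').trans ?_
      have h4 : (1 + 3 * t) ^ (n - ζ) ≤ 4 ^ (n - ζ) * t ^ (n - ζ) := by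
        rw [← Real.mul_rpow (by norm_num) ht0.le]
        exact Real.rpow_le_rpow (by linarith) (by linarith) hd.le
      have h5 : t ^ (-s) = t ^ (-n : ℝ) * t ^ (n - ζ) := by
        rw [← Real.rpow_add ht0, hsz]; ring_nf
      rw [h5]
      have h6 : 0 < t ^ (-n : ℝ) := by positivity
      calc _ ≤ t ^ (-n : ℝ) * ((4 ^ (n - ζ) * t ^ (n - ζ)) / (n - ζ)) := by
            gcongr; linarith
        _ = _ := by ring
    · have hsz : s = n := min_eq_left h.le
      have hd : 0 < ζ - n := by linarith
      refine ⟨1 / (ζ - n), by positivity, fun t ht => ?_⟩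
      have ht0 : 0 < t := by linarith
      refine (rad_pow (by omega) ht0 h.ne).trans ?_
      rw [hsz, mul_comm]
      gcongr ?_ * _
      rw [← neg_sub ζ, ← neg_sub 1, neg_div_neg_eq]
      gcongr
      have : 0 < (1 + 3 * t) ^ (-(ζ - n)) := by positivity
      linarith
  · exact tendsto_rpow_neg_atTop (by linarith)

lemma tail_log {n : ℕ} (hn : 3 ≤ n) : Tail n n (fun t => t ^ (-(n:ℝ)) * Real.log t) := by
  have hn' : (3:ℝ) ≤ n := by exact_mod_cast hn
  have hl2 : ∀ R : ℝ, 2 ≤ R → 1/2 ≤ Real.log R := fun R hR => by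
    have := Real.log_two_gt_d9
    have := Real.log_le_log (by norm_num) hR
    linarith
  have hlpos : ∀ R : ℝ, 2 ≤ R → 0 < Real.log R := fun R hR => by linarith [hl2 R hR]
  have hlog : ∀ R t : ℝ, 0 < R → R ≤ t → Real.log t ≤ Real.log R + 2 * (R ^ (-1/2:ℝ) * t ^ (1/2:ℝ)) := by
    intro R t hR ht
    have ht0 : 0 < t := by linarith
    have h1 : Real.log (t / R) ≤ (t / R) ^ (1/2:ℝ) / (1/2) := Real.log_le_rpow_div (by positivity) (by norm_num)
    rw [Real.log_div ht0.ne' hR.ne', Real.div_rpow ht0.le hR.le] at h1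
    rw [show (-1/2:ℝ) = -(1/2) by norm_num, Real.rpow_neg hR.le]
    have : t ^ (1/2:ℝ) / R ^ (1/2:ℝ) / (1/2) = 2 * ((R ^ (1/2:ℝ))⁻¹ * t ^ (1/2:ℝ)) := by ring
    linarith
  have key : ∀ R : ℝ, 2 ≤ R → ∀ t ∈ Set.Ioi R, t * (t ^ (-(n:ℝ)) * Real.log t) ≤
      Real.log R * t ^ (1 - n : ℝ) + 2 * R ^ (-1/2:ℝ) * t ^ (3/2 - n : ℝ) := by
    intro R hR t ht
    have ht : R < t := ht
    have hR0 : 0 < R := by linarith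
    have ht0 : 0 < t := by linarith
    have e1 : t * t ^ (-(n:ℝ)) = t ^ (1 - n : ℝ) := by
      nth_rewrite 1 [← Real.rpow_one t]
      rw [← Real.rpow_add ht0]; ring_nf
    have e2 : t ^ (3/2 - n : ℝ) = t ^ (1 - n : ℝ) * t ^ (1/2:ℝ) := by
      rw [← Real.rpow_add ht0]; ring_nf
    rw [← mul_assoc, e1, e2]
    have h3 : 0 < t ^ (1 - n : ℝ) := by positivity
    have := mul_le_mul_of_nonneg_left (hlog R t hR0 ht.le) h3.le
    calc _ ≤ _ := this
      _ = _ := by ring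
  have ki : ∀ R : ℝ, 2 ≤ R → IntegrableOn (fun t => Real.log R * t ^ (1 - n : ℝ) + 2 * R ^ (-1/2:ℝ) * t ^ (3/2 - n : ℝ)) (Set.Ioi R) := by
    intro R hR
    exact ((integrableOn_Ioi_rpow_of_lt (by linarith) (by linarith : 0 < R)).const_mul _).add
      ((integrableOn_Ioi_rpow_of_lt (by linarith) (by linarith : 0 < R)).const_mul _)
  have hint : ∀ R, 2 ≤ R → IntegrableOn (fun t => t * (t ^ (-(n:ℝ)) * Real.log t)) (Set.Ioi R) := by
    intro R hR
    refine (ki R hR).mono' ?_ ?_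
    · refine ContinuousOn.aestronglyMeasurable (fun t ht => ?_) measurableSet_Ioi
      have ht : R < t := ht
      have ht0 : t ≠ 0 := by linarith
      exact (continuousAt_id.mul ((Real.continuousAt_rpow_const _ _ (Or.inl ht0)).mul (Real.continuousAt_log ht0))).continuousWithinAt
    · filter_upwards [ae_restrict_mem measurableSet_Ioi] with t ht
      have ht' : R < t := ht
      rw [Real.norm_eq_abs, abs_of_nonneg]
      · exact key R hR t ht
      · have := hlpos t (by linarith)
        have : 0 < t := by linarith
        positivity
  refine ⟨?_, fun R hR => ?_, ⟨2, two_pos, fun R hR => ?_⟩, hint,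
    ⟨9, by norm_num, fun R hR => ?_⟩, ⟨3, by norm_num, fun t ht => ?_⟩, ?_⟩
  · refine (Wt.rpow _).mul ⟨?_, fun Λ hΛ => ⟨2, two_pos, ?_⟩⟩
    · filter_upwards [eventually_ge_atTop 2] with r hr using hlpos r hr
    · filter_upwards [eventually_ge_atTop Λ, eventually_ge_atTop 2] with r hr hr2 s h1 h2
      have hs : 0 < s := by
        by_contra hs
        push Not at hs
        nlinarith
      have := Real.log_le_log hs (h2.trans (by gcongr : Λ * r ≤ r * r))
      rw [Real.log_mul (by linarith) (by linarith)] at this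
      linarith
  · have := hlpos R hR
    positivity
  · have := hl2 R hR
    have h2 : 0 < R ^ (-(n:ℝ)) := by positivity
    nlinarith
  · have hR0 : 0 < R := by linarith
    refine (setIntegral_mono_on (hint R hR) (ki R hR) measurableSet_Ioi (key R hR)).trans ?_
    rw [integral_add ((integrableOn_Ioi_rpow_of_lt (by linarith) hR0).const_mul _)
      ((integrableOn_Ioi_rpow_of_lt (by linarith) hR0).const_mul _), integral_const_mul, integral_const_mul,
      integral_Ioi_rpow_of_lt (by linarith) hR0, integral_Ioi_rpow_of_lt (by linarith) hR0]
    set X := R ^ (2 - n : ℝ) with hX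
    have hXp : 0 < X := by positivity
    have e1 : R ^ (1 - n + 1 : ℝ) = X := by rw [hX]; ring_nf
    have e2 : R ^ 2 * R ^ (-(n:ℝ)) = X := by
      rw [← Real.rpow_natCast, ← Real.rpow_add hR0, hX]; push_cast; ring_nf
    have e3 : R ^ (-1/2:ℝ) * R ^ (3/2 - n + 1 : ℝ) = X := by
      rw [← Real.rpow_add hR0, hX]; ring_nf
    have f1 : -R ^ (1 - n + 1 : ℝ) / (1 - n + 1 : ℝ) = X / (n - 2) := by
      rw [e1, show (1 - n + 1 : ℝ) = -(n - 2) by ring, neg_div_neg_eq]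
    have f2 : 2 * R ^ (-1/2:ℝ) * (-R ^ (3/2 - n + 1 : ℝ) / (3/2 - n + 1 : ℝ)) = 2 * X / (n - 5/2) := by
      rw [show (3/2 - n + 1 : ℝ) = -(n - 5/2) by ring] at *
      rw [neg_div_neg_eq, ← e3]; ring
    have f3 : R ^ 2 * (R ^ (-(n:ℝ)) * Real.log R) = X * Real.log R := by rw [← mul_assoc, e2]
    rw [f1, f2, f3]
    have g1 : X / (n - 2) ≤ X := div_le_self hXp.le (by linarith)
    have g2 : 2 * X / (n - 5/2) ≤ 4 * X := by
      rw [div_le_iff₀ (by linarith)]; nlinarith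
    have := hl2 R hR
    nlinarith
  · have ht0 : 0 < t := by linarith
    refine (rad_log (by omega) ht0).trans ?_
    have h1 : Real.log (1 + 3 * t) ≤ 3 * Real.log t := by
      have : Real.log (1 + 3 * t) ≤ Real.log (t ^ 3) := by
        refine Real.log_le_log (by linarith) ?_
        nlinarith [mul_nonneg (sub_nonneg.2 ht) (sub_nonneg.2 ht), mul_nonneg (mul_nonneg (sub_nonneg.2 ht) (sub_nonneg.2 ht)) ht0.le]
      rw [Real.log_pow] at this
      exact_mod_cast this
    have h2 : 0 < t ^ (-(n:ℝ)) := by positivity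
    calc _ ≤ t ^ (-(n:ℝ)) * (3 * Real.log t) := by gcongr
      _ = _ := by ring
  · have h1 : Tendsto (fun t : ℝ => t ^ (-(n - 1:ℝ))) atTop (𝓝 0) := tendsto_rpow_neg_atTop (by linarith)
    refine squeeze_zero' ?_ ?_ h1
    · filter_upwards [eventually_ge_atTop 2] with t ht
      have := hlpos t ht
      positivity
    · filter_upwards [eventually_ge_atTop 2] with t ht
      have ht0 : 0 < t := by linarith
      have := Real.log_le_self ht0.le
      calc t ^ (-(n:ℝ)) * Real.log t ≤ t ^ (-(n:ℝ)) * t := by gcongr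
        _ = t ^ (-(n:ℝ)) * t ^ (1:ℝ) := by rw [Real.rpow_one]
        _ = _ := by rw [← Real.rpow_add ht0]; ring_nf

end PartSeven


section PartEight
open Filter Bornology Topology MeasureTheory Metric
open scoped ContDiff

variable {V : Type} [NormedAddCommGroup V] [InnerProductSpace ℝ V] [FiniteDimensional ℝ V]
  [MeasurableSpace V] [BorelSpace V] {μ : Measure V} [μ.IsAddHaarMeasure]

lemma rad_int [Nontrivial V] {ζ t : ℝ} (ht : 0 < t) :
    Integrable ((closedBall (0:V) 3).indicator fun w => (1 + t * ‖w‖) ^ (-ζ)) μ ∧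
    ∫ w, (closedBall (0:V) 3).indicator (fun w => (1 + t * ‖w‖) ^ (-ζ)) w ∂μ =
      Module.finrank ℝ V * μ.real (ball 0 1) *
        ∫ ρ in (0:ℝ)..3, ρ ^ (Module.finrank ℝ V - 1) * (1 + t * ρ) ^ (-ζ) := by
  constructor
  · rw [integrable_indicator_iff measurableSet_closedBall]
    refine ContinuousOn.integrableOn_compact (isCompact_closedBall _ _) ?_
    refine ContinuousOn.rpow_const (by fun_prop) fun w _ => Or.inl ?_
    have := mul_nonneg ht.le (norm_nonneg w)
    linarith
  · have e : (closedBall (0:V) 3).indicator (fun w => (1 + t * ‖w‖) ^ (-ζ)) =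
        fun w => ((Set.Iic (3:ℝ)).indicator (fun ρ => (1 + t * ρ) ^ (-ζ))) ‖w‖ := by
      funext w
      by_cases hw : ‖w‖ ≤ 3
      · rw [Set.indicator_of_mem (by simpa using hw), Set.indicator_of_mem (by simpa using hw)]
      · rw [Set.indicator_of_notMem (by simpa using hw), Set.indicator_of_notMem (by simpa using hw)]
    rw [e, integral_fun_norm_addHaar, intervalIntegral.integral_of_le (by norm_num)]
    have e2 : ∀ ρ : ℝ, ρ ^ (Module.finrank ℝ V - 1) • (Set.Iic (3:ℝ)).indicator (fun ρ => (1 + t * ρ) ^ (-ζ)) ρ =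
        (Set.Iic (3:ℝ)).indicator (fun ρ => ρ ^ (Module.finrank ℝ V - 1) * (1 + t * ρ) ^ (-ζ)) ρ := by
      intro ρ
      simp only [Set.indicator_apply, smul_eq_mul]
      split_ifs <;> simp
    simp_rw [e2]
    rw [setIntegral_indicator measurableSet_Iic, Set.Ioi_inter_Iic]
    simp [mul_assoc]

lemma rad_Kop [Nontrivial V] {ζ : ℝ} {Θ : ℝ → ℝ} (hT : Tail (Module.finrank ℝ V) ζ Θ) (hζ : 0 < ζ) {η : V → ℝ}
    (hη : Continuous η) (hη' : tsupport η ⊆ closedBall 0 1) :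
    ∃ C : ℝ, 0 < C ∧ ∀ (h : V → ℝ) (K : ℝ), 0 ≤ K → (∀ x, ‖h x‖ ≤ K * (1 + ‖x‖) ^ (-ζ)) →
      ∀ t, 2 ≤ t → ∀ y, ‖y‖ ≤ 2 * t → ‖Kop μ (sk ℝ η) t h y‖ ≤ C * K * Θ t := by
  have hcs : HasCompactSupport η := (isCompact_closedBall (0:V) 1).of_isClosed_subset (isClosed_tsupport _) hη'
  obtain ⟨M, hM⟩ := hcs.exists_bound_of_continuous hη
  obtain ⟨C, hC, hrad⟩ := hT.rad
  have hM0 : 0 ≤ M := (norm_nonneg _).trans (hM 0)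
  refine ⟨(M + 1) * (Module.finrank ℝ V * μ.real (ball 0 1) + 1) * C, by positivity, fun h K hK hh t ht y hy => ?_⟩
  have ht0 : 0 < t := by linarith
  set F := (closedBall (0:V) 3).indicator (fun w => (1 + t * ‖w‖) ^ (-ζ)) with hF
  have hFi := rad_int (V := V) (μ := μ) (ζ := ζ) ht0
  have hFn : ∀ w, 0 ≤ F w := fun w => Set.indicator_nonneg (fun w _ => by positivity) w
  have hgi : Integrable (fun z => M * K * F (t⁻¹ • y - z)) μ := (hFi.1.comp_sub_left _).const_mul _
  have h1 : ‖Kop μ (sk ℝ η) t h y‖ ≤ ∫ z in closedBall (0:V) 1, M * K * F (t⁻¹ • y - z) ∂μ := by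
    refine norm_integral_le_of_norm_le hgi.integrableOn ?_
    filter_upwards [ae_restrict_mem measurableSet_closedBall] with z hz
    rw [mem_closedBall, dist_zero_right] at hz
    have hw : t⁻¹ • y - z ∈ closedBall (0:V) 3 := by
      rw [mem_closedBall, dist_zero_right]
      have : ‖t⁻¹ • y‖ ≤ 2 := by
        rw [norm_smul, norm_inv, Real.norm_of_nonneg ht0.le, inv_mul_le_iff₀ ht0]; linarith
      linarith [norm_sub_le (t⁻¹ • y) z]
    have e3 : t * ‖t⁻¹ • y - z‖ = ‖y - t • z‖ := by
      rw [← Real.norm_of_nonneg ht0.le, ← norm_smul, smul_sub, smul_smul, Real.norm_of_nonneg ht0.le, mul_inv_cancel₀ ht0.ne', one_smul]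
    rw [hF, Set.indicator_of_mem hw, e3]
    simp only [sk, _root_.smul_apply, ContinuousLinearMap.id_apply, norm_smul]
    calc _ ≤ M * (K * (1 + ‖y - t • z‖) ^ (-ζ)) := by
          gcongr
          · exact hM z
          · exact hh _
      _ = _ := by ring
  refine h1.trans ?_
  refine (setIntegral_le_integral hgi (ae_of_all _ fun z => mul_nonneg (by positivity) (hFn _))).trans ?_
  rw [integral_const_mul, integral_sub_left_eq_self F μ (t⁻¹ • y), hFi.2]
  have h2 := hrad t ht
  have h3 : 0 ≤ ∫ ρ in (0:ℝ)..3, ρ ^ (Module.finrank ℝ V - 1) * (1 + t * ρ) ^ (-ζ) := by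
    apply intervalIntegral.integral_nonneg (by norm_num)
    intro ρ hρ
    have := hρ.1
    positivity
  calc _ ≤ (M + 1) * K * ((Module.finrank ℝ V * μ.real (ball 0 1) + 1) * (C * Θ t)) := by
        gcongr <;> linarith
    _ = _ := by ring

lemma newton [Nontrivial V] {ζ : ℝ} {Θ : ℝ → ℝ} (hT : Tail (Module.finrank ℝ V) ζ Θ) (hζ : 0 < ζ) {η : V → ℝ}
    (hη : ContDiff ℝ ∞ η) (hη' : tsupport η ⊆ closedBall 0 1) {h : V → ℝ} (hc : Continuous h) {K : ℝ} (hK : 0 ≤ K)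
    (hh : ∀ x, ‖h x‖ ≤ K * (1 + ‖x‖) ^ (-ζ)) :
    (∀ y, IntegrableOn (fun t => t • Kop μ (sk ℝ η) t h y) (Set.Ioi 0)) ∧
    ∃ C : ℝ, 0 < C ∧ ∀ᶠ y in cobounded V, ‖∫ t in Set.Ioi (0:ℝ), t • Kop μ (sk ℝ η) t h y‖ ≤ C * (‖y‖ ^ 2 * Θ ‖y‖) := by
  obtain ⟨C3, hC3, h3⟩ := rad_Kop (μ := μ) hT hζ hη.continuous hη'
  obtain ⟨C1, hC1, h1⟩ := (Ker_sk (E := ℝ) hη hη').bound μ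
  obtain ⟨C2, hC2, h2⟩ := hT.dom
  obtain ⟨C4, hC4, h4⟩ := hT.tail
  have hct : ∀ y, Continuous (fun t => t • Kop μ (sk ℝ η) t h y) := fun y =>
    continuous_id.smul (Kop_contOn μ (Ker_sk hη hη') hc y)
  have hbt : ∀ y T, 2 ≤ T → ‖y‖ ≤ 2 * T → ∀ t ∈ Set.Ioi T, ‖t • Kop μ (sk ℝ η) t h y‖ ≤ C3 * K * (t * Θ t) := by
    intro y T hT2 hy t ht
    have ht : T < t := ht
    rw [norm_smul, Real.norm_of_nonneg (by linarith)]
    have := h3 h K hK hh t (by linarith) y (by linarith)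
    calc _ ≤ t * (C3 * K * Θ t) := by gcongr; linarith
      _ = _ := by ring
  have hit : ∀ y T, 2 ≤ T → ‖y‖ ≤ 2 * T → IntegrableOn (fun t => t • Kop μ (sk ℝ η) t h y) (Set.Ioi T) := by
    intro y T hT2 hy
    refine ((hT.int T hT2).const_mul (C3 * K)).mono' (hct y).aestronglyMeasurable ?_
    filter_upwards [ae_restrict_mem measurableSet_Ioi] with t ht using hbt y T hT2 hy t ht
  have hi0 : ∀ y T, IntegrableOn (fun t => t • Kop μ (sk ℝ η) t h y) (Set.Ioc 0 T) := fun y T =>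
    (hct y).continuousOn.integrableOn_Icc.mono_set Set.Ioc_subset_Icc_self
  refine ⟨fun y => ?_, ?_⟩
  · rw [← Set.Ioc_union_Ioi_eq_Ioi (b := 2 + ‖y‖) (by positivity)]
    exact (hi0 y _).union (hit y _ (by linarith [norm_nonneg y]) (by linarith [norm_nonneg y]))
  · obtain ⟨C5, hC5, h5⟩ := hT.wt.2 2 (by norm_num)
    refine ⟨(C1 * K * C2 + C3 * K * C4 + 1) * C5, by positivity, ?_⟩
    filter_upwards [ev_norm (V := V) h5, ev_norm (eventually_ge_atTop 4)] with y hy5 hy4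
    set R := ‖y‖ with hR
    have h5' : Θ (R / 2) ≤ C5 * Θ R := hy5 _ (by linarith) (by linarith)
    have hp := hT.pos (R/2) (by linarith)
    have b1 : ‖∫ t in Set.Ioc 0 (R/2), t • Kop μ (sk ℝ η) t h y‖ ≤ C1 * K * C2 * ((R/2)^2 * Θ (R/2)) := by
      have := norm_setIntegral_le_of_norm_le_const (μ := volume) (s := Set.Ioc 0 (R/2))
        (f := fun t => t • Kop μ (sk ℝ η) t h y) (C := (R/2) * (C1 * (K * (C2 * Θ (R/2))))) (by simp) ?_
      · refine this.trans (le_of_eq ?_)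
        simp only [Real.volume_real_Ioc, sub_zero]
        rw [max_eq_left (by linarith)]; ring
      · intro t ht
        rw [norm_smul, Real.norm_of_nonneg ht.1.le]
        have hb := h1 t h y (K * (C2 * Θ (R/2))) ?_
        · have := ht.2
          gcongr
        · intro z hz
          refine (hh _).trans ?_
          gcongr
          refine le_trans ?_ (h2 (R/2) (by linarith))
          refine Real.rpow_le_rpow_of_nonpos (by linarith) ?_ (by linarith)
          have e1 : ‖t • z‖ ≤ R/2 := by
            rw [norm_smul, Real.norm_of_nonneg ht.1.le]
            nlinarith [ht.1, ht.2, norm_nonneg z]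
          linarith [norm_sub_norm_le y (t • z)]
    have b2 : ‖∫ t in Set.Ioi (R/2), t • Kop μ (sk ℝ η) t h y‖ ≤ C3 * K * C4 * ((R/2)^2 * Θ (R/2)) := by
      refine (norm_integral_le_of_norm_le ((hT.int (R/2) (by linarith)).const_mul (C3 * K)) ?_).trans ?_
      · filter_upwards [ae_restrict_mem measurableSet_Ioi] with t ht using hbt y _ (by linarith) (by linarith) t ht
      · rw [integral_const_mul]
        calc _ ≤ C3 * K * (C4 * ((R/2)^2 * Θ (R/2))) := by gcongr; exact h4 _ (by linarith)
          _ = _ := by ring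
    rw [← Set.Ioc_union_Ioi_eq_Ioi (b := R/2) (by linarith : (0:ℝ) ≤ R/2), 
      setIntegral_union (Set.Ioc_disjoint_Ioi le_rfl) measurableSet_Ioi (hi0 y _) (hit y _ (by linarith) (by linarith))]
    refine (norm_add_le _ _).trans ((add_le_add b1 b2).trans ?_)
    have hpR := hT.pos R (by linarith)
    calc _ = (C1 * K * C2 + C3 * K * C4) * ((R/2)^2 * Θ (R/2)) := by ring
      _ ≤ (C1 * K * C2 + C3 * K * C4 + 1) * (R^2 * (C5 * Θ R)) := by
          refine mul_le_mul (by linarith) ?_ (by positivity) (by positivity)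
          gcongr; linarith
      _ = _ := by ring

end PartEight


section PartNine
open Filter Bornology Topology MeasureTheory Metric
open scoped ContDiff

lemma taylor3 {V : Type} [NormedAddCommGroup V] [NormedSpace ℝ V] {a : V → ℝ} {a1 : V → V →L[ℝ] ℝ}
    {a2 : V → V →L[ℝ] V →L[ℝ] ℝ} (h1 : ∀ y, HasFDerivAt a (a1 y) y) (h2 : ∀ y, HasFDerivAt a1 (a2 y) y)
    {ε : ℝ} (hε : 0 ≤ ε) (h3 : ∀ y, ‖a2 y - a2 0‖ ≤ ε * ‖y‖) (y : V) :
    ‖a y - a 0 - a1 0 y - (1/2) * a2 0 y y‖ ≤ ε * ‖y‖ * ‖y‖ * ‖y‖ := by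
  have hr1 : ∀ z ∈ closedBall (0:V) ‖y‖, ‖a1 z - a1 0 - a2 0 z‖ ≤ ε * ‖y‖ * ‖y‖ := by
    intro z hz
    have hd : ∀ x ∈ closedBall (0:V) ‖y‖, HasFDerivWithinAt (fun z => a1 z - a1 0 - a2 0 z) (a2 x - a2 0) (closedBall (0:V) ‖y‖) x :=
      fun x _ => (((h2 x).sub_const _).sub (a2 0).hasFDerivAt).hasFDerivWithinAt
    have := Convex.norm_image_sub_le_of_norm_hasFDerivWithin_le (C := ε * ‖y‖) hd (fun x hx => ?_) (convex_closedBall 0 ‖y‖)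
      (mem_closedBall_self (norm_nonneg y)) hz
    · simp only [map_zero, sub_zero, sub_self] at this
      refine this.trans ?_
      rw [mem_closedBall, dist_zero_right] at hz
      gcongr
    · rw [mem_closedBall, dist_zero_right] at hx
      exact (h3 x).trans (by gcongr)
  have hg : ∀ s ∈ Set.Icc (0:ℝ) 1, HasDerivWithinAt (fun s : ℝ => a (s • y) - s * a1 0 y - (1/2) * (s^2 * a2 0 y y))
      ((a1 (s • y) - a1 0 - a2 0 (s • y)) y) (Set.Icc 0 1) s := by
    intro s _
    have e1 : HasDerivAt (fun s : ℝ => s • y) y s := by simpa using (hasDerivAt_id s).smul_const y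
    have e2 := (h1 (s • y)).comp_hasDerivAt s e1
    have e3 := (hasDerivAt_id s).mul_const (a1 0 y)
    have e4 := (((hasDerivAt_id s).pow 2).mul_const (a2 0 y y)).const_mul (1/2)
    refine (((e2.sub e3).sub e4).congr_deriv ?_).hasDerivWithinAt
    simp
    ring
  have := norm_image_sub_le_of_norm_deriv_le_segment_01' hg (C := ε * ‖y‖ * ‖y‖ * ‖y‖) fun s hs => ?_
  · simp only [one_smul, zero_smul] at this
    have e : a y - a 0 - a1 0 y - (1/2) * a2 0 y y = a y - 1 * a1 0 y - 1/2 * (1 ^ 2 * a2 0 y y) - (a 0 - 0 * a1 0 y - 1/2 * (0 ^ 2 * a2 0 y y)) := by ring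
    rw [e]; exact this
  · refine (ContinuousLinearMap.le_opNorm _ _).trans ?_
    gcongr
    apply hr1
    rw [mem_closedBall, dist_zero_right, norm_smul, Real.norm_of_nonneg hs.1]
    nlinarith [hs.2, norm_nonneg y]

section
variable {V : Type} [NormedAddCommGroup V] [NormedSpace ℝ V] [FiniteDimensional ℝ V]
  [MeasurableSpace V] [BorelSpace V] (μ : Measure V) [μ.IsAddHaarMeasure]
variable {E : Type} [NormedAddCommGroup E] [NormedSpace ℝ E] 

lemma Kop_deriv_right' {η : V → ℝ} (hη : Ker (sk E η)) (hη' : Ker (sk (V →L[ℝ] E) η)) {H : V → E}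
    (hH : ContDiff ℝ 1 H) (t : ℝ) (y : V) :
    HasFDerivAt (Kop μ (sk E η) t H) (Kop μ (sk (V →L[ℝ] E) η) t (fderiv ℝ H) y) y := by
  obtain ⟨H', c, e, M, hM, hM'⟩ := exists_cut (q := H) (y := y) (r := |t| + 1) (s := |t| + 2) (by positivity) (by linarith) hH.contDiffOn
  have hr : (2 * (|t| + 1) + (|t| + 2)) / 3 = |t| + 4/3 := by ring
  rw [hr] at e
  have h1 : Kop μ (sk (V →L[ℝ] E) η) t (fderiv ℝ H) y = Kop μ (sk (V →L[ℝ] E) η) t (fderiv ℝ H') y := by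
    refine Kop_congr μ fun x hx => ?_
    refine (Filter.EventuallyEq.fderiv_eq ?_).symm
    have : x ∈ ball y (|t| + 4/3) := closedBall_subset_ball (by linarith) hx
    filter_upwards [isOpen_ball.mem_nhds this] with z hz using e z hz
  rw [h1]
  refine (Kop_deriv_right μ hη hη' c hM' t y).congr_of_eventuallyEq ?_
  filter_upwards [ball_mem_nhds y (by norm_num : (0:ℝ) < 1)] with z hz
  refine Kop_congr μ fun x hx => (e x ?_).symm
  rw [mem_ball] at hz ⊢
  rw [mem_closedBall] at hx
  linarith [dist_triangle x z y]

lemma Kop_lip {κ : V → E →L[ℝ] E} (hκ : Ker κ) : ∃ C1 : ℝ, 0 < C1 ∧ ∀ (H : V → E) (B : ℝ), Continuous H → (∀ y, ‖H y‖ ≤ B) →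
    ∀ T, 0 < T → ∀ y, ‖Kop μ κ T H y - Kop μ κ T H 0‖ ≤ T⁻¹ * (C1 * B) * ‖y‖ := by
  obtain ⟨C1, hC1, hb1⟩ := hκ.kD.bound μ
  refine ⟨C1, hC1, fun H B cH hB T hT0 y => ?_⟩
  have := Convex.norm_image_sub_le_of_norm_hasFDerivWithin_le (s := Set.univ) (C := T⁻¹ * (C1 * B)) (x := 0) (y := y)
    (fun x _ => (Kop_hasFDerivAt μ hκ cH hT0 x).hasFDerivWithinAt) (fun x _ => ?_) convex_univ
    (Set.mem_univ _) (Set.mem_univ _)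
  · simpa using this
  · rw [norm_smul, norm_inv, Real.norm_of_nonneg hT0.le]
    gcongr
    exact hb1 T _ x B fun z _ => hB _

lemma Kop_clm [CompleteSpace E] {η : V → ℝ} (hη : Ker (sk E η)) {H : V → E} (hH : Continuous H) (tr : E →L[ℝ] ℝ) (T : ℝ) (y : V) :
    tr (Kop μ (sk E η) T H y) = Kop μ (sk ℝ η) T (fun x => tr (H x)) y := by
  unfold Kop
  rw [← ContinuousLinearMap.integral_comp_comm _ (Kop_integrable μ hη hH.continuousOn)]
  refine integral_congr_ae (ae_of_all _ fun z => ?_)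
  simp [sk]

lemma subseq_fd {W : Type} [NormedAddCommGroup W] [NormedSpace ℝ W] [FiniteDimensional ℝ W] (x : ℕ → W) {b : ℝ}
    (h : ∀ k, ‖x k‖ ≤ b) : ∃ (L : W) (φ : ℕ → ℕ), StrictMono φ ∧ Tendsto (x ∘ φ) atTop (𝓝 L) := by
  have := FiniteDimensional.proper ℝ W
  obtain ⟨L, -, φ, hφ, hφL⟩ := tendsto_subseq_of_bounded (x := x) (isBounded_closedBall (x := (0:W)) (r := b)) 
    (fun k => by rw [mem_closedBall, dist_zero_right]; exact h k)
  exact ⟨L, φ, hφ, hφL⟩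
end

variable {V : Type} [NormedAddCommGroup V] [InnerProductSpace ℝ V] [FiniteDimensional ℝ V]
  [MeasurableSpace V] [BorelSpace V] {μ : Measure V} [μ.IsAddHaarMeasure]

set_option maxHeartbeats 1000000 in
lemma liouville [Nontrivial V] {ζ : ℝ} {Θ : ℝ → ℝ} (hT : Tail (Module.finrank ℝ V) ζ Θ) (hζ : 0 < ζ) {η ψ : V → ℝ}
    (pk : PK μ η ψ) {h : V → ℝ} (hc : Continuous h) {K : ℝ} (hK : 0 ≤ K)
    (hh : ∀ x, ‖h x‖ ≤ K * (1 + ‖x‖) ^ (-ζ)) {U : V → ℝ} (hU : ContDiff ℝ 2 U) {B : ℝ}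
    (hB : ∀ y, ‖fderiv ℝ (fderiv ℝ U) y‖ ≤ B) {ι : Type} [Fintype ι] (b : OrthonormalBasis ι ℝ V) {g0 : ℝ}
    (hlap : ∀ y, ∑ i, fderiv ℝ (fderiv ℝ U) y (b i) (b i) = g0 + h y) :
    ∃ (L : V →L[ℝ] V →L[ℝ] ℝ) (l : V →L[ℝ] ℝ) (c : ℝ), (∀ x y, L x y = L y x) ∧ ∑ i, L (b i) (b i) = g0 ∧
      ∃ C : ℝ, 0 < C ∧ ∀ᶠ y in cobounded V, ‖U y - ((1/2) * L y y + l y + c)‖ ≤ C * (‖y‖ ^ 2 * Θ ‖y‖) := by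
  obtain ⟨hNi, C, hC, hNb⟩ := newton (μ := μ) hT hζ pk.sψ pk.tψ hc hK hh
  have hU1 : ContDiff ℝ 1 (fderiv ℝ U) := hU.fderiv_right (by norm_num)
  have cU2 : Continuous (fderiv ℝ (fderiv ℝ U)) := hU1.continuous_fderiv (by simp)
  have hB0 : 0 ≤ B := (norm_nonneg (fderiv ℝ (fderiv ℝ U) 0)).trans (hB 0)
  set N : V → ℝ := fun y => ∫ t in Set.Ioi (0:ℝ), t • Kop μ (sk ℝ ψ) t h y with hN
  set β := Kop μ (sk ℝ ψ) 0 (fun _ => g0) 0 with hβ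
  set a : ℝ → V → ℝ := fun T => Kop μ (sk ℝ η) T U with ha
  set a1 : ℝ → V → V →L[ℝ] ℝ := fun T => Kop μ (sk _ η) T (fderiv ℝ U) with ha1
  set a2 : ℝ → V → V →L[ℝ] V →L[ℝ] ℝ := fun T => Kop μ (sk _ η) T (fderiv ℝ (fderiv ℝ U)) with ha2
  -- limit
  have hlim : ∀ y, Tendsto (fun T => a T y - β * T ^ 2 / 2) atTop (𝓝 (U y + N y)) := by
    intro y
    have e1 : ∀ T, a T y - β * T ^ 2 / 2 = U y + ∫ t in (0:ℝ)..T, t • Kop μ (sk ℝ ψ) t h y := by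
      intro T
      have := pk.rep hU b y T
      simp_rw [hlap] at this
      have e2 : ∀ t, Kop μ (sk ℝ ψ) t (fun x => g0 + h x) y = β + Kop μ (sk ℝ ψ) t h y := by
        intro t
        rw [hβ]
        unfold Kop
        simp only [map_add]
        rw [integral_add]
        · exact Kop_integrable μ pk.kψ (t := t) (y := y) (H := fun _ => g0) continuousOn_const
        · exact Kop_integrable μ pk.kψ hc.continuousOn
      simp_rw [e2, smul_add] at this
      rw [intervalIntegral.integral_add] at this
      · simp only [smul_eq_mul, intervalIntegral.integral_mul_const, integral_id] at this ⊢
        simp only [ha]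
        linarith
      · apply Continuous.intervalIntegrable; fun_prop
      · apply Continuous.intervalIntegrable
        exact continuous_id.smul (Kop_contOn μ pk.kψ hc y)
    simp_rw [e1]
    exact (intervalIntegral_tendsto_integral_Ioi 0 (hNi y) tendsto_id).const_add _
  obtain ⟨C1, hC1, hb1⟩ := Kop_lip μ (pk.kη (E := V →L[ℝ] V →L[ℝ] ℝ))
  obtain ⟨C2, hC2, hb2⟩ := (pk.kη (E := V →L[ℝ] V →L[ℝ] ℝ)).bound μ
  have hlip : ∀ T, 0 < T → ∀ y, ‖a2 T y - a2 T 0‖ ≤ T⁻¹ * (C1 * B) * ‖y‖ := hb1 _ B cU2 hB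
  have htay : ∀ T, 0 < T → ∀ y, ‖a T y - a T 0 - a1 T 0 y - (1/2) * a2 T 0 y y‖ ≤ T⁻¹ * (C1 * B) * ‖y‖ * ‖y‖ * ‖y‖ :=
    fun T hT0 y => taylor3 (fun y => Kop_deriv_right' μ pk.kη pk.kη (hU.of_le (by norm_num)) T y)
      (fun y => Kop_deriv_right' μ pk.kη pk.kη hU1 T y) (by positivity) (hlip T hT0) y
  -- subsequence
  obtain ⟨L, φ, hφ, hφL⟩ := subseq_fd (fun k : ℕ => a2 ((k:ℝ) + 2) 0) (b := C2 * B) (fun k => hb2 _ _ 0 B fun z _ => hB _)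
  set τ : ℕ → ℝ := fun k => (φ k : ℝ) + 2 with hτ
  have hτt : Tendsto τ atTop atTop := tendsto_atTop_add_const_right _ _ (tendsto_natCast_atTop_atTop.comp hφ.tendsto_atTop)
  have hτ0 : ∀ k, 2 ≤ τ k := fun k => by simp [hτ]
  have hL2 : ∀ x y, Tendsto (fun k => a2 (τ k) 0 x y) atTop (𝓝 (L x y)) := by
    intro x y
    exact (((ContinuousLinearMap.apply ℝ ℝ y).continuous.comp (ContinuousLinearMap.apply ℝ (V →L[ℝ] ℝ) x).continuous).tendsto L).comp hφL
  have hl : ∀ y, Tendsto (fun k => a1 (τ k) 0 y) atTop (𝓝 ((U y + N y) - (U 0 + N 0) - (1/2) * L y y)) := by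
    intro y
    have e1 : Tendsto (fun k => (a (τ k) y - β * (τ k) ^ 2 / 2) - (a (τ k) 0 - β * (τ k) ^ 2 / 2) - (1/2) * a2 (τ k) 0 y y) atTop
        (𝓝 ((U y + N y) - (U 0 + N 0) - (1/2) * L y y)) :=
      (((hlim y).comp hτt).sub ((hlim 0).comp hτt)).sub ((hL2 y y).const_mul _)
    have e2 : Tendsto (fun k => a (τ k) y - a (τ k) 0 - a1 (τ k) 0 y - (1/2) * a2 (τ k) 0 y y) atTop (𝓝 0) := by
      refine squeeze_zero_norm (fun k => htay _ (by linarith [hτ0 k]) y) ?_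
      have : Tendsto (fun k => (τ k)⁻¹ * ((C1 * B) * ‖y‖ * ‖y‖ * ‖y‖)) atTop (𝓝 (0 * ((C1 * B) * ‖y‖ * ‖y‖ * ‖y‖))) :=
        (tendsto_inv_atTop_zero.comp hτt).mul_const _
      rw [zero_mul] at this
      refine this.congr fun k => by ring
    have := e1.sub e2
    rw [sub_zero] at this
    refine this.congr fun k => by ring
  obtain ⟨l, hl'⟩ : ∃ l : V →ₗ[ℝ] ℝ, ∀ y, l y = (U y + N y) - (U 0 + N 0) - (1/2) * L y y := by
    refine ⟨⟨⟨fun y => (U y + N y) - (U 0 + N 0) - (1/2) * L y y, fun x y => ?_⟩, fun s y => ?_⟩, fun y => rfl⟩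
    · refine tendsto_nhds_unique (hl (x + y)) ?_
      simp only [map_add]
      exact (hl x).add (hl y)
    · refine tendsto_nhds_unique (hl (s • y)) ?_
      simp only [map_smul]
      exact (hl y).const_mul s
  have htr : ∑ i, L (b i) (b i) = g0 := by
    have e1 : Tendsto (fun k => ∑ i, a2 (τ k) 0 (b i) (b i)) atTop (𝓝 (∑ i, L (b i) (b i))) :=
      tendsto_finsetSum _ fun i _ => hL2 _ _
    refine tendsto_nhds_unique e1 ?_
    obtain ⟨C3, hC3, hb3⟩ := rad_Kop (μ := μ) hT hζ pk.sη.continuous pk.tη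
    have e2 : ∀ T, ∑ i, a2 T 0 (b i) (b i) = g0 + Kop μ (sk ℝ η) T h 0 := by
      intro T
      set tr : (V →L[ℝ] V →L[ℝ] ℝ) →L[ℝ] ℝ := ∑ i, (ContinuousLinearMap.apply ℝ ℝ (b i)).comp (ContinuousLinearMap.apply ℝ (V →L[ℝ] ℝ) (b i)) with htr
      have e3 : ∀ M : V →L[ℝ] V →L[ℝ] ℝ, tr M = ∑ i, M (b i) (b i) := fun M => by
        simp [htr]
      rw [← e3]
      simp only [ha2]
      rw [Kop_clm μ (pk.kη (E := V →L[ℝ] V →L[ℝ] ℝ)) cU2]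
      simp_rw [e3, hlap]
      unfold Kop
      have e4 : ∀ z, (sk ℝ η z) (g0 + h (0 - T • z)) = η z * g0 + (sk ℝ η z) (h (0 - T • z)) := by
        intro z
        simp only [sk, _root_.smul_apply, ContinuousLinearMap.id_apply, smul_eq_mul]
        ring
      simp_rw [e4]
      rw [integral_add, integral_mul_const, pk.iη, one_mul]
      · exact (pk.sη.continuous.mul continuous_const).continuousOn.integrableOn_compact (isCompact_closedBall _ _)
      · exact Kop_integrable μ pk.kη hc.continuousOn
    simp_rw [e2]
    have e5 : Tendsto (fun k => Kop μ (sk ℝ η) (τ k) h 0) atTop (𝓝 0) := by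
      refine squeeze_zero_norm (fun k => hb3 h K hK hh _ (hτ0 k) 0 (by simp; linarith [hτ0 k])) ?_
      have := (hT.lim.comp hτt).const_mul (C3 * K)
      simpa using this
    simpa using e5.const_add g0
  refine ⟨(1/2 : ℝ) • (L + L.flip), LinearMap.toContinuousLinearMap l, U 0 + N 0, fun x y => ?_, ?_, C, hC, ?_⟩
  · simp; ring
  · rw [← htr]
    refine Finset.sum_congr rfl fun i _ => ?_
    simp
    ring
  · filter_upwards [hNb] with y hy
    have e : U y - ((1/2) * ((1/2 : ℝ) • (L + L.flip)) y y + LinearMap.toContinuousLinearMap l y + (U 0 + N 0)) = - N y := by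
      have : LinearMap.toContinuousLinearMap l y = l y := rfl
      rw [this, hl']
      simp
      ring
    rw [e, norm_neg]
    exact hy

end PartNine


section PartTen
open Filter Bornology Topology MeasureTheory Metric
open scoped ContDiff RealInnerProductSpace

variable {V : Type} [NormedAddCommGroup V] [InnerProductSpace ℝ V] [FiniteDimensional ℝ V]

lemma coer_inv {M : V →L[ℝ] V} {c : ℝ} (hc : 0 < c) (h : ∀ z, c * ‖z‖ ^ 2 ≤ ⟪M z, z⟫) :
    (∀ z, c * ‖z‖ ≤ ‖M z‖) ∧ ∃ e : V ≃L[ℝ] V, (e : V →L[ℝ] V) = M := by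
  have h1 : ∀ z, c * ‖z‖ ≤ ‖M z‖ := by
    intro z
    rcases (norm_nonneg z).eq_or_lt with h0 | h0
    · rw [← h0]; simp
    · have := (h z).trans (real_inner_le_norm (M z) z)
      refine le_of_mul_le_mul_right ?_ h0
      linarith
  have hinj : Function.Injective (M : V →ₗ[ℝ] V) := by
    rw [injective_iff_map_eq_zero]
    intro z hz
    have h2 := h1 z
    have hz' : M z = 0 := hz
    rw [hz', norm_zero] at h2
    have : ‖z‖ ≤ 0 := by
      by_contra h3
      push Not at h3
      nlinarith
    simpa using this
  refine ⟨h1, (LinearEquiv.ofInjectiveEndo (M : V →ₗ[ℝ] V) hinj).toContinuousLinearEquiv, ?_⟩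
  ext z; rfl

lemma strong_mono {Φ : V → V} (hΦ : ContDiff ℝ 1 Φ) {c : ℝ}
    (h : ∀ x z, c * ‖z‖ ^ 2 ≤ ⟪fderiv ℝ Φ x z, z⟫) (x x' : V) : c * ‖x - x'‖ ^ 2 ≤ ⟪Φ x - Φ x', x - x'⟫ := by
  set d := x - x' with hd
  have hder : ∀ s : ℝ, HasDerivAt (fun s : ℝ => ⟪Φ (x' + s • d), d⟫) ⟪fderiv ℝ Φ (x' + s • d) d, d⟫ s := by
    intro s
    have e1 : HasDerivAt (fun s : ℝ => x' + s • d) d s := by simpa using ((hasDerivAt_id s).smul_const d).const_add x'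
    have e2 := ((hΦ.differentiable (by simp) (x' + s • d)).hasFDerivAt).comp_hasDerivAt s e1
    simpa using e2.inner ℝ (hasDerivAt_const s d)
  obtain ⟨s, -, hs⟩ := exists_hasDerivAt_eq_slope (fun s : ℝ => ⟪Φ (x' + s • d), d⟫) (fun s => ⟪fderiv ℝ Φ (x' + s • d) d, d⟫)
    (zero_lt_one) (fun s _ => (hder s).continuousAt.continuousWithinAt) (fun s _ => hder s)
  have := h (x' + s • d) d
  rw [hs] at this
  simp only [one_smul, zero_smul, add_zero, sub_zero, div_one] at this
  rw [inner_sub_left]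
  have e : x' + d = x := by rw [hd]; abel
  rwa [e] at this

lemma leg1 {Φ : V → V} (hΦ : ContDiff ℝ 1 Φ) {c : ℝ} (hc : 0 < c)
    (h : ∀ x z, c * ‖z‖ ^ 2 ≤ ⟪fderiv ℝ Φ x z, z⟫) : ∃ p : V → V, (∀ y, Φ (p y) = y) ∧ (∀ x, p (Φ x) = x) ∧
      ContDiff ℝ 1 p ∧ (∀ y, fderiv ℝ p y * fderiv ℝ Φ (p y) = 1 ∧ fderiv ℝ Φ (p y) * fderiv ℝ p y = 1) ∧
      (∀ y y', ‖p y - p y'‖ ≤ c⁻¹ * ‖y - y'‖) ∧ ∀ y, ‖fderiv ℝ p y‖ ≤ c⁻¹ := by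
  have hanti : ∀ x x', ‖x - x'‖ ≤ c⁻¹ * ‖Φ x - Φ x'‖ := by
    intro x x'
    rw [le_inv_mul_iff₀ hc]
    rcases (norm_nonneg (x - x')).eq_or_lt with h0 | h0
    · rw [← h0]; simp
    · have := (strong_mono hΦ h x x').trans (real_inner_le_norm _ _)
      refine le_of_mul_le_mul_right ?_ h0
      linarith
  have hinj : Function.Injective Φ := by
    intro x x' hx
    have := hanti x x'
    rw [hx] at this
    simpa [sub_eq_zero] using this
  choose e he using fun x => (coer_inv hc (h x)).2
  have hst : ∀ x, HasStrictFDerivAt Φ (e x : V →L[ℝ] V) x := fun x => by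
    rw [he]; exact hΦ.contDiffAt.hasStrictFDerivAt (by simp)
  have hopen : IsOpenMap Φ := isOpenMap_of_hasStrictFDerivAt_equiv hst
  have hcl : IsClosed (Set.range Φ) := by
    refine isClosed_of_closure_subset fun y hy => ?_
    obtain ⟨u, hu, hlim⟩ := mem_closure_iff_seq_limit.1 hy
    choose x hx using hu
    have hcs : CauchySeq x := by
      rw [Metric.cauchySeq_iff']
      intro ε hε
      obtain ⟨N, hN⟩ := Metric.cauchySeq_iff'.1 hlim.cauchySeq (c * ε) (by positivity)
      refine ⟨N, fun k hk => ?_⟩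
      rw [dist_eq_norm]
      refine (hanti _ _).trans_lt ?_
      rw [inv_mul_lt_iff₀ hc, hx, hx, ← dist_eq_norm]
      exact hN k hk
    obtain ⟨x0, hx0⟩ := cauchySeq_tendsto_of_complete hcs
    refine ⟨x0, tendsto_nhds_unique ((hΦ.continuous.tendsto x0).comp hx0) ?_⟩
    convert hlim using 1
    funext k; exact hx k
  have hsurj : Function.Surjective Φ := by
    rw [← Set.range_eq_univ]
    exact IsClopen.eq_univ ⟨hcl, hopen.isOpen_range⟩ (Set.range_nonempty Φ)
  choose p hp using hsurj
  have hp' : ∀ x, p (Φ x) = x := fun x => hinj (hp _)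
  have hlip : ∀ y y', ‖p y - p y'‖ ≤ c⁻¹ * ‖y - y'‖ := fun y y' => by
    have := hanti (p y) (p y'); rwa [hp, hp] at this
  have hpc : Continuous p := by
    refine (LipschitzWith.of_dist_le_mul (K := ⟨c⁻¹, by positivity⟩) fun y y' => ?_).continuous
    rw [dist_eq_norm, dist_eq_norm]; exact hlip y y'
  have hpd : ∀ y, HasFDerivAt p ((e (p y)).symm : V →L[ℝ] V) y := fun y =>
    HasFDerivAt.of_local_left_inverse hpc.continuousAt ((hst (p y)).hasFDerivAt) (Eventually.of_forall hp)
  have hmul : ∀ y, fderiv ℝ p y * fderiv ℝ Φ (p y) = 1 ∧ fderiv ℝ Φ (p y) * fderiv ℝ p y = 1 := by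
    intro y
    rw [(hpd y).fderiv, ← he]
    constructor <;> ext z <;> simp
  refine ⟨p, hp, hp', ?_, hmul, hlip, fun y => ?_⟩
  · rw [contDiff_one_iff_fderiv]
    refine ⟨fun y => (hpd y).differentiableAt, ?_⟩
    have e1 : fderiv ℝ p = fun y => Ring.inverse (fderiv ℝ Φ (p y)) := by
      funext y
      exact (Ring.inverse_unit (⟨_, _, (hmul y).2, (hmul y).1⟩ : (V →L[ℝ] V)ˣ)).symm
    rw [e1]
    refine continuous_iff_continuousAt.2 fun y => ?_
    have e2 := NormedRing.inverse_continuousAt (⟨_, _, (hmul y).2, (hmul y).1⟩ : (V →L[ℝ] V)ˣ)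
    exact ContinuousAt.comp (f := fun y => fderiv ℝ Φ (p y)) e2 (((hΦ.continuous_fderiv (by simp)).comp hpc).continuousAt)
  · refine ContinuousLinearMap.opNorm_le_bound _ (by positivity) fun z => ?_
    have := (coer_inv hc (h (p y))).1 (fderiv ℝ p y z)
    have e1 : fderiv ℝ Φ (p y) (fderiv ℝ p y z) = z := by
      have := DFunLike.congr_fun (hmul y).2 z
      simpa using this
    rw [e1] at this
    rwa [le_inv_mul_iff₀ hc]

lemma leg_deriv {v : V → ℝ} {Φ p : V → V} (hv : ∀ x, HasFDerivAt v (innerSL ℝ (Φ x)) x) (hp : ∀ y, Φ (p y) = y)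
    (hpd : Differentiable ℝ p) (y : V) : HasFDerivAt (fun y => ⟪y, p y⟫ - v (p y)) (innerSL ℝ (p y)) y := by
  have h1 := (hasFDerivAt_id y).inner ℝ (hpd y).hasFDerivAt
  have h2 := (hv (p y)).comp y (hpd y).hasFDerivAt
  refine (h1.sub h2).congr_fderiv ?_
  ext z
  simp [hp, real_inner_comm]

lemma leg_fenchel {v : V → ℝ} {Φ p : V → V} (hv : ∀ x, HasFDerivAt v (innerSL ℝ (Φ x)) x) (hp : ∀ y, Φ (p y) = y)
    (hmono : ∀ x x', 0 ≤ ⟪Φ x - Φ x', x - x'⟫) (x y : V) : ⟪y, x⟫ ≤ (⟪y, p y⟫ - v (p y)) + v x := by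
  set d := x - p y with hd
  have hder : ∀ s : ℝ, HasDerivAt (fun s : ℝ => v (p y + s • d)) ⟪Φ (p y + s • d), d⟫ s := by
    intro s
    have e1 : HasDerivAt (fun s : ℝ => p y + s • d) d s := by simpa using ((hasDerivAt_id s).smul_const d).const_add (p y)
    exact ((hv (p y + s • d)).comp_hasDerivAt s e1)
  obtain ⟨s, hs0, hs⟩ := exists_hasDerivAt_eq_slope (fun s : ℝ => v (p y + s • d)) (fun s => ⟪Φ (p y + s • d), d⟫)
    (zero_lt_one) (fun s _ => (hder s).continuousAt.continuousWithinAt) (fun s _ => hder s)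
  have := hmono (p y + s • d) (p y)
  rw [add_sub_cancel_left, inner_smul_right, hp, inner_sub_left] at this
  have h2 := nonneg_of_mul_nonneg_right this hs0.1
  rw [hs] at h2
  simp only [one_smul, zero_smul, add_zero, sub_zero, div_one] at h2
  have e : p y + d = x := by rw [hd]; abel
  rw [e] at h2
  have h3 : ⟪y, d⟫ = ⟪y, x⟫ - ⟪y, p y⟫ := by rw [hd, inner_sub_right]
  linarith

lemma leg_growth {v U : V → ℝ} {p : V → V} (hf : ∀ x y, ⟪y, x⟫ ≤ U y + v x) (hU : ∀ y, U y = ⟪y, p y⟫ - v (p y))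
    {c : ℝ} (hlip : ∀ y y', ‖p y - p y'‖ ≤ c * ‖y - y'‖) (hc : 0 < c)
    (hg : ∃ C : ℝ, ∀ x, v x ≤ C * (1 + ‖x‖ ^ 2)) :
    ∃ a C : ℝ, 0 < a ∧ (∀ y, a * ‖y‖ ^ 2 - C ≤ U y) ∧ Cmp p ∧ ∃ Λ : ℝ, 0 < Λ ∧ ∀ y, 1 + ‖y‖ ≤ Λ * (1 + ‖p y‖) := by
  obtain ⟨C0, hC0⟩ := hg
  set C := |C0| + 1 with hC
  have hCp : 0 < C := by positivity
  have hvC : ∀ x, v x ≤ C * (1 + ‖x‖ ^ 2) := fun x => (hC0 x).trans (by gcongr; linarith [le_abs_self C0])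
  have hUg : ∀ y, 1 / (4 * C) * ‖y‖ ^ 2 - C ≤ U y := by
    intro y
    have h1 := hf ((1 / (2 * C)) • y) y
    have h2 := hvC ((1 / (2 * C)) • y)
    rw [inner_smul_right, real_inner_self_eq_norm_sq] at h1
    rw [norm_smul, Real.norm_of_nonneg (by positivity), mul_pow] at h2
    have e : C * (1 + (1 / (2 * C)) ^ 2 * ‖y‖ ^ 2) = C + 1 / (4 * C) * ‖y‖ ^ 2 := by field_simp; ring
    have e2 : 1 / (2 * C) * ‖y‖ ^ 2 = 1 / (4 * C) * ‖y‖ ^ 2 + 1 / (4 * C) * ‖y‖ ^ 2 := by field_simp; ring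
    linarith
  set a := 1 / (4 * C) with ha
  have hap : 0 < a := by positivity
  have hlow : ∀ y, a * ‖y‖ ^ 2 - C - U 0 ≤ ‖y‖ * ‖p y‖ := by
    intro y
    have h1 := hf (p y) 0
    rw [inner_zero_left] at h1
    have h2 := hU y
    have := real_inner_le_norm y (p y)
    linarith [hUg y]
  have hev : ∀ᶠ y in cobounded V, (a / 2) * ‖y‖ ≤ ‖p y‖ := by
    filter_upwards [ev_norm (V := V) (eventually_ge_atTop (1 + 2 * |C + U 0| / a))] with y hy
    have h0 : 0 ≤ 2 * |C + U 0| / a := by positivity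
    have h1 : 1 ≤ ‖y‖ := by linarith
    have h2 := hlow y
    have h3 : 2 * |C + U 0| ≤ a * ‖y‖ := by
      have h6 : 2 * |C + U 0| / a ≤ ‖y‖ := by linarith
      rw [div_le_iff₀ hap] at h6
      linarith
    have h5 : 2 * |C + U 0| ≤ a * ‖y‖ * ‖y‖ := h3.trans (le_mul_of_one_le_right (by positivity) h1)
    have h4 := le_abs_self (C + U 0)
    refine le_of_mul_le_mul_left (a := ‖y‖) ?_ (by linarith)
    have e7 : ‖y‖ * (a / 2 * ‖y‖) = a * ‖y‖ ^ 2 - a * ‖y‖ * ‖y‖ / 2 := by ring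
    rw [e7]
    linarith
  refine ⟨a, C, hap, hUg, ?_, ?_⟩
  · have h30 : 0 ≤ 2 / a := by positivity
    refine ⟨1 + 2 / a + c + ‖p 0‖, 1, by linarith [norm_nonneg (p 0)], one_pos, ?_⟩
    filter_upwards [hev, ev_norm (V := V) (eventually_ge_atTop 1)] with y h1 h2
    have h3 : 0 ≤ 2 / a := by positivity
    refine ⟨?_, ?_, fun y' _ => ?_⟩
    · have e1 : ‖y‖ ≤ 2 / a * ‖p y‖ := by
        rw [div_mul_eq_mul_div, le_div_iff₀ hap]; linarith
      nlinarith [norm_nonneg (p y), norm_nonneg (p 0)]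
    · have e1 := hlip y 0
      rw [sub_zero] at e1
      have e2 := norm_sub_norm_le (p y) (p 0)
      nlinarith [norm_nonneg (p 0), norm_nonneg y]
    · refine (hlip y' y).trans ?_
      gcongr
      linarith [norm_nonneg (p 0)]
  · obtain ⟨R, hR⟩ := ev_cob.1 hev
    refine ⟨1 + |R| + 2 / a, by positivity, fun y => ?_⟩
    have h3 : 0 ≤ 2 / a := by positivity
    rcases le_total R ‖y‖ with h | h
    · have e1 : ‖y‖ ≤ 2 / a * ‖p y‖ := by
        have := hR y h
        rw [div_mul_eq_mul_div, le_div_iff₀ hap]; linarith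
      nlinarith [norm_nonneg (p y), abs_nonneg R, mul_nonneg (abs_nonneg R) (norm_nonneg (p y))]
    · have := le_abs_self R
      nlinarith [norm_nonneg (p y), abs_nonneg R, mul_nonneg (abs_nonneg R) (norm_nonneg (p y)), mul_nonneg h3 (norm_nonneg (p y))]

end PartTen


section PartEleven
open Filter Bornology Topology MeasureTheory Metric
open scoped ContDiff RealInnerProductSpace

section gen
variable {V : Type} [NormedAddCommGroup V] [NormedSpace ℝ V]
variable {E : Type} [NormedAddCommGroup E] [NormedSpace ℝ E]

lemma SH_null (k : ℕ) {σ : ℝ → ℝ} (hσ : ∀ᶠ r in atTop, 0 < σ r) : SH k E (fun _ : V => (0 : E)) σ := by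
  induction k generalizing E σ with
  | zero =>
    refine SH_zero_of_lip (C := 1) (δ := 1) one_pos hσ ?_ ?_
    · filter_upwards [ev_norm hσ] with y hy
      simp [hy.le]
    · filter_upwards [ev_norm hσ] with y hy y' _
      rw [sub_zero, norm_zero]
      positivity
  | succ k ih =>
    refine SH_succ_iff.2 ⟨⟨1, one_pos, ?_⟩, ?_⟩
    · filter_upwards [ev_norm hσ] with y hy
      exact ⟨differentiableAt_const _, by simp [hy.le]⟩
    · have : fderiv ℝ (fun _ : V => (0 : E)) = fun _ => 0 := by funext y; simp
      rw [this]
      refine ih ?_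
      filter_upwards [hσ, eventually_gt_atTop 0] with r h1 h2 using div_pos h1 h2

lemma SH_const (k : ℕ) (e : E) : SH k E (fun _ : V => e) (fun _ => 1) := by
  cases k with
  | zero =>
    refine SH_zero_of_lip (C := ‖e‖) (δ := 1) one_pos (by simp) (by simp) ?_
    filter_upwards with y y' _
    rw [sub_self, norm_zero]
    positivity
  | succ k =>
    refine SH_succ_iff.2 ⟨⟨‖e‖ + 1, by positivity, ?_⟩, ?_⟩
    · filter_upwards with y
      exact ⟨differentiableAt_const _, by simp⟩
    · have : fderiv ℝ (fun _ : V => e) = fun _ => 0 := by funext y; simp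
      rw [this]
      refine SH_null k ?_
      filter_upwards [eventually_gt_atTop 0] with r h2 using div_pos one_pos h2

lemma SH_lin (k : ℕ) (T : V →L[ℝ] E) : SH k E (fun y : V => T y) (fun r => r) := by
  cases k with
  | zero =>
    refine SH_zero_of_lip (C := ‖T‖) (δ := 1) one_pos (eventually_gt_atTop 0) ?_ ?_
    · filter_upwards with y using T.le_opNorm y
    filter_upwards [ev_pos] with y hy y' _
    rw [div_self hy.ne', mul_one, ← map_sub]
    exact T.le_opNorm _
  | succ k =>
    refine SH_succ_iff.2 ⟨⟨‖T‖ + 1, by positivity, ?_⟩, ?_⟩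
    · filter_upwards with y
      exact ⟨T.differentiableAt, (T.le_opNorm y).trans (by gcongr; linarith)⟩
    · have : fderiv ℝ (fun y : V => T y) = fun _ => T := by funext y; exact T.fderiv
      rw [this]
      refine (SH_const k T).congr_wt ?_ ?_
      · filter_upwards [eventually_gt_atTop 0] with r hr using (div_self hr.ne').symm
      · filter_upwards [eventually_gt_atTop 0] with r h2 using div_pos h2 h2

lemma SH_affine (k : ℕ) (T : V →L[ℝ] E) (e : E) : SH k E (fun y : V => T y + e) (fun r => r) :=
  (SH_lin k T).add ((SH_const k e).mono ⟨1, by filter_upwards [eventually_ge_atTop 1] with r hr using by simpa using hr⟩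
    (eventually_gt_atTop 0))

end gen

variable {V : Type} [NormedAddCommGroup V] [InnerProductSpace ℝ V] [FiniteDimensional ℝ V]

lemma L_coer {U : V → ℝ} {L : V →L[ℝ] V →L[ℝ] ℝ} {l : V →L[ℝ] ℝ} {c a C0 C : ℝ} {Θ : ℝ → ℝ}
    (hlow : ∀ y, a * ‖y‖ ^ 2 - C0 ≤ U y) (hΘ : Tendsto Θ atTop (𝓝 0))
    (hb : ∀ᶠ y in cobounded V, ‖U y - ((1/2) * L y y + l y + c)‖ ≤ C * (‖y‖ ^ 2 * Θ ‖y‖)) (y : V) :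
    2 * a * ‖y‖ ^ 2 ≤ L y y := by
  rcases eq_or_ne y 0 with rfl | hy
  · simp
  have hy0 : 0 < ‖y‖ := norm_pos_iff.2 hy
  have ht : Tendsto (fun s : ℝ => ‖s • y‖) atTop atTop := by
    refine (tendsto_id.atTop_mul_const hy0).congr' ?_
    filter_upwards [eventually_gt_atTop 0] with s hs
    rw [norm_smul, Real.norm_of_nonneg hs.le]; rfl
  have ht2 : Tendsto (fun s : ℝ => s • y) atTop (cobounded V) := tendsto_norm_atTop_iff_cobounded.1 ht
  have hi := tendsto_inv_atTop_zero (𝕜 := ℝ)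
  have hi2 : Tendsto (fun s : ℝ => (s⁻¹) ^ 2) atTop (𝓝 0) := by simpa using hi.pow 2
  have hlim : Tendsto (fun s : ℝ => (1/2) * L y y + s⁻¹ * l y + (s⁻¹) ^ 2 * (c + C0) + C * (‖y‖ ^ 2 * Θ ‖s • y‖)) atTop
      (𝓝 ((1/2) * L y y + 0 * l y + 0 * (c + C0) + C * (‖y‖ ^ 2 * 0))) :=
    ((tendsto_const_nhds.add (hi.mul_const _)).add (hi2.mul_const _)).add (((hΘ.comp ht).const_mul _).const_mul _)
  have := ge_of_tendsto (b := a * ‖y‖ ^ 2) hlim ?_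
  · linarith
  filter_upwards [ht2.eventually hb, eventually_gt_atTop 0] with s h1 hs
  have h2 := hlow (s • y)
  have h3 := (le_abs_self _).trans h1
  simp only [map_smul, _root_.smul_apply, smul_eq_mul] at h3
  rw [norm_smul, Real.norm_of_nonneg hs.le] at h2 h3
  rw [norm_smul, Real.norm_of_nonneg hs.le]
  have h4 : s ^ 2 * (a * ‖y‖ ^ 2) ≤ s ^ 2 * ((1/2) * L y y + s⁻¹ * l y + (s⁻¹) ^ 2 * (c + C0) + C * (‖y‖ ^ 2 * Θ (s * ‖y‖))) := by
    have e : s ^ 2 * ((1/2) * L y y + s⁻¹ * l y + (s⁻¹) ^ 2 * (c + C0) + C * (‖y‖ ^ 2 * Θ (s * ‖y‖))) =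
      (1/2) * (s * (s * L y y)) + s * l y + (c + C0) + C * ((s * ‖y‖) ^ 2 * Θ (s * ‖y‖)) := by
      field_simp
    rw [e]
    nlinarith
  exact le_of_mul_le_mul_left h4 (by positivity)

/-- Riesz representation, real linear version -/
noncomputable def rz (V : Type) [NormedAddCommGroup V] [InnerProductSpace ℝ V] [FiniteDimensional ℝ V] :
    (V →L[ℝ] ℝ) →L[ℝ] V :=
  LinearMap.toContinuousLinearMap
    { toFun := fun l => (InnerProductSpace.toDual ℝ V).symm l
      map_add' := fun l l' => by simp
      map_smul' := fun s l => by simp }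

lemma rz_inner (l : V →L[ℝ] ℝ) (z : V) : ⟪rz V l, z⟫ = l z :=
  InnerProductSpace.toDual_symm_apply

lemma rz_innerSL (x : V) : rz V (innerSL ℝ x) = x :=
  (InnerProductSpace.toDual ℝ V).symm_apply_apply _

/-- regularity bootstrap for the dual potential -/
lemma w_boot [MeasurableSpace V] [BorelSpace V] (μ : Measure V) [μ.IsAddHaarMeasure] {η ψ : V → ℝ} (pk : PK μ η ψ)
    {θ : ℝ → ℝ} (hθ : Wt θ) (hθ1 : ∃ C : ℝ, ∀ᶠ r in atTop, θ r / r ≤ C * r) {τ : ℝ → ℝ} (hτ : Wt τ)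
    (hτθ : ∃ C : ℝ, ∀ᶠ r in atTop, τ r ≤ C * (θ r / r / r))
    {p : V → V} (hcmp : Cmp p) {M : V →L[ℝ] V} {b0 : V} {w : V → ℝ} (hw : ContDiff ℝ 2 w)
    (hwd : ∀ y, fderiv ℝ w y = innerSL ℝ (p y - M y - b0))
    {ι : Type} [Fintype ι] (b : OrthonormalBasis ι ℝ V) {G : V → ℝ}
    (hlap : ∀ y, ∑ i, fderiv ℝ (fderiv ℝ w) y (b i) (b i) = G (p y))
    {C1 : ℝ} (hb : ∀ᶠ y in cobounded V, ‖w y‖ ≤ C1 * θ ‖y‖) {k : ℕ} (hG : SH k ℝ G τ) :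
    SH (k + 2) ℝ w θ ∧ SH (k + 1) V (fun y => p y - M y - b0) (fun r => θ r / r) ∧ SH (k + 1) V p (fun r => r) := by
  have hP : Pois μ η ψ w (fun y => G (p y)) := by
    refine ⟨0, fun y r _ _ => ?_⟩
    have := pk.rep hw b y r
    simp only [hlap] at this
    exact this
  have hpos : ∀ᶠ r in atTop, 0 < θ r / r / r := hθ.div.div.1
  have step : ∀ j, SH (j + 2) ℝ w θ → SH (j + 1) V (fun y => p y - M y - b0) (fun r => θ r / r) ∧
      SH (j + 1) V p (fun r => r) := by
    intro j hj
    have h1 : SH (j + 1) V (fun y => p y - M y - b0) (fun r => θ r / r) := by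
      refine (hj.fderiv.clm hθ.div.1 (rz V)).congr (Eventually.of_forall fun y => ?_)
      rw [hwd, rz_innerSL]
    refine ⟨h1, ?_⟩
    refine ((h1.mono hθ1 (eventually_gt_atTop 0)).add (SH_affine (j+1) M b0)).congr (Eventually.of_forall fun y => ?_)
    abel
  have main : ∀ j ≤ k, SH (j + 2) ℝ w θ := by
    intro j
    induction j with
    | zero =>
      intro _
      refine schauder μ pk.sη pk.tη pk.sψ pk.tψ hP hθ (Eventually.of_forall fun y => hw.continuous.continuousAt) hb ?_
      exact ((hG.of_le (Nat.zero_le _) hτ).comp_zero hτ hcmp).mono hτθ hpos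
    | succ j ih =>
      intro hj
      have h2 := (step j (ih (by omega))).2
      refine schauder μ pk.sη pk.tη pk.sψ pk.tψ hP hθ (Eventually.of_forall fun y => hw.continuous.continuousAt) hb ?_
      exact ((hG.of_le hj hτ).comp hτ hcmp (fun _ => h2)).mono hτθ hpos
  exact ⟨main k le_rfl, step k (main k le_rfl)⟩

end PartEleven


section PartTwelve
open Filter Bornology Topology MeasureTheory Metric
open scoped ContDiff RealInnerProductSpace

variable {V : Type} [NormedAddCommGroup V] [InnerProductSpace ℝ V] [FiniteDimensional ℝ V]

lemma Phi_boot {p Φ : V → V} (hp' : ∀ x, p (Φ x) = x)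
    (hΦ : ContDiff ℝ 1 Φ)
    (hmul : ∀ y, fderiv ℝ p y * fderiv ℝ Φ (p y) = 1 ∧ fderiv ℝ Φ (p y) * fderiv ℝ p y = 1)
    {c : ℝ} (hc : 0 < c) (hlip : ∀ y y', ‖p y - p y'‖ ≤ c * ‖y - y'‖) (hcmp : Cmp p)
    {M : V →L[ℝ] V} {a : ℝ} (ha : 0 < a) (hM : ∀ z, 2 * a * ‖z‖ ^ 2 ≤ ⟪M z, z⟫)
    (hd : ∀ᶠ y in cobounded V, ‖fderiv ℝ p y - M‖ ≤ a) {k : ℕ} (hpk : SH k V p (fun r => r)) :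
    Cmp Φ ∧ SH k V Φ (fun r => r) := by
  have hΦd := hΦ.differentiable (by simp)
  have ht : Tendsto Φ (cobounded V) (cobounded V) := by
    rw [← tendsto_norm_atTop_iff_cobounded]
    have h1 : Tendsto (fun x : V => c⁻¹ * (‖x‖ + (-‖p 0‖))) (cobounded V) atTop :=
      (tendsto_atTop_add_const_right _ _ tendsto_norm_cobounded_atTop).const_mul_atTop (by positivity)
    refine tendsto_atTop_mono (fun x => ?_) h1
    rw [inv_mul_le_iff₀ hc]
    have h2 := hlip (Φ x) 0
    rw [hp', sub_zero] at h2
    have := norm_sub_norm_le x (p 0)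
    linarith
  have hmul' : ∀ x, fderiv ℝ Φ x * fderiv ℝ p (Φ x) = 1 ∧ fderiv ℝ p (Φ x) * fderiv ℝ Φ x = 1 := by
    intro x
    have := hmul (Φ x)
    rw [hp'] at this
    exact ⟨this.2, this.1⟩
  have hbd : ∀ᶠ x in cobounded V, ‖fderiv ℝ Φ x‖ ≤ a⁻¹ := by
    filter_upwards [ht.eventually hd] with x hx
    refine ContinuousLinearMap.opNorm_le_bound _ (by positivity) fun z => ?_
    have hco : ∀ z, a * ‖z‖ ^ 2 ≤ ⟪fderiv ℝ p (Φ x) z, z⟫ := by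
      intro z
      have h1 : ‖⟪(fderiv ℝ p (Φ x) - M) z, z⟫‖ ≤ a * ‖z‖ * ‖z‖ :=
        (norm_inner_le_norm _ _).trans (by gcongr; exact ((fderiv ℝ p (Φ x) - M).le_opNorm z).trans (by gcongr))
      have h2 := (abs_le.1 h1).1
      rw [_root_.sub_apply, inner_sub_left] at h2
      nlinarith [hM z]
    have h3 := (coer_inv ha hco).1 (fderiv ℝ Φ x z)
    have e1 : fderiv ℝ p (Φ x) (fderiv ℝ Φ x z) = z := by
      have := DFunLike.congr_fun (hmul' x).2 z
      simpa using this
    rw [e1] at h3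
    rwa [le_inv_mul_iff₀ ha]
  have hC : Cmp Φ := by
    obtain ⟨Λ, δ, h1, h2, h3⟩ := hcmp
    have hai : 0 < a⁻¹ := by positivity
    refine ⟨Λ + a⁻¹, 1/2, by linarith, by norm_num, ?_⟩
    filter_upwards [ht.eventually h3, ev_ball hbd] with x hx hx2
    rw [hp'] at hx
    refine ⟨?_, ?_, fun x' hx' => ?_⟩
    · nlinarith [hx.2.1, norm_nonneg (Φ x)]
    · nlinarith [hx.1, norm_nonneg x]
    · have h5 : ‖Φ x' - Φ x‖ ≤ a⁻¹ * ‖x' - x‖ := by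
        refine (convex_closedBall x ((1/2) * ‖x‖)).norm_image_sub_le_of_norm_hasFDerivWithin_le (f' := fderiv ℝ Φ)
          (fun z _ => (hΦd z).hasFDerivAt.hasFDerivWithinAt) (fun z hz => hx2 z ?_) ?_ ?_
        · rwa [mem_closedBall, dist_eq_norm] at hz
        · exact mem_closedBall_self (by positivity)
        · rwa [mem_closedBall, dist_eq_norm]
      refine h5.trans ?_
      gcongr
      linarith
  refine ⟨hC, ?_⟩
  have main : ∀ j ≤ k, SH j V Φ (fun r => r) := by
    intro j
    induction j with
    | zero =>
      intro _
      obtain ⟨Λ, δ, h1, h2, h3⟩ := hC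
      refine SH_zero_of_lip (C := Λ) h2 (eventually_gt_atTop 0) (h3.mono fun x hx => hx.2.1) ?_
      filter_upwards [h3, ev_pos] with x hx hx0 x' hx'
      rw [div_self hx0.ne', mul_one]
      exact hx.2.2 x' hx'
    | succ j ih =>
      intro hj
      have h0 := ih (by omega)
      obtain ⟨C, hC0, hb⟩ := h0.bound
      refine SH_succ_iff.2 ⟨⟨C, hC0, hb.mono fun x hx => ⟨hΦd x, hx⟩⟩, ?_⟩
      have h1 : SH j (V →L[ℝ] V) (fderiv ℝ p) (fun _ => 1) := by
        refine ((hpk.of_le hj Wt.id).fderiv).congr_wt ?_ (by simp)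
        filter_upwards [eventually_gt_atTop 0] with r hr using div_self hr.ne'
      have h2 := h1.comp Wt.one hC (fun _ => h0)
      have h3 : SH j (V →L[ℝ] V) (fderiv ℝ Φ) (fun _ => 1) :=
        SH_inv h2 (C := a⁻¹) (hbd.mono fun x hx => ⟨(hmul' x).1, (hmul' x).2, hx⟩)
      refine h3.congr_wt ?_ ?_
      · filter_upwards [eventually_gt_atTop 0] with r hr using (div_self hr.ne').symm
      · filter_upwards [eventually_gt_atTop 0] with r hr using div_pos hr hr
  exact main k le_rfl

lemma dual_id {x y d b0 X : V} (e : V ≃L[ℝ] V) (hs : ∀ x y, ⟪e x, y⟫ = ⟪x, e y⟫) (hX : X = x - b0)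
    (hx : d = x - e y - b0) : ⟪y, x⟫ - ((1/2) * ⟪e y, y⟫ + ⟪b0, y⟫) =
      (1/2) * ⟪e.symm X, X⟫ - (1/2) * ⟪e.symm d, d⟫ := by
  obtain ⟨t, rfl⟩ : ∃ t, X = e t := ⟨e.symm X, by simp⟩
  have hd : d = e (t - y) := by rw [map_sub, hX, hx]; abel
  have hx2 : x = e t + b0 := by rw [hX]; abel
  rw [hd, hx2]
  simp only [ContinuousLinearEquiv.symm_apply_apply, map_sub, inner_sub_left, inner_sub_right, inner_add_right]
  have h1 := hs t y
  have h2 := real_inner_comm y (e t)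
  have h3 := real_inner_comm b0 y
  have h4 := real_inner_comm y (e y)
  linarith

end PartTwelve


section PartThirteen
open Filter Bornology Topology MeasureTheory Metric
open scoped ContDiff RealInnerProductSpace

variable {V : Type} [NormedAddCommGroup V] [InnerProductSpace ℝ V] [FiniteDimensional ℝ V]

lemma quad_deriv (L : V →L[ℝ] V →L[ℝ] ℝ) (hL : ∀ x y, L x y = L y x) (l : V →L[ℝ] ℝ) (c : ℝ) (y : V) :
    HasFDerivAt (fun y => (1/2) * L y y + l y + c) (L y + l) y := by
  have h1 : HasFDerivAt (fun y => L y y) _ y := (L.hasFDerivAt (x := y)).clm_apply (hasFDerivAt_id y)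
  refine (((h1.const_mul (1/2)).add l.hasFDerivAt).add_const c).congr_fderiv ?_
  ext z
  simp [hL z y]
  ring

lemma core_final {v w : V → ℝ} {Φ : V → V} {e : V ≃L[ℝ] V} (hs : ∀ x y, ⟪e x, y⟫ = ⟪x, e y⟫)
    {b0 : V} {c : ℝ} (hv : ∀ x, HasFDerivAt v (innerSL ℝ (Φ x)) x) {d : V → V}
    (hd : ∀ x, d (Φ x) = x - e (Φ x) - b0)
    (hval : ∀ x, v x = ⟪Φ x, x⟫ - ((1/2) * ⟪e (Φ x), Φ x⟫ + ⟪b0, Φ x⟫ + c + w (Φ x)))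
    {θ : ℝ → ℝ} (hθ : Wt θ) (hθ1 : ∃ C : ℝ, ∀ᶠ r in atTop, θ r / r ≤ C * r) {k : ℕ}
    (hcmp : Cmp Φ) (hΦ : SH (k+1) V Φ (fun r => r)) (hw : SH (k+2) ℝ w θ)
    (hdk : SH (k+1) V d (fun r => θ r / r)) :
    SH (k + 2) ℝ (fun x => v x - ((1/2) * ⟪e.symm (x - b0), x - b0⟫ - c)) θ := by
  set E := fun x => v x - ((1/2) * ⟪e.symm (x - b0), x - b0⟫ - c) with hE
  have hss : ∀ x y, ⟪e.symm x, y⟫ = ⟪x, e.symm y⟫ := by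
    intro x y
    have := hs (e.symm x) (e.symm y)
    simpa using this.symm
  have hEd : ∀ x, HasFDerivAt E (innerSL ℝ (-(e.symm (d (Φ x))))) x := by
    intro x
    have h0 : HasFDerivAt (fun x : V => x - b0) (ContinuousLinearMap.id ℝ V) x := (hasFDerivAt_id x).sub_const b0
    have h1 : HasFDerivAt (fun x : V => e.symm (x - b0)) ((e.symm : V →L[ℝ] V).comp (ContinuousLinearMap.id ℝ V)) x :=
      (e.symm : V →L[ℝ] V).hasFDerivAt.comp x h0
    have h2 := ((hv x).sub (((h1.inner ℝ h0).const_mul (1/2)).sub_const c))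
    refine h2.congr_fderiv ?_
    ext z
    have e1 : e.symm (d (Φ x)) = e.symm (x - b0) - Φ x := by
      rw [hd, show x - e (Φ x) - b0 = (x - b0) - e (Φ x) by abel, map_sub]
      simp
    rw [e1]
    have e2 := hss (x - b0) z
    have e3 := real_inner_comm (x - b0) (e.symm z)
    simp [fderivInnerCLM_apply, inner_sub_left] at *
    linarith
  have hEv : ∀ x, E x = -(1/2) * ⟪e.symm (d (Φ x)), d (Φ x)⟫ - w (Φ x) := by
    intro x
    have := dual_id (x := x) (y := Φ x) (d := d (Φ x)) (b0 := b0) (X := x - b0) e hs rfl (hd x)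
    simp only [hE]
    rw [hval]
    linarith
  have hdc : SH (k+1) V (fun x => d (Φ x)) (fun r => θ r / r) := hdk.comp hθ.div hcmp (fun _ => hΦ)
  have hwc : SH (k+1) ℝ (fun x => w (Φ x)) θ := (hw.pred hθ).comp hθ hcmp (fun _ => hΦ)
  obtain ⟨C1, hC1, hb1⟩ := hdc.bound
  obtain ⟨C2, hC2, hb2⟩ := hwc.bound
  obtain ⟨C3, hC3⟩ := hθ1
  refine SH_succ_iff.2 ⟨⟨‖(e.symm : V →L[ℝ] V)‖ * C1 * (C1 * |C3|) + C2, by positivity, ?_⟩, ?_⟩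
  · filter_upwards [hb1, hb2, ev_norm hC3, ev_pos, ev_norm hθ.1] with x h1 h2 h3 h4 h5
    refine ⟨(hEd x).differentiableAt, ?_⟩
    rw [hEv]
    have e1 : ‖⟪e.symm (d (Φ x)), d (Φ x)⟫‖ ≤ ‖(e.symm : V →L[ℝ] V)‖ * C1 * (C1 * |C3|) * θ ‖x‖ := by
      calc _ ≤ ‖e.symm (d (Φ x))‖ * ‖d (Φ x)‖ := norm_inner_le_norm _ _
        _ ≤ (‖(e.symm : V →L[ℝ] V)‖ * (C1 * (θ ‖x‖ / ‖x‖))) * (C1 * (|C3| * ‖x‖)) := by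
          gcongr
          · exact ((e.symm : V →L[ℝ] V).le_opNorm _).trans (by gcongr)
          · refine h1.trans ?_
            gcongr
            refine h3.trans ?_
            gcongr
            exact le_abs_self _
        _ = _ := by field_simp
    have e2 : ‖-(1/2) * ⟪e.symm (d (Φ x)), d (Φ x)⟫ - w (Φ x)‖ ≤ ‖⟪e.symm (d (Φ x)), d (Φ x)⟫‖ + ‖w (Φ x)‖ := by
      refine (norm_sub_le _ _).trans ?_
      gcongr
      rw [norm_mul]
      refine mul_le_of_le_one_left (norm_nonneg _) ?_
      norm_num
    rw [add_mul]
    linarith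
  · have h1 : SH (k+1) (V →L[ℝ] ℝ) (fun x => innerSL ℝ (-(e.symm (d (Φ x))))) (fun r => θ r / r) := by
      have h2 := (hdc.clm hθ.div.1 (-(e.symm : V →L[ℝ] V))).clm hθ.div.1 (F := V →L[ℝ] ℝ) (innerSL ℝ)
      exact h2
    exact h1.congr (Eventually.of_forall fun x => (hEd x).fderiv.symm)

set_option maxHeartbeats 1000000 in
theorem core [Nontrivial V] [MeasurableSpace V] [BorelSpace V] {ζ : ℝ} (hζ : 0 < ζ) {Θ : ℝ → ℝ}
    (hT : Tail (Module.finrank ℝ V) ζ Θ)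
    {v : V → ℝ} {Φ : V → V} (hv : ∀ x, HasFDerivAt v (innerSL ℝ (Φ x)) x) (hΦ : ContDiff ℝ 1 Φ)
    {c0 : ℝ} (hc0 : 0 < c0) (hco : ∀ x z, c0 * ‖z‖ ^ 2 ≤ ⟪fderiv ℝ Φ x z, z⟫)
    (hg : ∃ C : ℝ, ∀ x, v x ≤ C * (1 + ‖x‖ ^ 2)) {ι : Type} [Fintype ι] (b : OrthonormalBasis ι ℝ V)
    {g0 : ℝ} {G : V → ℝ} (hGc : Continuous G)
    (htr : ∀ x, ∀ N : V →L[ℝ] V, fderiv ℝ Φ x * N = 1 → ∑ i, ⟪N (b i), b i⟫ = g0 + G x)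
    {K : ℝ} (hK : 0 ≤ K) (hGK : ∀ x, ‖G x‖ ≤ K * (1 + ‖x‖) ^ (-ζ)) {k : ℕ} (hG : SH k ℝ G (fun r => r ^ (-ζ))) :
    ∃ (e : V ≃L[ℝ] V) (b0 : V) (c a : ℝ), 0 < a ∧ (∀ z, a * ‖z‖ ^ 2 ≤ ⟪e z, z⟫) ∧
      (∀ x y, ⟪e x, y⟫ = ⟪x, e y⟫) ∧ ∑ i, ⟪e (b i), b i⟫ = g0 ∧
      SH (k + 2) ℝ (fun x => v x - ((1/2) * ⟪e.symm (x - b0), x - b0⟫ - c)) (fun r => r ^ 2 * Θ r) := by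
  obtain ⟨p, hp, hp', hpC, hmul, hlip, hpn⟩ := leg1 hΦ hc0 hco
  set U : V → ℝ := fun y => ⟪y, p y⟫ - v (p y) with hU
  have hUd : ∀ y, HasFDerivAt U (innerSL ℝ (p y)) y := leg_deriv hv hp (hpC.differentiable (by simp))
  have hUf : fderiv ℝ U = fun y => innerSL ℝ (p y) := by funext y; exact (hUd y).fderiv
  have hci : (0:ℝ) < c0⁻¹ := by positivity
  have hpd : ∀ y, HasFDerivAt p (fderiv ℝ p y) y := fun y => (hpC.differentiable (by simp) y).hasFDerivAt
  have hSc : ContDiff ℝ 1 (fun y => (innerSL ℝ (p y) : V →L[ℝ] ℝ)) :=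
    ContDiff.comp (g := fun z => (innerSL ℝ z : V →L[ℝ] ℝ)) (ContinuousLinearMap.contDiff (innerSL ℝ)) hpC
  have hSd : ∀ y, HasFDerivAt (fun y => (innerSL ℝ (p y) : V →L[ℝ] ℝ)) ((innerSL ℝ : V →L[ℝ] V →L[ℝ] ℝ).comp (fderiv ℝ p y)) y :=
    fun y => HasFDerivAt.comp (g := fun z => (innerSL ℝ z : V →L[ℝ] ℝ)) y
      ((innerSL ℝ : V →L[ℝ] V →L[ℝ] ℝ).hasFDerivAt) (hpd y)
  have hUC : ContDiff ℝ 2 U := by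
    rw [show (2 : WithTop ℕ∞) = 1 + 1 by norm_num, contDiff_succ_iff_fderiv]
    refine ⟨fun y => (hUd y).differentiableAt, by simp, ?_⟩
    rw [hUf]; exact hSc
  have hUff : ∀ y z1 z2, fderiv ℝ (fderiv ℝ U) y z1 z2 = ⟪fderiv ℝ p y z1, z2⟫ := by
    intro y z1 z2
    rw [hUf, (hSd y).fderiv]
    rfl
  have hfen := leg_fenchel hv hp (fun x x' => (by positivity : (0:ℝ) ≤ c0 * ‖x - x'‖ ^ 2).trans (strong_mono hΦ hco x x'))
  obtain ⟨a, C0, ha, hlow, hcmp, Λ, hΛ, hΛy⟩ := leg_growth (U := U) hfen (fun y => rfl) hlip hci hg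
  obtain ⟨η, ψ, pk⟩ := exists_PK (volume : Measure V)
  have hlapU : ∀ y, ∑ i, fderiv ℝ (fderiv ℝ U) y (b i) (b i) = g0 + G (p y) := by
    intro y
    simp only [hUff]
    exact htr (p y) _ (hmul y).2
  have hGp : ∀ y, ‖G (p y)‖ ≤ (K * Λ ^ ζ) * (1 + ‖y‖) ^ (-ζ) := by
    intro y
    refine (hGK (p y)).trans ?_
    rw [mul_assoc]
    gcongr
    have h1 : 0 < 1 + ‖p y‖ := by positivity
    have h2 : 0 < 1 + ‖y‖ := by positivity
    rw [Real.rpow_neg h1.le, Real.rpow_neg h2.le, ← div_eq_mul_inv, inv_eq_one_div, div_le_div_iff₀ (by positivity) (by positivity),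
      one_mul, ← Real.mul_rpow hΛ.le h1.le]
    exact Real.rpow_le_rpow h2.le (hΛy y) hζ.le
  obtain ⟨L, l, c, hLs, hLtr, C, hC, hb⟩ := liouville hT hζ pk (hGc.comp hpC.continuous)
    (K := K * Λ ^ ζ) (by positivity) hGp hUC (B := c0⁻¹) (fun y => by
      refine ContinuousLinearMap.opNorm_le_bound₂ _ hci.le fun z1 z2 => ?_
      rw [hUff]
      refine (norm_inner_le_norm _ _).trans ?_
      gcongr
      exact ((fderiv ℝ p y).le_opNorm z1).trans (by gcongr; exact hpn y)) b hlapU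
  have hLc := L_coer hlow hT.lim hb
  set M : V →L[ℝ] V := (rz V).comp L with hM
  have hMi : ∀ x y, ⟪M x, y⟫ = L x y := fun x y => rz_inner _ _
  have hMc : ∀ z, (2 * a) * ‖z‖ ^ 2 ≤ ⟪M z, z⟫ := fun z => by rw [hMi]; exact hLc z
  obtain ⟨e, he⟩ := (coer_inv (by positivity : 0 < 2 * a) hMc).2
  have heM : ∀ z, e z = M z := fun z => by rw [← he]; rfl
  have hsym : ∀ x y, ⟪e x, y⟫ = ⟪x, e y⟫ := fun x y => by
    rw [heM, heM, hMi, real_inner_comm, hMi, hLs]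
  set b0 := rz V l with hb0
  have hb0i : ∀ z, ⟪b0, z⟫ = l z := fun z => rz_inner _ _
  set θ : ℝ → ℝ := fun r => r ^ 2 * Θ r with hθ
  have hθw : Wt θ := by
    refine ((Wt.id.mul Wt.id).mul hT.wt).congr (Eventually.of_forall fun r => ?_)
    simp only [hθ]; ring
  have hθ1 : ∃ C : ℝ, ∀ᶠ r in atTop, θ r / r ≤ C * r := by
    refine ⟨1, ?_⟩
    filter_upwards [hT.lim.eventually (eventually_le_nhds one_pos), eventually_gt_atTop 0] with r h1 h2
    rw [div_le_iff₀ h2]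
    simp only [hθ]
    nlinarith
  have hdom : ∃ C : ℝ, ∀ᶠ r in atTop, r ^ (-ζ) ≤ C * (θ r / r / r) := by
    obtain ⟨C', -, h'⟩ := hT.dom
    refine ⟨C', ?_⟩
    filter_upwards [eventually_ge_atTop 2] with r hr
    have h2 : θ r / r / r = Θ r := by simp only [hθ]; field_simp
    rw [h2]; exact h' r hr
  set w : V → ℝ := fun y => U y - ((1/2) * L y y + l y + c) with hw
  have hwd : ∀ y, HasFDerivAt w (innerSL ℝ (p y - M y - b0)) y := by
    intro y
    refine ((hUd y).sub (quad_deriv L hLs l c y)).congr_fderiv ?_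
    ext z
    simp only [innerSL_apply_apply, _root_.sub_apply, _root_.add_apply, inner_sub_left, hMi, hb0i]
    ring
  have hwf : fderiv ℝ w = fun y => innerSL ℝ (p y - M y - b0) := by funext y; exact (hwd y).fderiv
  have hdC : ContDiff ℝ 1 (fun y => p y - M y - b0) := (hpC.sub M.contDiff).sub contDiff_const
  have hdd : ∀ y, HasFDerivAt (fun y => p y - M y - b0) (fderiv ℝ p y - M) y := fun y =>
    ((hpd y).sub M.hasFDerivAt).sub_const b0
  have hwC : ContDiff ℝ 2 w := by
    rw [show (2 : WithTop ℕ∞) = 1 + 1 by norm_num, contDiff_succ_iff_fderiv]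
    refine ⟨fun y => (hwd y).differentiableAt, by simp, ?_⟩
    rw [hwf]
    exact ContDiff.comp (g := fun z => (innerSL ℝ z : V →L[ℝ] ℝ)) (ContinuousLinearMap.contDiff (innerSL ℝ)) hdC
  have hwff : ∀ y z1 z2, fderiv ℝ (fderiv ℝ w) y z1 z2 = ⟪fderiv ℝ p y z1, z2⟫ - L z1 z2 := by
    intro y z1 z2
    have h1 : HasFDerivAt (fun y => (innerSL ℝ (p y - M y - b0) : V →L[ℝ] ℝ))
      ((innerSL ℝ : V →L[ℝ] V →L[ℝ] ℝ).comp (fderiv ℝ p y - M)) y :=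
      HasFDerivAt.comp (g := fun z => (innerSL ℝ z : V →L[ℝ] ℝ)) y
        ((innerSL ℝ : V →L[ℝ] V →L[ℝ] ℝ).hasFDerivAt) (hdd y)
    rw [hwf, h1.fderiv, ← hMi, ← inner_sub_left]
    rfl
  have hwlap : ∀ y, ∑ i, fderiv ℝ (fderiv ℝ w) y (b i) (b i) = G (p y) := by
    intro y
    simp only [hwff, Finset.sum_sub_distrib, hLtr]
    have := hlapU y
    simp only [hUff] at this
    rw [this]; ring
  obtain ⟨hw2, hd1, hp1⟩ := w_boot (volume : Measure V) pk hθw hθ1 (Wt.rpow (-ζ)) hdom hcmp hwC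
    (fun y => (hwd y).fderiv) b hwlap hb hG
  have hsmall : ∀ᶠ y in cobounded V, ‖fderiv ℝ p y - M‖ ≤ a := by
    obtain ⟨C', hC', hb'⟩ := hd1.fderiv.bound
    have h1 : Tendsto (fun r => C' * Θ r) atTop (𝓝 (C' * 0)) := hT.lim.const_mul C'
    rw [mul_zero] at h1
    filter_upwards [hb', ev_norm (h1.eventually (eventually_le_nhds ha)), ev_pos] with y h2 h3 h4
    rw [(hdd y).fderiv] at h2
    refine h2.trans (le_trans (le_of_eq ?_) h3)
    simp only [hθ]; field_simp
  obtain ⟨hΦc, hΦk⟩ := Phi_boot hp' hΦ hmul hci hlip hcmp ha hMc hsmall hp1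
  refine ⟨e, b0, c, 2 * a, by positivity, fun z => by rw [heM]; exact hMc z, hsym, ?_, ?_⟩
  · simp only [heM, hMi]; exact hLtr
  · refine core_final (w := w) (d := fun y => p y - M y - b0) hsym hv (fun x => ?_) (fun x => ?_) hθw hθ1 hΦc hΦk hw2 hd1
    · simp only [hp', heM]
    · simp only [hw, hU, hp', heM, hMi, hb0i]
      ring

end PartThirteen


section PartFourteen
open Filter Bornology Topology MeasureTheory Metric
open scoped ContDiff RealInnerProductSpace

section abs
variable {V : Type} [NormedAddCommGroup V] [InnerProductSpace ℝ V] [FiniteDimensional ℝ V]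

lemma spec_coer {ι : Type} [Fintype ι] (w : OrthonormalBasis ι ℝ V) {T : V →L[ℝ] V} {ν : ι → ℝ} (hν : ∀ j, 0 < ν j)
    (hT : ∀ j, T (w j) = ν j • w j) {S : ℝ} (hS : ∑ j, 1 / ν j ≤ S) (hS0 : 0 < S) (z : V) :
    S⁻¹ * ‖z‖ ^ 2 ≤ ⟪T z, z⟫ := by
  have h1 : ∀ j, S⁻¹ ≤ ν j := by
    intro j
    have : 1 / ν j ≤ S := (Finset.single_le_sum (f := fun j => 1 / ν j) (fun i _ => by have := hν i; positivity)
      (Finset.mem_univ j)).trans hS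
    rw [div_le_iff₀ (hν j)] at this
    rw [inv_eq_one_div, div_le_iff₀ hS0]
    linarith
  have h2 : T z = ∑ j, (⟪w j, z⟫ * ν j) • w j := by
    conv_lhs => rw [← w.sum_repr' z]
    rw [map_sum]
    refine Finset.sum_congr rfl fun j _ => ?_
    rw [map_smul, hT, smul_smul]
  have h3 : ‖z‖ ^ 2 = ∑ j, ⟪w j, z⟫ * ⟪w j, z⟫ := by
    rw [← real_inner_self_eq_norm_sq, ← w.sum_inner_mul_inner]
    refine Finset.sum_congr rfl fun j _ => ?_
    rw [real_inner_comm]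
  rw [h2, sum_inner, h3, Finset.mul_sum]
  refine Finset.sum_le_sum fun j _ => ?_
  rw [real_inner_smul_left]
  nlinarith [h1 j, mul_self_nonneg ⟪w j, z⟫]

lemma spec_trace {ι κ : Type} [Fintype ι] [Fintype κ] (w : OrthonormalBasis ι ℝ V) (b : OrthonormalBasis κ ℝ V)
    {T N : V →L[ℝ] V} {ν : ι → ℝ} (hν : ∀ j, 0 < ν j)
    (hT : ∀ j, T (w j) = ν j • w j) (hN : T * N = 1) : ∑ i, ⟪N (b i), b i⟫ = ∑ j, 1 / ν j := by
  have hN' : N * T = 1 := by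
    have h1 : ((T : V →ₗ[ℝ] V)) * (N : V →ₗ[ℝ] V) = 1 := by
      ext z; exact DFunLike.congr_fun hN z
    have h2 := mul_eq_one_comm.1 h1
    ext z; exact DFunLike.congr_fun h2 z
  have h1 : ∀ j, N (w j) = (1 / ν j) • w j := by
    intro j
    have h2 : N (T (w j)) = w j := DFunLike.congr_fun hN' (w j)
    rw [hT, map_smul] at h2
    rw [← h2, smul_smul, one_div, inv_mul_cancel₀ (hν j).ne', one_smul, h2]
  have h2 := (LinearMap.trace_eq_sum_inner (N : V →ₗ[ℝ] V) b).symm.trans (LinearMap.trace_eq_sum_inner (N : V →ₗ[ℝ] V) w)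
  calc ∑ i, ⟪N (b i), b i⟫ = ∑ i, ⟪b i, N (b i)⟫ := Finset.sum_congr rfl fun j _ => real_inner_comm _ _
    _ = ∑ j, ⟪w j, N (w j)⟫ := h2
    _ = _ := Finset.sum_congr rfl fun j _ => by
      rw [h1, real_inner_smul_right, real_inner_self_eq_norm_sq, w.norm_eq_one]; simp

end abs

variable {n : ℕ}


lemma eu_inner (T : EuclideanSpace ℝ (Fin n) →L[ℝ] EuclideanSpace ℝ (Fin n)) (x y : EuclideanSpace ℝ (Fin n)) : ⟪T x, y⟫ =
    ∑ i, ∑ j, ⟪T (EuclideanSpace.single i 1), EuclideanSpace.single j 1⟫ * x i * y j := by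
  have hx := (EuclideanSpace.basisFun (Fin n) ℝ).sum_repr x
  have hy := (EuclideanSpace.basisFun (Fin n) ℝ).sum_repr y
  simp only [EuclideanSpace.basisFun_repr, EuclideanSpace.basisFun_apply] at hx hy
  conv_lhs => rw [← hx, ← hy]
  rw [map_sum, sum_inner]
  refine Finset.sum_congr rfl fun i _ => ?_
  rw [inner_sum]
  refine Finset.sum_congr rfl fun j _ => ?_
  rw [map_smul, real_inner_smul_left, real_inner_smul_right]
  ring

lemma eu_eig {M : Matrix (Fin n) (Fin n) ℝ} (hM : M.IsHermitian) (T : EuclideanSpace ℝ (Fin n) →L[ℝ] EuclideanSpace ℝ (Fin n))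
    (hT : ∀ i j, ⟪T (EuclideanSpace.single i 1), EuclideanSpace.single j 1⟫ = (M + 1) i j) (k : Fin n) :
    T (hM.eigenvectorBasis k) = (1 + hM.eigenvalues k) • hM.eigenvectorBasis k := by
  ext i
  have h1 := congrFun (hM.mulVec_eigenvectorBasis k) i
  have h2 : T (hM.eigenvectorBasis k) i = ⟪T (hM.eigenvectorBasis k), EuclideanSpace.single i 1⟫ := by
    rw [EuclideanSpace.inner_single_right]; simp
  rw [h2, eu_inner]
  simp only [Matrix.mulVec, dotProduct, Pi.smul_apply, smul_eq_mul] at h1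
  have hs : ∀ a b, M a b = M b a := fun a b => by
    have := hM.apply b a; simpa using this.symm ▸ rfl
  have : ∀ a, ∑ j, ⟪T (EuclideanSpace.single a 1), EuclideanSpace.single j 1⟫ * (hM.eigenvectorBasis k) a *
      (EuclideanSpace.single i (1:ℝ) : EuclideanSpace ℝ (Fin n)) j = (M i a + (1 : Matrix (Fin n) (Fin n) ℝ) i a) * (hM.eigenvectorBasis k) a := by
    intro a
    rw [Finset.sum_eq_single i]
    · rw [hT, Matrix.add_apply, hs a i, Matrix.one_apply, Matrix.one_apply]
      simp [eq_comm]
    · intro j _ hj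
      simp [hj]
    · simp
  simp only [this, add_mul, Finset.sum_add_distrib, h1, PiLp.smul_apply, smul_eq_mul]
  rw [Finset.sum_eq_single i]
  · simp; ring
  · intro j _ hj
    simp [Matrix.one_apply, hj.symm]
  · simp

lemma eu_pos {M : Matrix (Fin n) (Fin n) ℝ} (hM : M.PosDef) (T : EuclideanSpace ℝ (Fin n) →L[ℝ] EuclideanSpace ℝ (Fin n))
    (hT : ∀ i j, ⟪T (EuclideanSpace.single i 1), EuclideanSpace.single j 1⟫ = M i j) {z : EuclideanSpace ℝ (Fin n)} (hz : z ≠ 0) :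
    0 < ⟪T z, z⟫ := by
  have h := hM.dotProduct_mulVec_pos (x := WithLp.ofLp z) (by simpa using hz)
  rw [eu_inner]
  simp only [hT]
  refine h.trans_le (le_of_eq ?_)
  simp only [dotProduct, Matrix.mulVec, Finset.mul_sum]
  refine Finset.sum_congr rfl fun i _ => Finset.sum_congr rfl fun j _ => ?_
  simp; ring

lemma eu_posDef {M : Matrix (Fin n) (Fin n) ℝ} (hM : M.IsHermitian) (T : EuclideanSpace ℝ (Fin n) →L[ℝ] EuclideanSpace ℝ (Fin n))
    (hT : ∀ i j, ⟪T (EuclideanSpace.single i 1), EuclideanSpace.single j 1⟫ = M i j)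
    (h : ∀ z : EuclideanSpace ℝ (Fin n), z ≠ 0 → 0 < ⟪T z, z⟫) : M.PosDef := by
  rw [Matrix.posDef_iff_dotProduct_mulVec]
  refine ⟨hM, fun x hx => ?_⟩
  have h1 := h (WithLp.toLp 2 x) (by simpa using hx)
  rw [eu_inner] at h1
  simp only [hT] at h1
  refine h1.trans_le (le_of_eq ?_)
  simp only [dotProduct, Matrix.mulVec, Finset.mul_sum]
  refine Finset.sum_congr rfl fun i _ => Finset.sum_congr rfl fun j _ => ?_
  simp; ring

lemma eu_eig_pos {M : Matrix (Fin n) (Fin n) ℝ} (hM : M.IsHermitian) (T : EuclideanSpace ℝ (Fin n) →L[ℝ] EuclideanSpace ℝ (Fin n))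
    (hT : ∀ i j, ⟪T (EuclideanSpace.single i 1), EuclideanSpace.single j 1⟫ = (M + 1) i j) 
    (h : ∀ z : EuclideanSpace ℝ (Fin n), z ≠ 0 → 0 < ⟪T z, z⟫) (k : Fin n) : 0 < 1 + hM.eigenvalues k := by
  have h0 : ‖hM.eigenvectorBasis k‖ = 1 := hM.eigenvectorBasis.norm_eq_one k
  have h1 := h (hM.eigenvectorBasis k) (by intro h2; rw [h2] at h0; simp at h0)
  rw [eu_eig hM T hT, real_inner_smul_left, real_inner_self_eq_norm_sq, h0] at h1
  simpa using h1

end PartFourteen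


section PartFifteen
open Filter Bornology Topology MeasureTheory Metric
open scoped ContDiff RealInnerProductSpace

lemma decay_global {V : Type} [NormedAddCommGroup V] [NormedSpace ℝ V] [FiniteDimensional ℝ V] {q : V → ℝ}
    (hq : Continuous q) {ζ : ℝ} (hζ : 0 < ζ) {C R : ℝ} (h : ∀ x, R ≤ ‖x‖ → ‖x‖ ^ ζ * ‖q x‖ ≤ C) :
    ∃ K : ℝ, 0 ≤ K ∧ ∀ x, ‖q x‖ ≤ K * (1 + ‖x‖) ^ (-ζ) := by
  have hc : Continuous (fun x => ‖q x‖ * (1 + ‖x‖) ^ ζ) :=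
    hq.norm.mul ((continuous_const.add continuous_norm).rpow_const fun x => Or.inr hζ.le)
  obtain ⟨B, hB⟩ := (isCompact_closedBall (0 : V) (max R 1)).exists_bound_of_continuousOn hc.continuousOn
  refine ⟨|B| + 2 ^ ζ * |C|, by positivity, fun x => ?_⟩
  have hp : 0 < 1 + ‖x‖ := by positivity
  rw [Real.rpow_neg hp.le, ← div_eq_mul_inv, le_div_iff₀ (by positivity)]
  rcases le_total ‖x‖ (max R 1) with h1 | h1
  · have h2 := hB x (by simpa using h1)
    have h3 : (0:ℝ) ≤ 2 ^ ζ * |C| := by positivity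
    have h4 := (le_abs_self _).trans h2
    linarith [le_abs_self B]
  · have h2 := h x ((le_max_left _ _).trans h1)
    have h3 : 1 ≤ ‖x‖ := (le_max_right _ _).trans h1
    have h4 : (1 + ‖x‖) ^ ζ ≤ 2 ^ ζ * ‖x‖ ^ ζ := by
      rw [← Real.mul_rpow (by norm_num) (norm_nonneg _)]
      exact Real.rpow_le_rpow hp.le (by linarith) hζ.le
    calc ‖q x‖ * (1 + ‖x‖) ^ ζ ≤ ‖q x‖ * (2 ^ ζ * ‖x‖ ^ ζ) := by gcongr
      _ = 2 ^ ζ * (‖x‖ ^ ζ * ‖q x‖) := by ring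
      _ ≤ 2 ^ ζ * |C| := by gcongr; exact h2.trans (le_abs_self C)
      _ ≤ _ := by linarith [abs_nonneg B]

lemma decay_SH {V : Type} [NormedAddCommGroup V] [NormedSpace ℝ V] [FiniteDimensional ℝ V] {q : V → ℝ} {m : ℕ} {ζ : ℝ}
    {K : Set V} (hK : IsCompact K) (hq : ContDiffOn ℝ (m + 1 : ℕ) q Kᶜ)
    (hd : ∀ k : ℕ, k ≤ m + 1 → ∃ C R : ℝ, 0 < C ∧ 0 < R ∧
      ∀ x, R ≤ ‖x‖ → ‖x‖ ^ (ζ + k) * ‖iteratedFDeriv ℝ k q x‖ ≤ C) : SH m ℝ q (fun r => r ^ (-ζ)) := by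
  refine SH_of_iterated (Wt.rpow _) ?_ ?_
  · have : Kᶜ ∈ cobounded V := hK.isBounded
    filter_upwards [this] with y hy
    exact (hq y hy).contDiffAt (hK.isClosed.isOpen_compl.mem_nhds hy)
  · intro j hj
    obtain ⟨C, R, -, -, h⟩ := hd j hj
    refine ⟨C, ?_⟩
    filter_upwards [ev_norm (V := V) (eventually_ge_atTop R), ev_pos] with y h1 h2
    have h3 := h y h1
    rw [Real.rpow_add h2, Real.rpow_natCast] at h3
    rw [Real.rpow_neg h2.le, ← mul_div_assoc, ← div_eq_mul_inv, div_div, le_div_iff₀ (by positivity)]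
    linarith

set_option maxHeartbeats 1000000 in
theorem main_aux (n m : ℕ) (hn : 3 ≤ n) (ζ : ℝ) (hζ : 2 < ζ) {Θ : ℝ → ℝ} (hT : Tail n ζ Θ)
    (f : EuclideanSpace ℝ (Fin n) → ℝ) (finf : ℝ)
    (hf_cont : Continuous f)
    (hf_Cm : ∃ K : Set (EuclideanSpace ℝ (Fin n)), IsCompact K ∧ ContDiffOn ℝ (m + 1 : ℕ) f Kᶜ)
    (hf_decay : ∀ k : ℕ, k ≤ m + 1 → ∃ C R : ℝ, 0 < C ∧ 0 < R ∧
      ∀ x : EuclideanSpace ℝ (Fin n), R ≤ ‖x‖ →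
        ‖x‖ ^ (ζ + k) * ‖iteratedFDeriv ℝ k (fun y => f y - finf) x‖ ≤ C)
    (u : EuclideanSpace ℝ (Fin n) → ℝ) (hu : ContDiff ℝ 2 u)
    (hsym : ∀ x, (hess u x).IsHermitian)
    (heq : ∀ x, -Real.sqrt 2 * ∑ i, 1 / (1 + (hsym x).eigenvalues i) = f x)
    (hgrow : ∃ C : ℝ, ∀ x : EuclideanSpace ℝ (Fin n), u x ≤ C * (1 + ‖x‖ ^ 2))
    (hsemiconv : ∀ x, (hess u x + 1).PosDef) :
    ∃ (c : ℝ) (b : Fin n → ℝ) (A : Matrix (Fin n) (Fin n) ℝ) (hA : A.IsHermitian),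
      (A + 1).PosDef ∧
      (-Real.sqrt 2 * ∑ i, 1 / (1 + hA.eigenvalues i) = finf) ∧
      SH (m + 2) ℝ (fun y => u y - ((1/2) * ∑ i, ∑ j, A i j * y i * y j + ∑ i, b i * y i + c))
        (fun r => r ^ 2 * Θ r) := by
  have hfr : Module.finrank ℝ (EuclideanSpace ℝ (Fin n)) = n := finrank_euclideanSpace_fin
  have : Nontrivial (EuclideanSpace ℝ (Fin n)) := Module.nontrivial_of_finrank_pos (R := ℝ) (by rw [hfr]; omega)
  have h2 : (0:ℝ) < √2 := by positivity
  set G : (EuclideanSpace ℝ (Fin n)) → ℝ := fun x => -(√2)⁻¹ * (f x - finf) with hG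
  set g0 : ℝ := -(√2)⁻¹ * finf with hg0
  have hsum : ∀ x, ∑ i, 1 / (1 + (hsym x).eigenvalues i) = g0 + G x := by
    intro x
    have := heq x
    simp only [hG, hg0]
    rw [← this]
    field_simp
    ring
  have hGc : Continuous G := continuous_const.mul (hf_cont.sub continuous_const)
  obtain ⟨K, hK, hGK⟩ : ∃ K : ℝ, 0 ≤ K ∧ ∀ x, ‖G x‖ ≤ K * (1 + ‖x‖) ^ (-ζ) := by
    obtain ⟨C, R, -, -, h⟩ := hf_decay 0 (by omega)
    obtain ⟨K, hK, h1⟩ := decay_global (q := fun y => f y - finf) (hf_cont.sub continuous_const) (by linarith : 0 < ζ)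
      (C := C) (R := R) (fun x hx => by simpa using h x hx)
    refine ⟨(√2)⁻¹ * K, by positivity, fun x => ?_⟩
    simp only [hG]
    rw [norm_mul, norm_neg, Real.norm_of_nonneg (by positivity), mul_assoc]
    gcongr
    exact h1 x
  have hGS : SH m ℝ G (fun r => r ^ (-ζ)) := by
    obtain ⟨S, hS, hS'⟩ := hf_Cm
    have h1 := decay_SH (q := fun y => f y - finf) hS (hS'.sub contDiffOn_const) hf_decay
    exact h1.clm (Wt.rpow _).1 ((-(√2)⁻¹) • ContinuousLinearMap.id ℝ ℝ)
  have hud : ∀ x, HasFDerivAt u (fderiv ℝ u x) x := fun x => (hu.differentiable (by simp) x).hasFDerivAt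
  have hu1 : ContDiff ℝ 1 (fderiv ℝ u) := hu.fderiv_right (by norm_num)
  set v : (EuclideanSpace ℝ (Fin n)) → ℝ := fun x => u x + (1/2) * ‖x‖ ^ 2 with hv
  set Φ : (EuclideanSpace ℝ (Fin n)) → (EuclideanSpace ℝ (Fin n)) := fun x => rz (EuclideanSpace ℝ (Fin n)) (fderiv ℝ u x) + x with hΦ
  have hvd : ∀ x, HasFDerivAt v (innerSL ℝ (Φ x)) x := by
    intro x
    have h1 := (hud x).add (((hasStrictFDerivAt_norm_sq x).hasFDerivAt).const_mul (1/2))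
    refine h1.congr_fderiv ?_
    ext z
    simp only [hΦ, innerSL_apply_apply, inner_add_left, rz_inner]
    simp
  have hΦC : ContDiff ℝ 1 Φ := ((rz (EuclideanSpace ℝ (Fin n))).contDiff.comp hu1).add contDiff_id
  have hΦd : ∀ x, fderiv ℝ Φ x = (rz (EuclideanSpace ℝ (Fin n))).comp (fderiv ℝ (fderiv ℝ u) x) + ContinuousLinearMap.id ℝ (EuclideanSpace ℝ (Fin n)) := by
    intro x
    have h1 : HasFDerivAt (fderiv ℝ u) (fderiv ℝ (fderiv ℝ u) x) x := (hu1.differentiable (by simp) x).hasFDerivAt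
    exact (((rz (EuclideanSpace ℝ (Fin n))).hasFDerivAt.comp x h1).add (hasFDerivAt_id x)).fderiv
  have hmat : ∀ x i j, ⟪fderiv ℝ Φ x (EuclideanSpace.single i 1), EuclideanSpace.single j 1⟫ = (hess u x + 1) i j := by
    intro x i j
    rw [hΦd, _root_.add_apply, inner_add_left, Matrix.add_apply]
    congr 1
    · rw [ContinuousLinearMap.comp_apply, rz_inner]
      simp only [hess, Matrix.of_apply, iteratedFDeriv_two_apply]
      rfl
    · simp [Matrix.one_apply, EuclideanSpace.inner_single_left, eq_comm]
  have hpos : ∀ x (z : (EuclideanSpace ℝ (Fin n))), z ≠ 0 → 0 < ⟪fderiv ℝ Φ x z, z⟫ := fun x z hz => eu_pos (hsemiconv x) _ (hmat x) hz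
  have hνp : ∀ x k, 0 < 1 + (hsym x).eigenvalues k := fun x k => eu_eig_pos (hsym x) _ (hmat x) (hpos x) k
  have hνe : ∀ x k, fderiv ℝ Φ x ((hsym x).eigenvectorBasis k) = (1 + (hsym x).eigenvalues k) • (hsym x).eigenvectorBasis k :=
    fun x k => eu_eig (hsym x) _ (hmat x) k
  have hS0 : 0 < |g0| + K + 1 := by positivity
  have hSle : ∀ x, ∑ i, 1 / (1 + (hsym x).eigenvalues i) ≤ |g0| + K + 1 := by
    intro x
    rw [hsum]
    have h3 : (1 + ‖x‖) ^ (-ζ) ≤ 1 := Real.rpow_le_one_of_one_le_of_nonpos (by linarith [norm_nonneg x]) (by linarith)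
    have h4 := (le_abs_self _).trans (hGK x)
    nlinarith [le_abs_self g0]
  have hco : ∀ x z, (|g0| + K + 1)⁻¹ * ‖z‖ ^ 2 ≤ ⟪fderiv ℝ Φ x z, z⟫ := fun x z =>
    spec_coer (hsym x).eigenvectorBasis (hνp x) (hνe x) (hSle x) hS0 z
  have hgv : ∃ C : ℝ, ∀ x, v x ≤ C * (1 + ‖x‖ ^ 2) := by
    obtain ⟨C, hC⟩ := hgrow
    refine ⟨C + 1/2, fun x => ?_⟩
    have := hC x
    simp only [hv]
    linarith
  obtain ⟨e, b0, c, a, ha, hec, hes, htr, hE⟩ := core (V := EuclideanSpace ℝ (Fin n)) (by linarith : 0 < ζ) (by rw [hfr]; exact hT) hvd hΦC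
    (inv_pos.2 hS0) hco hgv (EuclideanSpace.basisFun (Fin n) ℝ) hGc
    (fun x N hN => (spec_trace (hsym x).eigenvectorBasis (EuclideanSpace.basisFun (Fin n) ℝ) (hνp x) (hνe x) hN).trans (hsum x))
    hK hGK hGS
  have hss : ∀ x y, ⟪e.symm x, y⟫ = ⟪x, e.symm y⟫ := by
    intro x y
    have := hes (e.symm x) (e.symm y)
    simpa using this.symm
  set T : (EuclideanSpace ℝ (Fin n)) →L[ℝ] (EuclideanSpace ℝ (Fin n)) := (e.symm : (EuclideanSpace ℝ (Fin n)) →L[ℝ] (EuclideanSpace ℝ (Fin n))) with hTdef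
  have hTe : ∀ z, T z = e.symm z := fun z => rfl
  set A : Matrix (Fin n) (Fin n) ℝ := (Matrix.of fun i j => ⟪T (EuclideanSpace.single i 1), EuclideanSpace.single j 1⟫) - 1 with hA
  have hA1 : ∀ i j, ⟪T (EuclideanSpace.single i 1), EuclideanSpace.single j 1⟫ = (A + 1) i j := by
    intro i j
    rw [hA, sub_add_cancel]; rfl
  have hA1h : (A + 1).IsHermitian := by
    ext i j
    rw [Matrix.conjTranspose_apply, ← hA1, ← hA1, hTe, hTe, hss, real_inner_comm]
    simp
  have hAh : A.IsHermitian := by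
    have := hA1h.sub (Matrix.isHermitian_one (n := Fin n) (α := ℝ))
    rwa [add_sub_cancel_right] at this
  have hTp : ∀ z : (EuclideanSpace ℝ (Fin n)), z ≠ 0 → 0 < ⟪T z, z⟫ := by
    intro z hz
    have h1 := hec (e.symm z)
    have h3 : 0 < ‖e.symm z‖ := norm_pos_iff.2 (by simpa using hz)
    rw [e.apply_symm_apply, real_inner_comm] at h1
    exact lt_of_lt_of_le (by positivity) h1
  refine ⟨(1/2) * ⟪T b0, b0⟫ - c, fun i => -(T b0) i, A, hAh, eu_posDef hA1h T hA1 hTp, ?_, ?_⟩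
  · have h1 := spec_trace hAh.eigenvectorBasis (EuclideanSpace.basisFun (Fin n) ℝ) (T := T) (N := (e : (EuclideanSpace ℝ (Fin n)) →L[ℝ] (EuclideanSpace ℝ (Fin n))))
      (eu_eig_pos hAh T hA1 hTp) (eu_eig hAh T hA1) (by ext z; simp [hTdef])
    rw [← h1]
    refine (congrArg (fun t => -√2 * t) htr).trans ?_
    simp only [hg0]
    field_simp
  · refine hE.congr (Eventually.of_forall fun y => ?_)
    have h1 := eu_inner T y y
    simp only [hA1] at h1
    have h3 : ∑ i, ∑ j, (A + 1) i j * y i * y j = ∑ i, ∑ j, A i j * y i * y j + ‖y‖ ^ 2 := by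
      rw [EuclideanSpace.real_norm_sq_eq, ← Finset.sum_add_distrib]
      refine Finset.sum_congr rfl fun i _ => ?_
      simp only [Matrix.add_apply, add_mul, Finset.sum_add_distrib]
      congr 1
      rw [Finset.sum_eq_single i]
      · simp; ring
      · intro j _ hj
        simp [hj.symm]
      · simp
    have h4 : ∑ i, -(T b0) i * y i = -⟪T b0, y⟫ := by
      rw [PiLp.inner_apply, ← Finset.sum_neg_distrib]
      refine Finset.sum_congr rfl fun i _ => ?_
      simp; ring
    rw [h4]
    have h5 := hss y b0
    have h6 := real_inner_comm y (e.symm b0)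
    simp only [hv, map_sub, inner_sub_left, inner_sub_right]
    simp only [hTe] at *
    linarith

end PartFifteen

/-- **Theorem 1.1, case τ = π/4**: if `u ∈ C²(ℝⁿ)` solves
`-√2 Σᵢ 1/(1+λᵢ(D²u)) = f` with `u ≤ C(1+|x|²)`, `D²u + I > 0`, `n ≥ 3`, and `f` is `C^m`
outside a compact set with `|x|^{ζ+k}|D^k(f - f(∞))|` bounded at infinity for all `k ≤ m`,
`ζ > 2`, `m ≥ 2`, then `u` is asymptotic to a quadratic polynomial `½xᵀAx + b·x + c` with
`A + I > 0` and `-√2 Σᵢ 1/(1+λᵢ(A)) = f(∞)`, with error `O_{m+1}(|x|^{2-min{n,ζ}})`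
(`O_{m+1}(|x|^{2-n}ln|x|)` if `ζ = n`). -/
theorem asymptotic_expansion_tau_pi_div_four
    (n m : ℕ) (hn : 3 ≤ n) (hm : 2 ≤ m) (ζ : ℝ) (hζ : 2 < ζ)
    (f : EuclideanSpace ℝ (Fin n) → ℝ) (finf : ℝ)
    (hf_cont : Continuous f)
    (hf_Cm : ∃ K : Set (EuclideanSpace ℝ (Fin n)), IsCompact K ∧ ContDiffOn ℝ m f Kᶜ)
    (hf_lim : Tendsto f (cocompact _) (nhds finf))
    (hf_decay : ∀ k : ℕ, k ≤ m → ∃ C R : ℝ, 0 < C ∧ 0 < R ∧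
      ∀ x : EuclideanSpace ℝ (Fin n), R ≤ ‖x‖ →
        ‖x‖ ^ (ζ + k) * ‖iteratedFDeriv ℝ k (fun y => f y - finf) x‖ ≤ C)
    (u : EuclideanSpace ℝ (Fin n) → ℝ) (hu : ContDiff ℝ 2 u)
    (hsym : ∀ x, (hess u x).IsHermitian)
    (heq : ∀ x, -Real.sqrt 2 * ∑ i, 1 / (1 + (hsym x).eigenvalues i) = f x)
    (hgrow : ∃ C : ℝ, ∀ x : EuclideanSpace ℝ (Fin n), u x ≤ C * (1 + ‖x‖ ^ 2))
    (hsemiconv : ∀ x, (hess u x + 1).PosDef) :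
    ∃ (c : ℝ) (b : Fin n → ℝ) (A : Matrix (Fin n) (Fin n) ℝ) (hA : A.IsHermitian),
      (A + 1).PosDef ∧
      (-Real.sqrt 2 * ∑ i, 1 / (1 + hA.eigenvalues i) = finf) ∧
      ((ζ ≠ n → ∀ k : ℕ, k ≤ m + 1 → ∃ C R : ℝ, 0 < C ∧ 1 < R ∧
        ∀ x : EuclideanSpace ℝ (Fin n), R ≤ ‖x‖ →
          ‖iteratedFDeriv ℝ k
              (fun y => u y - ((1/2) * ∑ i, ∑ j, A i j * y i * y j + ∑ i, b i * y i + c)) x‖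
            ≤ C * ‖x‖ ^ ((2 : ℝ) - min (n : ℝ) ζ - k)) ∧
      (ζ = n → ∀ k : ℕ, k ≤ m + 1 → ∃ C R : ℝ, 0 < C ∧ 1 < R ∧
        ∀ x : EuclideanSpace ℝ (Fin n), R ≤ ‖x‖ →
          ‖iteratedFDeriv ℝ k
              (fun y => u y - ((1/2) * ∑ i, ∑ j, A i j * y i * y j + ∑ i, b i * y i + c)) x‖
            ≤ C * ‖x‖ ^ ((2 : ℝ) - n - k) * Real.log ‖x‖)) := by
  obtain ⟨m, rfl⟩ : ∃ m', m = m' + 1 := ⟨m - 1, by omega⟩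
  by_cases hne : ζ = n
  · subst hne
    obtain ⟨c, b, A, hA, h1, h2, h3⟩ := main_aux n m hn n hζ (tail_log hn) f finf hf_cont hf_Cm hf_decay u hu hsym heq
      hgrow hsemiconv
    refine ⟨c, b, A, hA, h1, h2, fun h => absurd rfl h, fun _ k hk => ?_⟩
    obtain ⟨C, hC, hb⟩ := h3.iterated hk
    obtain ⟨R, hR⟩ := ev_cob.1 hb
    refine ⟨C, max R 2, hC, lt_of_lt_of_le (by norm_num) (le_max_right _ _), fun x hx => ?_⟩
    have h4 := hR x ((le_max_left _ _).trans hx)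
    have h5 : 0 < ‖x‖ := lt_of_lt_of_le (by norm_num) ((le_max_right _ _).trans hx)
    refine h4.trans (le_of_eq ?_)
    rw [Real.rpow_sub h5, Real.rpow_sub h5, Real.rpow_natCast ‖x‖ k, Real.rpow_neg h5.le, Real.rpow_two]
    ring
  · obtain ⟨c, b, A, hA, h1, h2, h3⟩ := main_aux n m hn ζ hζ (tail_pow hn hζ hne) f finf hf_cont hf_Cm hf_decay u hu hsym heq
      hgrow hsemiconv
    refine ⟨c, b, A, hA, h1, h2, fun _ k hk => ?_, fun h => absurd h hne⟩
    obtain ⟨C, hC, hb⟩ := h3.iterated hk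
    obtain ⟨R, hR⟩ := ev_cob.1 hb
    refine ⟨C, max R 2, hC, lt_of_lt_of_le (by norm_num) (le_max_right _ _), fun x hx => ?_⟩
    have h4 := hR x ((le_max_left _ _).trans hx)
    have h5 : 0 < ‖x‖ := lt_of_lt_of_le (by norm_num) ((le_max_right _ _).trans hx)
    refine h4.trans (le_of_eq ?_)
    rw [Real.rpow_sub h5, Real.rpow_sub h5, Real.rpow_natCast, Real.rpow_neg h5.le, Real.rpow_two]
    ring
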